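/- arXiv:1512.00962 — 6 statements merged into one kernel-verified Lean document; each statement's English description precedes it below -/
import Mathlib

section
/- For every prime power q with q ≡ 3 (mod 4), there exists a subset D of the nonzero elements of F_{q^6} such that: (i) λx ∈ D whenever x ∈ D and λ ∈ F_q^×; (ii) Tr_{q^3/q}(x^{q^3+1}) = 0 for all x ∈ D; (iii) |D| = (q^3+1)(q^2-1)/2; and (iv) for every nonzero a ∈ F_{q^6}, the character sum Σ_{x∈D} ψ(ax) equals -q^3 + (q^2-1)/2 if a^{q^3} ∈ D, and equals (q^2-1)/2 otherwise, where ψ is the canonical additive character of F_{q^6}. In particular, D takes exactly two nontrivial additive character values, so the Cayley graph Cay(F_{q^6}, D) is strongly regular. -/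
open scoped Classical

/-- The extension `K[X]/(X² + 1)`, which is a field when `-1` is not a square in `K`. -/
abbrev GaussExt (K : Type*) [Field K] := QuadraticAlgebra K (-1) 0

namespace GaussExt

variable {K : Type*} [Field K]

theorem fact_sq_ne [Fintype K] (hK : Fintype.card K % 4 = 3) :
    Fact (∀ r : K, r ^ 2 ≠ -1 + 0 * r) := by
  refine ⟨fun r hr => FiniteField.isSquare_neg_one_iff.mp ⟨r, ?_⟩ hK⟩
  rw [← sq, hr]; ring

noncomputable instance [Fintype K] : Fintype (GaussExt K) :=
  Fintype.ofEquiv _ (QuadraticAlgebra.equivProd (-1 : K) 0).symm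

theorem card_eq [Fintype K] : Fintype.card (GaussExt K) = Fintype.card K ^ 2 := by
  rw [Fintype.card_congr (QuadraticAlgebra.equivProd (-1 : K) 0), Fintype.card_prod, sq]

theorem sum_eq [Fintype K] {M : Type*} [AddCommMonoid M] (F : GaussExt K → M) :
    ∑ z, F z = ∑ a, ∑ b, F ⟨a, b⟩ := by
  rw [← Fintype.sum_prod_type', ← Equiv.sum_comp (QuadraticAlgebra.equivProd (-1 : K) 0).symm]
  rfl

theorem norm_eq (z : GaussExt K) : z.norm = z.re ^ 2 + z.im ^ 2 := by
  rw [QuadraticAlgebra.norm_def]; ring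

/-- The additive character `ψ ∘ re` of `GaussExt K`. -/
noncomputable def reChar (ψ : AddChar K ℂ) : AddChar (GaussExt K) ℂ :=
  ψ.compAddMonoidHom (QuadraticAlgebra.reₗ (-1 : K) 0).toAddMonoidHom

theorem reChar_apply (ψ : AddChar K ℂ) (z : GaussExt K) : reChar ψ z = ψ z.re := rfl

theorem isPrimitive_reChar [Fact (∀ r : K, r ^ 2 ≠ -1 + 0 * r)]
    {ψ : AddChar K ℂ} (hψ : ψ ≠ 1) : (reChar ψ).IsPrimitive := by
  apply AddChar.IsPrimitive.of_ne_one
  obtain ⟨a, ha⟩ := AddChar.ne_one_iff.mp hψ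
  exact AddChar.ne_one_iff.mpr ⟨⟨a, 0⟩, ha⟩

end GaussExt

/-- The quadratic character of a finite field with values in `ℂ`. -/
noncomputable def complexQuadraticChar (K : Type*) [Field K] [Fintype K] : MulChar K ℂ :=
  (quadraticChar K).ringHomComp (Int.castRingHom ℂ)

section QuadraticGaussSums

variable {K : Type*} [Field K] [Fintype K]

local notation "η" => complexQuadraticChar K

theorem complexQuadraticChar_apply (a : K) : η a = (quadraticChar K a : ℂ) := rfl

theorem complexQuadraticChar_sq {a : K} (ha : a ≠ 0) : η a ^ 2 = 1 := by
  rw [complexQuadraticChar_apply]; exact_mod_cast quadraticChar_sq_one ha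

theorem complexQuadraticChar_sq_left {a : K} (ha : a ≠ 0) : η (a ^ 2) = 1 := by
  rw [map_pow, complexQuadraticChar_sq ha]

theorem complexQuadraticChar_inv (a : K) : η a⁻¹ = η a := by
  rcases eq_or_ne a 0 with rfl | ha
  · simp
  · have h : η a⁻¹ * η a = 1 := by rw [← map_mul, inv_mul_cancel₀ ha, map_one]
    linear_combination η a * h - η a⁻¹ * complexQuadraticChar_sq ha

theorem complexQuadraticChar_eq_or {a : K} (ha : a ≠ 0) : η a = 1 ∨ η a = -1 :=
  sq_eq_one_iff.mp (complexQuadraticChar_sq ha)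

variable (hK : Fintype.card K % 4 = 3)
include hK

theorem ringChar_ne_two_of_card : ringChar K ≠ 2 := fun h => by
  have := FiniteField.even_card_of_char_two h
  omega

theorem two_ne_zero_of_card : (2 : K) ≠ 0 :=
  Ring.two_ne_zero (ringChar_ne_two_of_card hK)

theorem complexQuadraticChar_neg_one : η (-1) = -1 := by
  have h : ¬ IsSquare (-1 : K) := by simpa [FiniteField.isSquare_neg_one_iff] using hK
  rw [complexQuadraticChar_apply, quadraticChar_neg_one_iff_not_isSquare.mpr h]; simp

theorem complexQuadraticChar_neg (a : K) : η (-a) = -η a := by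
  rw [← neg_one_mul, map_mul, complexQuadraticChar_neg_one hK, neg_one_mul]

theorem complexQuadraticChar_ne_one : η ≠ 1 := fun h => by
  have := complexQuadraticChar_neg_one hK
  rw [h, MulChar.one_apply isUnit_one.neg] at this
  norm_num at this

theorem sum_complexQuadraticChar : ∑ a, η a = 0 :=
  MulChar.sum_eq_zero_of_ne_one (complexQuadraticChar_ne_one hK)

theorem sum_complexQuadraticChar_mul (ψ : AddChar K ℂ) (b : K) :
    ∑ a, η a * ψ (a * b) = η b * gaussSum η ψ := by
  rcases eq_or_ne b 0 with rfl | hb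
  · simp [sum_complexQuadraticChar hK, MulChar.map_zero]
  · have h := gaussSum_mulShift η ψ (Units.mk0 b hb)
    rw [← h, gaussSum, Units.val_mk0, ← mul_assoc, ← sq, complexQuadraticChar_sq hb, one_mul]
    simp only [AddChar.mulShift_apply, mul_comm b]

theorem gaussSum_complexQuadraticChar_sq {ψ : AddChar K ℂ} (hψ : ψ ≠ 1) :
    gaussSum η ψ ^ 2 = -Fintype.card K := by
  rw [gaussSum_sq (complexQuadraticChar_ne_one hK)
    ((quadraticChar_isQuadratic K).comp _) (AddChar.IsPrimitive.of_ne_one hψ),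
    complexQuadraticChar_neg_one hK, neg_one_mul]

/-- The number of square roots of `w` is `η w + 1`. -/
theorem sum_comp_sq (F : K → ℂ) : ∑ x, F (x ^ 2) = ∑ w, (η w + 1) * F w := by
  rw [← Finset.sum_fiberwise' Finset.univ (fun x : K => x ^ 2) F]
  refine Finset.sum_congr rfl fun w _ => ?_
  have h := quadraticChar_card_sqrts (ringChar_ne_two_of_card hK) w
  rw [Finset.sum_const, nsmul_eq_mul, complexQuadraticChar_apply]
  congr 1
  have h' : ((Finset.univ.filter fun x : K => x ^ 2 = w).card : ℤ) = quadraticChar K w + 1 := by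
    rw [← h]; congr 2; ext; simp
  exact_mod_cast h'

theorem sum_addChar_mul_sq {ψ : AddChar K ℂ} (hψ : ψ ≠ 1) {s : K} (hs : s ≠ 0) :
    ∑ x, ψ (s * x ^ 2) = η s * gaussSum η ψ := by
  rw [sum_comp_sq hK (fun w => ψ (s * w)), ← sum_complexQuadraticChar_mul hK]
  simp_rw [add_mul, one_mul, Finset.sum_add_distrib, mul_comm s]
  rw [AddChar.sum_mulShift s (AddChar.IsPrimitive.of_ne_one hψ), if_neg hs]
  simp

end QuadraticGaussSums

namespace GaussExt

variable {K : Type*} [Field K] [Fintype K]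

local notation "η" => complexQuadraticChar K

/-- The quadratic character of `GaussExt K`, written through the norm to `K`. -/
noncomputable def quadChar (z : GaussExt K) : ℂ := complexQuadraticChar K z.norm

theorem quadChar_mul (z w : GaussExt K) : quadChar (z * w) = quadChar z * quadChar w := by
  simp only [quadChar, map_mul]

theorem quadChar_zero : quadChar (0 : GaussExt K) = 0 := by
  rw [quadChar, QuadraticAlgebra.norm_zero, MulChar.map_zero]

theorem quadChar_neg (z : GaussExt K) : quadChar (-z) = quadChar z := by
  rw [quadChar, QuadraticAlgebra.norm_neg, quadChar]

theorem quadChar_algebraMap {a : K} (ha : a ≠ 0) :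
    quadChar (algebraMap K (GaussExt K) a) = 1 := by
  rw [quadChar, QuadraticAlgebra.norm_algebraMap, complexQuadraticChar_sq_left ha]

section

variable [Fact (∀ r : K, r ^ 2 ≠ -1 + 0 * r)]

omit [Fintype K] in
theorem norm_ne_zero {z : GaussExt K} (hz : z ≠ 0) : z.norm ≠ 0 :=
  fun h => hz (QuadraticAlgebra.norm_eq_zero_iff_eq_zero.mp h)

theorem quadChar_sq {z : GaussExt K} (hz : z ≠ 0) : quadChar z ^ 2 = 1 :=
  complexQuadraticChar_sq (norm_ne_zero hz)

theorem quadChar_eq_or {z : GaussExt K} (hz : z ≠ 0) : quadChar z = 1 ∨ quadChar z = -1 :=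
  complexQuadraticChar_eq_or (norm_ne_zero hz)

theorem quadChar_inv (z : GaussExt K) : quadChar z⁻¹ = quadChar z := by
  rcases eq_or_ne z 0 with rfl | hz
  · rw [inv_zero]
  · have h : quadChar z⁻¹ * quadChar z = 1 := by
      rw [← quadChar_mul, inv_mul_cancel₀ hz, quadChar, map_one, map_one]
    linear_combination quadChar z * h - quadChar z⁻¹ * quadChar_sq hz

theorem sum_reChar_mul {ψ : AddChar K ℂ} (hψ : ψ ≠ 1) (s : GaussExt K) :
    ∑ z, reChar ψ (z * s) = if s = 0 then (Fintype.card K : ℂ) ^ 2 else 0 := by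
  rw [AddChar.sum_mulShift s (isPrimitive_reChar hψ), card_eq]
  push_cast; rfl

end

theorem exists_norm_eq (hK : Fintype.card K % 4 = 3) (c : K) :
    ∃ z : GaussExt K, z.norm = c := by
  obtain ⟨a, b, h⟩ := FiniteField.exists_root_sum_quadratic (R := K)
    (f := Polynomial.X ^ 2) (g := Polynomial.X ^ 2 - Polynomial.C c)
    (Polynomial.degree_X_pow 2) (Polynomial.degree_X_pow_sub_C (by norm_num) c) (by omega)
  simp only [Polynomial.eval_pow, Polynomial.eval_X, Polynomial.eval_sub,
    Polynomial.eval_C] at h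
  exact ⟨⟨a, b⟩, by rw [norm_eq]; linear_combination h⟩

variable (hK : Fintype.card K % 4 = 3) {ψ : AddChar K ℂ} (hψ : ψ ≠ 1)
include hK hψ

theorem sum_reChar_mul_sq {s : GaussExt K} (hs : s ≠ 0) :
    ∑ z, reChar ψ (s * z ^ 2) = Fintype.card K * quadChar s := by
  have := fact_sq_ne hK
  have h2 := two_ne_zero_of_card hK
  have hn := norm_ne_zero hs
  have hG := gaussSum_complexQuadraticChar_sq hK hψ
  obtain ⟨α, β⟩ := s
  have key (a b : K) : ((⟨α, β⟩ : GaussExt K) * (⟨a, b⟩ : GaussExt K) ^ 2).re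
      = α * a ^ 2 - α * b ^ 2 - 2 * β * a * b := by
    simp [sq]; ring
  have hN : (⟨α, β⟩ : GaussExt K).norm = α ^ 2 + β ^ 2 := by rw [norm_eq]
  rw [hN] at hn
  rw [sum_eq, quadChar, hN]
  simp_rw [reChar_apply, key]
  rcases eq_or_ne α 0 with rfl | hα
  · have hβ : β ≠ 0 := by rintro rfl; simp at hn
    have h (a : K) : ∑ b, ψ (0 * a ^ 2 - 0 * b ^ 2 - 2 * β * a * b)
        = if a = 0 then (Fintype.card K : ℂ) else 0 := by
      have := AddChar.sum_mulShift (-2 * β * a) (AddChar.IsPrimitive.of_ne_one hψ)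
      simp only [mul_eq_zero, neg_eq_zero, h2, hβ, false_or] at this
      push_cast at this
      rw [← this]
      refine Finset.sum_congr rfl fun b _ => congrArg ψ (by ring)
    simp_rw [h]
    rw [Finset.sum_ite_eq' Finset.univ (0 : K)]
    simp [complexQuadraticChar_sq hβ]
  · rw [Finset.sum_comm]
    have h (b : K) : ∑ a, ψ (α * a ^ 2 - α * b ^ 2 - 2 * β * a * b)
        = η α * gaussSum η ψ * ψ (-((α ^ 2 + β ^ 2) / α) * b ^ 2) := by
      rw [← sum_addChar_mul_sq hK hψ hα, Finset.sum_mul,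
        ← Equiv.sum_comp (Equiv.addRight (β * b / α))]
      refine Finset.sum_congr rfl fun a _ => ?_
      rw [← AddChar.map_add_eq_mul]
      congr 1
      simp only [Equiv.coe_addRight]
      field_simp
      ring
    simp_rw [h]
    rw [← Finset.mul_sum, sum_addChar_mul_sq hK hψ (neg_ne_zero.mpr (div_ne_zero hn hα)),
      complexQuadraticChar_neg hK, div_eq_mul_inv, map_mul, complexQuadraticChar_inv]
    linear_combination (-η α ^ 2 * η (α ^ 2 + β ^ 2)) * hG
      + (Fintype.card K) * η (α ^ 2 + β ^ 2) * complexQuadraticChar_sq hα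

theorem sum_quadChar_mul_reChar (s : GaussExt K) :
    ∑ z, quadChar z * reChar ψ (z * s) = Fintype.card K * quadChar s := by
  have := fact_sq_ne hK
  have h2 := two_ne_zero_of_card hK
  have hq : (Fintype.card K : ℂ) ≠ 0 := by simp
  have main : ∑ z : GaussExt K, quadChar z * reChar ψ z = Fintype.card K := by
    let I : GaussExt K := ⟨0, 1⟩
    have hI : I ^ 2 = -1 := by
      ext <;> simp [I, sq, QuadraticAlgebra.re_one, QuadraticAlgebra.im_one]
    have hI' : I ≠ -I := fun h => h2 (by
      have := congrArg QuadraticAlgebra.im h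
      simp only [I, QuadraticAlgebra.im_neg] at this
      linear_combination this)
    have h1 : ∑ x : GaussExt K, ∑ z, reChar ψ (z * (x ^ 2 + 1)) = 2 * (Fintype.card K : ℂ) ^ 2 := by
      simp_rw [sum_reChar_mul hψ]
      rw [← Finset.sum_filter, Finset.sum_const, nsmul_eq_mul]
      have : (Finset.univ.filter fun x : GaussExt K => x ^ 2 + 1 = 0) = {I, -I} := by
        ext x
        have : x ^ 2 + 1 = (x - I) * (x + I) := by linear_combination hI
        rw [Finset.mem_filter, this]
        simp [sub_eq_zero, add_eq_zero_iff_eq_neg]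
      rw [this, Finset.card_pair hI']
      norm_num
    have h3 (z : GaussExt K) : ∑ x, reChar ψ (z * (x ^ 2 + 1))
        = Fintype.card K * (quadChar z * reChar ψ z)
          + if z = 0 then (Fintype.card K : ℂ) ^ 2 else 0 := by
      split_ifs with hz
      · simp [hz, quadChar_zero, card_eq]
      · rw [add_zero, mul_comm (quadChar z), mul_left_comm, ← sum_reChar_mul_sq hK hψ hz,
          Finset.mul_sum]
        refine Finset.sum_congr rfl fun x _ => ?_
        rw [← AddChar.map_add_eq_mul]; ring_nf
    rw [Finset.sum_comm] at h1
    simp_rw [h3, Finset.sum_add_distrib, ← Finset.mul_sum] at h1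
    simp only [Finset.sum_ite_eq', Finset.mem_univ, if_true] at h1
    apply mul_left_cancel₀ hq
    linear_combination h1
  have hsum : ∑ z : GaussExt K, quadChar z = 0 := by
    obtain ⟨δ, hδ⟩ : ∃ δ : GaussExt K, quadChar δ = -1 := by
      obtain ⟨δ, hδ⟩ := exists_norm_eq hK (-1)
      exact ⟨δ, by rw [quadChar, hδ, complexQuadraticChar_neg_one hK]⟩
    have : ∑ z : GaussExt K, quadChar z = - ∑ z : GaussExt K, quadChar z := by
      have hδ0 : δ ≠ 0 := by rintro rfl; rw [quadChar_zero] at hδ; norm_num at hδ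
      conv_lhs => rw [← Equiv.sum_comp (Equiv.mulLeft₀ δ hδ0)]
      simp [quadChar_mul, hδ]
    linear_combination this / 2
  rcases eq_or_ne s 0 with rfl | hs
  · simp [hsum, quadChar_zero]
  · rw [← main, Finset.sum_mul, ← Equiv.sum_comp (Equiv.mulRight₀ s hs) (fun z => _ * _ * _)]
    refine Finset.sum_congr rfl fun z _ => ?_
    rw [Equiv.mulRight₀_apply, quadChar_mul]
    linear_combination (-quadChar z * reChar ψ (z * s)) * quadChar_sq hs

end GaussExt

namespace GaussExt

variable {K : Type*} [Field K]

/-- The ternary quadratic form `u v + z²` over `GaussExt K`. -/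
def conic (x : GaussExt K × GaussExt K × GaussExt K) : GaussExt K :=
  x.1 * x.2.1 + x.2.2 ^ 2

/-- The polar form of `conic`. -/
def conicPolar (x y : GaussExt K × GaussExt K × GaussExt K) : GaussExt K :=
  x.1 * y.2.1 + x.2.1 * y.1 + 2 * x.2.2 * y.2.2

theorem conicPolar_self (x : GaussExt K × GaussExt K × GaussExt K) :
    conicPolar x x = 2 * conic x := by
  simp only [conicPolar, conic]; ring

theorem conicPolar_zero_right (x : GaussExt K × GaussExt K × GaussExt K) :
    conicPolar x 0 = 0 := by
  simp [conicPolar]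

theorem conic_smul (a : K) (x : GaussExt K × GaussExt K × GaussExt K) :
    conic (a • x) = a ^ 2 • conic x := by
  simp only [conic, Prod.smul_fst, Prod.smul_snd]
  simp only [Algebra.smul_def, map_pow]; ring

theorem ne_zero_of_norm_eq_neg_one {δ : GaussExt K} (hδ : δ.norm = -1) : δ ≠ 0 := by
  rintro rfl
  rw [QuadraticAlgebra.norm_zero] at hδ
  simp at hδ

variable [Fintype K]

local notation "η" => complexQuadraticChar K

/-- A function of absolute value one on the nonzero vectors of the cone `conic x = 0`. -/
noncomputable def coneChar (x : GaussExt K × GaussExt K × GaussExt K) : ℂ :=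
  if conic x = 0 then if x.1 = 0 then quadChar x.2.1 else quadChar x.1 else 0

/-- On vectors with `δ * conic x` purely imaginary, the quadratic character of its
imaginary part. -/
noncomputable def imChar (δ : GaussExt K) (x : GaussExt K × GaussExt K × GaussExt K) : ℂ :=
  if (δ * conic x).re = 0 then η (δ * conic x).im else 0

variable (hK : Fintype.card K % 4 = 3) {ψ : AddChar K ℂ} (hψ : ψ ≠ 1)
include hK hψ

theorem sum_reChar_mul_conic {s : GaussExt K} (hs : s ≠ 0) :
    ∑ x, reChar ψ (s * conic x) = (Fintype.card K : ℂ) ^ 3 * quadChar s := by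
  have := fact_sq_ne hK
  have h (u : GaussExt K) : ∑ w : GaussExt K × GaussExt K, reChar ψ (s * conic (u, w))
      = if u = 0 then (Fintype.card K : ℂ) ^ 3 * quadChar s else 0 := by
    rw [Fintype.sum_prod_type]
    have h' (v : GaussExt K) : ∑ z : GaussExt K, reChar ψ (s * conic (u, v, z))
        = reChar ψ (v * (s * u)) * (Fintype.card K * quadChar s) := by
      rw [← sum_reChar_mul_sq hK hψ hs, Finset.mul_sum]
      refine Finset.sum_congr rfl fun z _ => ?_
      rw [← AddChar.map_add_eq_mul]
      congr 1
      simp only [conic]; ring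
    simp_rw [h']
    rw [← Finset.sum_mul, sum_reChar_mul hψ]
    simp only [mul_eq_zero, hs, false_or]
    split_ifs <;> ring
  rw [Fintype.sum_prod_type]
  simp_rw [h]
  simp

theorem sum_reChar_mul_conic_add {s : GaussExt K} (hs : s ≠ 0)
    (y : GaussExt K × GaussExt K × GaussExt K) :
    ∑ x, reChar ψ (s * conic x + conicPolar x y)
      = (Fintype.card K : ℂ) ^ 3 * quadChar s * reChar ψ (-(conic y / s)) := by
  have := fact_sq_ne hK
  rw [← sum_reChar_mul_conic hK hψ hs, Finset.sum_mul,
    ← Equiv.sum_comp (Equiv.addRight (s⁻¹ • y)) (fun x => reChar ψ (s * conic x) * _)]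
  refine Finset.sum_congr rfl fun x _ => ?_
  rw [← AddChar.map_add_eq_mul]
  congr 1
  simp only [Equiv.coe_addRight, conic, conicPolar, Prod.fst_add, Prod.snd_add, Prod.smul_fst,
    Prod.smul_snd, smul_eq_mul]
  field_simp
  ring

variable {δ : GaussExt K} (hδ : δ.norm = -1)
include hδ

omit hψ in
theorem quadChar_of_norm_eq_neg_one : quadChar δ = -1 := by
  rw [quadChar, hδ, complexQuadraticChar_neg_one hK]

theorem sum_reChar_mul_scaled_conic_add {s : GaussExt K} (hs : s ≠ 0)
    (y : GaussExt K × GaussExt K × GaussExt K) :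
    ∑ x, reChar ψ (s * (δ * conic x) + δ * conicPolar x y)
      = -(Fintype.card K : ℂ) ^ 3 * quadChar s * reChar ψ (-(δ * conic y / s)) := by
  have := fact_sq_ne hK
  have hδ0 := ne_zero_of_norm_eq_neg_one hδ
  have h := sum_reChar_mul_conic_add hK hψ (mul_ne_zero hs hδ0) (δ • y)
  rw [quadChar_mul, quadChar_of_norm_eq_neg_one hK hδ] at h
  have e1 : conic (δ • y) / (s * δ) = δ * conic y / s := by
    simp only [conic, Prod.smul_fst, Prod.smul_snd, smul_eq_mul]
    field_simp
  rw [e1] at h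
  convert h using 2
  · congr 1
    simp only [conicPolar, Prod.smul_fst, Prod.smul_snd, smul_eq_mul]
    ring
  · ring

theorem sum_reChar_scaled_conicPolar (y : GaussExt K × GaussExt K × GaussExt K) :
    ∑ x, reChar ψ (δ * conicPolar x y) = if y = 0 then (Fintype.card K : ℂ) ^ 6 else 0 := by
  have := fact_sq_ne hK
  have hδ0 := ne_zero_of_norm_eq_neg_one hδ
  have h2 : (2 : GaussExt K) ≠ 0 := fun h => two_ne_zero_of_card hK (by
    have := map_ofNat (algebraMap K (GaussExt K)) 2
    rw [h] at this
    simpa using this)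
  obtain ⟨a, b, c⟩ := y
  have h (u v z : GaussExt K) : reChar ψ (δ * conicPolar (u, v, z) (a, b, c))
      = reChar ψ (u * (δ * b)) * (reChar ψ (v * (δ * a)) * reChar ψ (z * (2 * δ * c))) := by
    simp only [← AddChar.map_add_eq_mul, conicPolar]
    ring_nf
  simp_rw [Fintype.sum_prod_type, h, ← Finset.mul_sum, ← Finset.sum_mul,
    sum_reChar_mul hψ, mul_eq_zero, hδ0, h2, false_or, Prod.mk_eq_zero]
  by_cases ha : a = 0 <;> by_cases hb : b = 0 <;> by_cases hc : c = 0 <;> simp [ha, hb, hc]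
  ring

/-- Fourier transform of the indicator function of the quadric. -/
theorem sum_quadric_reChar (y : GaussExt K × GaussExt K × GaussExt K) :
    ∑ x, (if (δ * conic x).re = 0 then 1 else 0) * reChar ψ (δ * conicPolar x y)
      = (if y = 0 then (Fintype.card K : ℂ) ^ 5 else 0)
        - (if (δ * conic y).re = 0 then (Fintype.card K : ℂ) ^ 3 else 0)
        + (Fintype.card K : ℂ) ^ 2 := by
  have := fact_sq_ne hK
  have hq : (Fintype.card K : ℂ) ≠ 0 := by simp
  have hind (w : K) : ∑ t : K, ψ (t * w) = if w = 0 then (Fintype.card K : ℂ) else 0 := by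
    have := AddChar.sum_mulShift w (AddChar.IsPrimitive.of_ne_one hψ)
    push_cast at this; exact this
  have h1 : ∑ t : K, ∑ x, reChar ψ (algebraMap K (GaussExt K) t * (δ * conic x)
        + δ * conicPolar x y)
      = Fintype.card K * ∑ x, (if (δ * conic x).re = 0 then 1 else 0)
          * reChar ψ (δ * conicPolar x y) := by
    rw [Finset.sum_comm, Finset.mul_sum]
    refine Finset.sum_congr rfl fun x _ => ?_
    have : ∑ t : K, reChar ψ (algebraMap K (GaussExt K) t * (δ * conic x))
        = if (δ * conic x).re = 0 then (Fintype.card K : ℂ) else 0 := by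
      rw [← hind]
      refine Finset.sum_congr rfl fun t _ => ?_
      rw [reChar_apply, ← Algebra.smul_def, QuadraticAlgebra.re_smul, smul_eq_mul]
    simp_rw [AddChar.map_add_eq_mul, ← Finset.sum_mul, this]
    split_ifs <;> ring
  have h2 (t : K) : ∑ x, reChar ψ (algebraMap K (GaussExt K) t * (δ * conic x)
        + δ * conicPolar x y)
      = (if t = 0 then (if y = 0 then (Fintype.card K : ℂ) ^ 6 else 0) + (Fintype.card K : ℂ) ^ 3
          else 0) - (Fintype.card K : ℂ) ^ 3 * ψ (t⁻¹ * -(δ * conic y).re) := by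
    split_ifs with ht hy
    · subst ht hy
      simp [conicPolar_zero_right, card_eq]; ring
    · subst ht
      have := sum_reChar_scaled_conicPolar hK hψ hδ y
      simp only [map_zero, zero_mul, zero_add, this, if_neg hy]; simp
    · have ht' : algebraMap K (GaussExt K) t ≠ 0 := by simpa using ht
      rw [sum_reChar_mul_scaled_conic_add hK hψ hδ ht', quadChar_algebraMap ht]
      rw [reChar_apply, div_eq_inv_mul, ← map_inv₀, ← Algebra.smul_def, QuadraticAlgebra.re_neg,
        QuadraticAlgebra.re_smul, smul_eq_mul, mul_neg]
      ring
  have h3 : ∑ t : K, ψ (t⁻¹ * -(δ * conic y).re)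
      = if (δ * conic y).re = 0 then (Fintype.card K : ℂ) else 0 := by
    have h := Equiv.sum_comp (Equiv.inv K) (fun t => ψ (t * -(δ * conic y).re))
    simp only [Equiv.inv_apply] at h
    rw [h, hind]
    simp only [neg_eq_zero]
  simp_rw [h2, Finset.sum_sub_distrib, ← Finset.mul_sum, h3] at h1
  apply mul_left_cancel₀ hq
  rw [← h1]
  simp only [Finset.sum_ite_eq', Finset.mem_univ, if_true]
  split_ifs <;> ring

end GaussExt

namespace GaussExt

variable {K : Type*} [Field K] [Fintype K]

local notation "η" => complexQuadraticChar K

variable (hK : Fintype.card K % 4 = 3) {ψ : AddChar K ℂ} (hψ : ψ ≠ 1)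
include hK hψ

theorem sum_im_mul_reChar (w : GaussExt K) :
    ∑ s : GaussExt K, η s.im * reChar ψ (s * w)
      = -Fintype.card K * gaussSum η ψ * if w.re = 0 then η w.im else 0 := by
  have key (a b : K) : reChar ψ (⟨a, b⟩ * w) = ψ (a * w.re) * ψ (b * -w.im) := by
    rw [reChar_apply, ← AddChar.map_add_eq_mul]
    congr 1
    simp
  have h := AddChar.sum_mulShift w.re (AddChar.IsPrimitive.of_ne_one hψ)
  push_cast at h
  simp_rw [sum_eq, key, mul_left_comm (η _), ← Finset.mul_sum, ← Finset.sum_mul,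
    sum_complexQuadraticChar_mul hK, h, complexQuadraticChar_neg hK]
  split_ifs <;> ring

variable {δ : GaussExt K} (hδ : δ.norm = -1)
include hδ

/-- `imChar` is an eigenfunction of the Fourier transform. -/
theorem sum_imChar_mul_reChar (y : GaussExt K × GaussExt K × GaussExt K) :
    ∑ x, imChar δ x * reChar ψ (δ * conicPolar x y)
      = -(Fintype.card K : ℂ) ^ 3 * imChar δ y := by
  have := fact_sq_ne hK
  have hq : (Fintype.card K : ℂ) ≠ 0 := by simp
  have hG : gaussSum η ψ ≠ 0 := fun h => by
    have := gaussSum_complexQuadraticChar_sq hK hψ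
    rw [h] at this; simp at this
  have h1 : ∑ s : GaussExt K, ∑ x, η s.im *
        reChar ψ (s * (δ * conic x) + δ * conicPolar x y)
      = (-Fintype.card K * gaussSum η ψ) * ∑ x, imChar δ x * reChar ψ (δ * conicPolar x y) := by
    rw [Finset.sum_comm, Finset.mul_sum]
    refine Finset.sum_congr rfl fun x _ => ?_
    rw [← mul_assoc, imChar, ← sum_im_mul_reChar hK hψ, Finset.sum_mul]
    refine Finset.sum_congr rfl fun s _ => ?_
    rw [AddChar.map_add_eq_mul, mul_assoc]
  have h2 (s : GaussExt K) : ∑ x, η s⁻¹.im *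
        reChar ψ (s⁻¹ * (δ * conic x) + δ * conicPolar x y)
      = (Fintype.card K : ℂ) ^ 3 * (η s.im * reChar ψ (s * -(δ * conic y))) := by
    rcases eq_or_ne s 0 with rfl | hs
    · simp [MulChar.map_zero]
    · have e : η s⁻¹.im * quadChar s = -η s.im := by
        have e1 : s⁻¹.im = s.norm⁻¹ * -s.im := by
          show (s.norm⁻¹ • star s).im = _
          simp
        rw [e1, map_mul, complexQuadraticChar_inv, complexQuadraticChar_neg hK, quadChar]
        linear_combination (-η s.im) * complexQuadraticChar_sq (norm_ne_zero hs)
      rw [← Finset.mul_sum, sum_reChar_mul_scaled_conic_add hK hψ hδ (inv_ne_zero hs),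
        quadChar_inv, div_inv_eq_mul, mul_neg s, mul_comm s (δ * conic y)]
      linear_combination (-(Fintype.card K : ℂ) ^ 3 * reChar ψ (-(δ * conic y * s))) * e
  rw [← Equiv.sum_comp (Equiv.inv (GaussExt K))] at h1
  simp only [Equiv.inv_apply, h2] at h1
  rw [← Finset.mul_sum, sum_im_mul_reChar hK hψ] at h1
  apply mul_left_cancel₀ (mul_ne_zero (neg_ne_zero.mpr hq) hG)
  rw [← h1, imChar, QuadraticAlgebra.re_neg, QuadraticAlgebra.im_neg, neg_eq_zero,
    complexQuadraticChar_neg hK]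
  split_ifs <;> ring

/-- `coneChar` is an eigenfunction of the Fourier transform. -/
theorem sum_coneChar_mul_reChar (y : GaussExt K × GaussExt K × GaussExt K) :
    ∑ x, coneChar x * reChar ψ (δ * conicPolar x y)
      = -(Fintype.card K : ℂ) ^ 3 * coneChar y := by
  have := fact_sq_ne hK
  have hδ0 := ne_zero_of_norm_eq_neg_one hδ
  have h2 : (2 : GaussExt K) ≠ 0 := fun h => two_ne_zero_of_card hK (by
    have := map_ofNat (algebraMap K (GaussExt K)) 2
    rw [h] at this
    simpa using this)
  obtain ⟨a, b, c⟩ := y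
  have hzero : ∑ w : GaussExt K × GaussExt K, coneChar (0, w)
      * reChar ψ (δ * conicPolar (0, w) (a, b, c)) = -Fintype.card K * quadChar a := by
    rw [Fintype.sum_prod_type]
    have h (v : GaussExt K) : ∑ z, coneChar (0, v, z) *
        reChar ψ (δ * conicPolar (0, v, z) (a, b, c)) = quadChar v * reChar ψ (v * (δ * a)) := by
      rw [Finset.sum_eq_single 0]
      · simp [coneChar, conic, conicPolar, mul_left_comm v]
      · intro z _ hz
        simp [coneChar, conic, hz]
      · simp
    simp_rw [h]
    rw [sum_quadChar_mul_reChar hK hψ, quadChar_mul, quadChar_of_norm_eq_neg_one hK hδ]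
    ring
  have hne (u : GaussExt K) (hu : u ≠ 0) : ∑ w : GaussExt K × GaussExt K, coneChar (u, w)
      * reChar ψ (δ * conicPolar (u, w) (a, b, c))
      = ∑ z : GaussExt K, quadChar u * reChar ψ (δ * (u * b - z ^ 2 / u * a + 2 * z * c)) := by
    rw [Fintype.sum_prod_type_right]
    refine Finset.sum_congr rfl fun z _ => ?_
    rw [Finset.sum_eq_single (-(z ^ 2) / u)]
    · simp only [coneChar, conic, conicPolar, if_neg hu]
      rw [if_pos (by field_simp; ring)]
      congr 2
      ring
    · intro v _ hv
      have : conic (u, v, z) ≠ 0 := fun h => hv (by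
        simp only [conic] at h
        field_simp
        linear_combination h)
      simp [coneChar, this]
    · simp
  have hne' (u : GaussExt K) (hu : u ≠ 0) : ∑ w : GaussExt K × GaussExt K, coneChar (u, w)
      * reChar ψ (δ * conicPolar (u, w) (a, b, c))
      = if a = 0 then
          if c = 0 then (Fintype.card K : ℂ) ^ 2 * (quadChar u * reChar ψ (u * (δ * b))) else 0
        else -Fintype.card K * quadChar a * reChar ψ (u * (δ * (b + c ^ 2 / a))) := by
    rw [hne u hu]
    split_ifs with ha hc
    · subst ha hc
      simp [card_eq, mul_left_comm u]
    · subst ha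
      have (z : GaussExt K) : reChar ψ (δ * (u * b - z ^ 2 / u * 0 + 2 * z * c))
          = reChar ψ (δ * u * b) * reChar ψ (z * (2 * δ * c)) := by
        rw [← AddChar.map_add_eq_mul]; ring_nf
      simp_rw [this, ← Finset.mul_sum, sum_reChar_mul hψ]
      simp [hδ0, h2, hc]
    · have hs : -(δ * a / u) ≠ 0 := neg_ne_zero.mpr (div_ne_zero (mul_ne_zero hδ0 ha) hu)
      have hc : quadChar u * quadChar (-(δ * a / u)) = -quadChar a := by
        rw [quadChar_neg, div_eq_mul_inv, quadChar_mul, quadChar_mul, quadChar_inv,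
          quadChar_of_norm_eq_neg_one hK hδ]
        linear_combination (-quadChar a) * quadChar_sq hu
      have : (-Fintype.card K * quadChar a : ℂ)
          = quadChar u * (Fintype.card K * quadChar (-(δ * a / u))) := by
        linear_combination (-Fintype.card K : ℂ) * hc
      rw [this, ← sum_reChar_mul_sq hK hψ hs, ← Finset.mul_sum, mul_assoc, Finset.sum_mul,
        ← Equiv.sum_comp (Equiv.addRight (u * c / a))]
      congr 1
      refine Finset.sum_congr rfl fun z _ => ?_
      rw [← AddChar.map_add_eq_mul]
      congr 1
      simp only [Equiv.coe_addRight]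
      field_simp
      ring
  have hsplit : ∑ x, coneChar x * reChar ψ (δ * conicPolar x (a, b, c))
      = -Fintype.card K * quadChar a + ∑ u ∈ Finset.univ.erase (0 : GaussExt K),
        if a = 0 then
          if c = 0 then (Fintype.card K : ℂ) ^ 2 * (quadChar u * reChar ψ (u * (δ * b))) else 0
        else -Fintype.card K * quadChar a * reChar ψ (u * (δ * (b + c ^ 2 / a))) := by
    rw [Fintype.sum_prod_type, ← Finset.add_sum_erase _ _ (Finset.mem_univ 0), hzero]
    congr 1
    exact Finset.sum_congr rfl fun u hu => hne' u (Finset.ne_of_mem_erase hu)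
  rw [hsplit]
  split_ifs with ha hc
  · subst ha hc
    rw [← Finset.mul_sum, Finset.sum_erase _ (by rw [quadChar_zero, zero_mul]),
      sum_quadChar_mul_reChar hK hψ, quadChar_mul, quadChar_of_norm_eq_neg_one hK hδ]
    simp [coneChar, conic, quadChar_zero]
    ring
  · subst ha
    simp [coneChar, conic, quadChar_zero, hc]
  · rw [← Finset.mul_sum, Finset.sum_erase_eq_sub (Finset.mem_univ _), sum_reChar_mul hψ]
    have : conic (a, b, c) = a * (b + c ^ 2 / a) := by
      simp only [conic]; field_simp
    have hcone : coneChar (a, b, c) = if b + c ^ 2 / a = 0 then quadChar a else 0 := by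
      simp [coneChar, this, ha]
    rw [hcone, zero_mul, AddChar.map_zero_eq_one]
    simp only [mul_eq_zero, hδ0, false_or]
    split_ifs <;> ring

end GaussExt

namespace GaussExt

variable {K : Type*} [Field K] [Fintype K]

section

variable (hK : Fintype.card K % 4 = 3) {δ : GaussExt K} (hδ : δ.norm = -1)
include hK hδ

/-- The binary form `re (δ * z * w)` is similar to the sum of two squares, with any given
similarity factor. -/
theorem exists_linearMap_re_mul (c : K) : ∃ θ : K × K →ₗ[K] GaussExt K,
    ∀ x y, (δ * (θ x * θ y)).re = c * (x.1 * y.1 + x.2 * y.2) := by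
  obtain ⟨α, β⟩ := δ
  rw [norm_eq] at hδ
  simp only at hδ
  have hα : α ≠ 0 := by
    rintro rfl
    have := (fact_sq_ne hK).out β
    exact this (by linear_combination hδ)
  obtain ⟨⟨r, w⟩, hrw⟩ := exists_norm_eq hK (c / α)
  rw [norm_eq, eq_div_iff hα] at hrw
  simp only at hrw
  refine ⟨
    { toFun x := ⟨r * x.1 + w * x.2 + β * (r * x.2 - w * x.1), α * (r * x.2 - w * x.1)⟩
      map_add' x y := by ext <;> simp <;> ring
      map_smul' a x := by ext <;> simp <;> ring }, fun x y => ?_⟩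
  simp only [LinearMap.coe_mk, AddHom.coe_mk, QuadraticAlgebra.re_mul, QuadraticAlgebra.im_mul]
  linear_combination (x.1 * y.1 + x.2 * y.2) * hrw
    - α * (r * x.2 - w * x.1) * (r * y.2 - w * y.1) * hδ

theorem exists_linearMap_conicPolar (b : Fin 3 → K) :
    ∃ Θ : (Fin 3 → K × K) →ₗ[K] GaussExt K × GaussExt K × GaussExt K, ∀ x y,
      (δ * conicPolar (Θ x) (Θ y)).re
        = ∑ j, b j * ((x j).1 * (y j).1 + (x j).2 * (y j).2) := by
  choose θ hθ using fun j => exists_linearMap_re_mul hK hδ (b j / 2)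
  let I : GaussExt K := ⟨0, 1⟩
  have hI : I * I = -1 := by
    ext
    · simp [I, QuadraticAlgebra.re_one]
    · simp [I, QuadraticAlgebra.im_one]
  refine ⟨
    { toFun x := (θ 0 (x 0) + I * θ 1 (x 1), θ 0 (x 0) - I * θ 1 (x 1), θ 2 (x 2))
      map_add' x y := by
        simp only [Pi.add_apply, map_add, Prod.mk_add_mk, Prod.mk.injEq]
        exact ⟨by ring, by ring, trivial⟩
      map_smul' a x := by
        simp only [Pi.smul_apply, map_smul, mul_smul_comm, ← smul_add, ← smul_sub,
          RingHom.id_apply, Prod.smul_mk] }, fun x y => ?_⟩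
  have h : δ * conicPolar
      (θ 0 (x 0) + I * θ 1 (x 1), θ 0 (x 0) - I * θ 1 (x 1), θ 2 (x 2))
      (θ 0 (y 0) + I * θ 1 (y 1), θ 0 (y 0) - I * θ 1 (y 1), θ 2 (y 2))
      = ∑ j, (2 : K) • (δ * (θ j (x j) * θ j (y j))) := by
    simp only [conicPolar, Fin.sum_univ_three, two_smul]
    linear_combination (-2 * δ * θ 1 (x 1) * θ 1 (y 1)) * hI
  have h2 := two_ne_zero_of_card hK
  rw [LinearMap.coe_mk, AddHom.coe_mk, h]
  simp only [Fin.sum_univ_three, QuadraticAlgebra.re_add, QuadraticAlgebra.re_smul, hθ,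
    smul_eq_mul]
  field_simp

end

end GaussExt

section FiniteFieldTrace

open FiniteField

variable {K L M : Type*} [Field K] [Fintype K] [Field L] [Fintype L] [Algebra K L]
  [Field M] [Fintype M] [Algebra K M]

theorem FiniteField.trace_algHom_of_finrank (hL : Module.finrank K L = 6)
    (hM : Module.finrank K M = 3) (φ : M →ₐ[K] L) (m : M) :
    Algebra.trace K L (φ m) = 2 * Algebra.trace K M m := by
  have hm : m ^ Fintype.card K ^ 3 = m := by
    rw [← hM, ← Module.card_eq_pow_finrank, FiniteField.pow_card]
  apply (algebraMap K L).injective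
  rw [map_mul, ← φ.commutes (Algebra.trace K M m), algebraMap_trace_eq_sum_pow,
    algebraMap_trace_eq_sum_pow, hL, hM, Nat.card_eq_fintype_card]
  have h (k : ℕ) : φ m ^ Fintype.card K ^ (3 + k) = φ m ^ Fintype.card K ^ k := by
    rw [pow_add, pow_mul, ← map_pow φ, hm]
  have h3 := h 0
  have h4 := h 1
  have h5 := h 2
  simp only [Finset.sum_range_succ, Finset.sum_range_zero, map_add, map_pow, map_ofNat, map_zero]
  linear_combination h3 + h4 + h5

theorem FiniteField.trace_mul_algHom_of_finrank (hK : Fintype.card K % 4 = 3)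
    (hL : Module.finrank K L = 6) (hM : Module.finrank K M = 3) (φ : M →ₐ[K] L) (m : M)
    {i : L} (hi : i ^ Fintype.card K = -i) :
    Algebra.trace K L (i * φ m) = 0 := by
  have hodd : Odd (Fintype.card K) := Nat.odd_iff.mpr (by omega)
  have hm : m ^ Fintype.card K ^ 3 = m := by
    rw [← hM, ← Module.card_eq_pow_finrank, FiniteField.pow_card]
  apply (algebraMap K L).injective
  rw [algebraMap_trace_eq_sum_pow, hL, Nat.card_eq_fintype_card]
  have h (k : ℕ) : φ m ^ Fintype.card K ^ (3 + k) = φ m ^ Fintype.card K ^ k := by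
    rw [pow_add, pow_mul, ← map_pow φ, hm]
  have hi' (k : ℕ) : i ^ Fintype.card K ^ k = (-1) ^ k * i := by
    induction k with
    | zero => simp
    | succ k ih => rw [pow_succ, pow_mul, ih, mul_pow, hi, ← pow_mul, mul_comm k, pow_mul,
        hodd.neg_one_pow]; ring
  have h3 := h 0
  have h4 := h 1
  have h5 := h 2
  simp only [Finset.sum_range_succ, Finset.sum_range_zero, mul_pow, hi', map_zero]
  linear_combination i * (-h3 + h4 - h5)

end FiniteFieldTrace

section Isometry

variable {K L : Type*} [Field K] [Fintype K] [Field L] [Fintype L] [Algebra K L]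

omit [Field K] [Algebra K L] in
theorem FiniteField.exists_pow_card_eq_neg (hK : Fintype.card K % 4 = 3)
    (hL : Fintype.card L % 4 = 1) : ∃ i : L, i * i = -1 ∧ i ^ Fintype.card K = -i := by
  obtain ⟨i, hi⟩ := (FiniteField.isSquare_neg_one_iff (F := L)).mpr (by omega)
  refine ⟨i, hi.symm, ?_⟩
  have h4 : i ^ 4 = 1 := by linear_combination (-(i * i) + 1) * hi
  rw [← Nat.div_add_mod (Fintype.card K) 4, hK, pow_add, pow_mul, h4, one_pow]
  linear_combination -i * hi

variable (K) in
theorem FiniteField.exists_finrank_eq_three : ∃ (M : Type) (_ : Field M) (_ : Fintype M)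
    (_ : Algebra K M), Module.finrank K M = 3 :=
  have : Fact (ringChar K).Prime := ⟨CharP.char_is_prime K _⟩
  ⟨FiniteField.Extension K (ringChar K) 3, inferInstance, Fintype.ofFinite _, inferInstance,
    FiniteField.finrank_extension K _ 3⟩

theorem FiniteField.exists_linearMap_trace_mul_pow (hK : Fintype.card K % 4 = 3)
    (hL : Module.finrank K L = 6) :
    ∃ b : Fin 3 → K, (∀ j, b j ≠ 0) ∧ ∃ Ω : (Fin 3 → K × K) →ₗ[K] L, ∀ x y,
      Algebra.trace K L (Ω x * Ω y ^ Fintype.card K ^ 3)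
        = ∑ j, b j * ((x j).1 * (y j).1 + (x j).2 * (y j).2) := by
  have h2 := two_ne_zero_of_card hK
  obtain ⟨M, _, _, _, hM⟩ := FiniteField.exists_finrank_eq_three K
  obtain ⟨φ⟩ : Nonempty (M →ₐ[K] L) :=
    FiniteField.nonempty_algHom_of_finrank_dvd (by norm_num [hM, hL])
  obtain ⟨i, hi, hiq⟩ : ∃ i : L, i * i = -1 ∧ i ^ Fintype.card K = -i := by
    refine FiniteField.exists_pow_card_eq_neg hK ?_
    rw [Module.card_eq_pow_finrank (K := K), hL, Nat.pow_mod, hK]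
  let _ : Invertible (2 : K) := invertibleOfNonzero h2
  obtain ⟨e, he⟩ := LinearMap.BilinForm.exists_orthogonal_basis
    (LinearMap.BilinForm.isSymm_iff.mp (Algebra.traceForm_isSymm K (S := M)))
  have hnd (j) : Algebra.traceForm K M (e j) (e j) ≠ 0 :=
    he.not_isOrtho_basis_self_of_separatingLeft (traceForm_nondegenerate K M).1 j
  let e' (j : Fin 3) : M := e (Fin.cast hM.symm j)
  have he' (j k : Fin 3) (h : j ≠ k) : Algebra.trace K M (e' j * e' k) = 0 :=
    he (by simpa using h)
  let A : (Fin 3 → K × K) →ₗ[K] M :=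
    ∑ j, (LinearMap.toSpanSingleton K M (e' j)) ∘ₗ LinearMap.fst K K K ∘ₗ LinearMap.proj j
  let B : (Fin 3 → K × K) →ₗ[K] M :=
    ∑ j, (LinearMap.toSpanSingleton K M (e' j)) ∘ₗ LinearMap.snd K K K ∘ₗ LinearMap.proj j
  have hA (x) : A x = ∑ j, (x j).1 • e' j := by simp [A]
  have hB (x) : B x = ∑ j, (x j).2 • e' j := by simp [B]
  have htr (f g : Fin 3 → K) : Algebra.trace K M ((∑ j, f j • e' j) * ∑ j, g j • e' j)
      = ∑ j, f j * g j * Algebra.trace K M (e' j * e' j) := by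
    simp only [Finset.sum_mul_sum, smul_mul_smul_comm, map_sum, map_smul, smul_eq_mul]
    refine Finset.sum_congr rfl fun j _ => Finset.sum_eq_single j (fun k _ hk => ?_) (by simp)
    rw [he' j k hk.symm, mul_zero]
  refine ⟨fun j => 2 * Algebra.trace K M (e' j * e' j), fun j => mul_ne_zero h2 (hnd _),
    φ.toLinearMap ∘ₗ A + LinearMap.mulLeft K i ∘ₗ φ.toLinearMap ∘ₗ B, fun x y => ?_⟩
  have hodd : Odd (Fintype.card K) := Nat.odd_iff.mpr (by omega)
  have hm (m : M) : m ^ Fintype.card K ^ 3 = m := by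
    rw [← hM, ← Module.card_eq_pow_finrank, FiniteField.pow_card]
  have hi3 : i ^ Fintype.card K ^ 3 = -i := by
    rw [pow_succ, pow_two, pow_mul, pow_mul, hiq, hodd.neg_pow, hiq, neg_neg, hiq]
  have hpow : (φ (A y) + i * φ (B y)) ^ Fintype.card K ^ 3 = φ (A y) - i * φ (B y) := by
    have hF (u v : L) : (u + v) ^ Fintype.card K ^ 3
        = u ^ Fintype.card K ^ 3 + v ^ Fintype.card K ^ 3 := by
      have h (w : L) : w ^ Fintype.card K ^ 3 = (FiniteField.frobeniusAlgHom K L ^ 3) w := by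
        rw [AlgHom.coe_pow, FiniteField.coe_frobeniusAlgHom, pow_iterate]
      rw [h, h, h, map_add]
    rw [hF, mul_pow, hi3, ← map_pow φ, ← map_pow φ, hm, hm]
    ring
  simp only [LinearMap.add_apply, LinearMap.comp_apply, LinearMap.mulLeft_apply,
    AlgHom.toLinearMap_apply, hpow]
  have hprod : (φ (A x) + i * φ (B x)) * (φ (A y) - i * φ (B y))
      = φ (A x * A y) + φ (B x * B y) + i * φ (B x * A y - A x * B y) := by
    simp only [map_mul, map_sub]
    linear_combination (-φ (B x) * φ (B y)) * hi
  rw [hprod, map_add, map_add, FiniteField.trace_mul_algHom_of_finrank hK hL hM φ _ hiq,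
    FiniteField.trace_algHom_of_finrank hL hM, FiniteField.trace_algHom_of_finrank hL hM,
    hA, hA, hB, hB, htr, htr]
  rw [add_zero, Finset.mul_sum, Finset.mul_sum, ← Finset.sum_add_distrib]
  exact Finset.sum_congr rfl fun j _ => by ring

/-- The trace form `Tr (x * y ^ q ^ 3)` is isometric to `re (δ * conicPolar x y)`. -/
theorem GaussExt.exists_linearEquiv_trace_mul_pow (hK : Fintype.card K % 4 = 3)
    (hL : Module.finrank K L = 6) {δ : GaussExt K} (hδ : δ.norm = -1) :
    ∃ Φ : L ≃ₗ[K] GaussExt K × GaussExt K × GaussExt K, ∀ x y,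
      Algebra.trace K L (x * y ^ Fintype.card K ^ 3) = (δ * conicPolar (Φ x) (Φ y)).re := by
  obtain ⟨b, hb, Ω, hΩ⟩ := FiniteField.exists_linearMap_trace_mul_pow hK hL
  obtain ⟨Θ, hΘ⟩ := exists_linearMap_conicPolar hK hδ b
  have hnd (x : Fin 3 → K × K)
      (hx : ∀ y : Fin 3 → K × K, ∑ j, b j * ((x j).1 * (y j).1 + (x j).2 * (y j).2) = 0) :
      x = 0 := by
    funext j
    have h (s : K × K) : b j * ((x j).1 * s.1 + (x j).2 * s.2) = 0 := by
      rw [← hx (Pi.single j s), Finset.sum_eq_single j]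
      · simp
      · intro k _ hk
        simp [hk]
      · simp
    ext
    · simpa [hb j] using h (1, 0)
    · simpa [hb j] using h (0, 1)
  have hΩi : Function.Injective Ω := by
    refine (injective_iff_map_eq_zero Ω).mpr fun x hx => hnd x fun y => ?_
    rw [← hΩ, hx, zero_mul, map_zero]
  have hΘi : Function.Injective Θ := by
    refine (injective_iff_map_eq_zero Θ).mpr fun x hx => hnd x fun y => ?_
    rw [← hΘ, hx]
    simp [conicPolar]
  have hdim : Module.finrank K (Fin 3 → K × K) = 6 := by
    rw [Module.finrank_pi_fintype]
    simp
  let Ω' := LinearEquiv.ofInjectiveOfFinrankEq Ω hΩi (by rw [hdim, hL])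
  let Θ' := LinearEquiv.ofInjectiveOfFinrankEq Θ hΘi
    (by rw [hdim]; simp [QuadraticAlgebra.finrank_eq_two])
  refine ⟨Ω'.symm.trans Θ', fun x y => ?_⟩
  obtain ⟨x, rfl⟩ := Ω'.surjective x
  obtain ⟨y, rfl⟩ := Ω'.surjective y
  simp only [LinearEquiv.trans_apply, LinearEquiv.symm_apply_apply]
  exact (hΩ x y).trans (hΘ x y).symm

end Isometry

namespace GaussExt

variable {K : Type*} [Field K] [Fintype K]

/-- A hemisystem of the elliptic quadric `re (δ * conic x) = 0`, as a set of vectors. -/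
noncomputable def hemisystem (δ : GaussExt K) :
    Finset (GaussExt K × GaussExt K × GaussExt K) :=
  {x | imChar δ x + coneChar x = 1}

theorem mem_hemisystem {δ : GaussExt K} {x : GaussExt K × GaussExt K × GaussExt K} :
    x ∈ hemisystem δ ↔ imChar δ x + coneChar x = 1 := by
  simp [hemisystem]

theorem zero_notMem_hemisystem (δ : GaussExt K) : 0 ∉ hemisystem δ := by
  simp [mem_hemisystem, imChar, coneChar, conic, quadChar_zero, MulChar.map_zero]

theorem smul_mem_hemisystem {δ : GaussExt K} {a : K} (ha : a ≠ 0)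
    {x : GaussExt K × GaussExt K × GaussExt K} (hx : x ∈ hemisystem δ) :
    a • x ∈ hemisystem δ := by
  have hq (z : GaussExt K) : quadChar (a • z) = quadChar z := by
    rw [Algebra.smul_def, quadChar_mul, quadChar_algebraMap ha, one_mul]
  have him : imChar δ (a • x) = imChar δ x := by
    simp only [imChar, conic_smul, mul_smul_comm, QuadraticAlgebra.re_smul,
      QuadraticAlgebra.im_smul, smul_eq_mul, map_mul, complexQuadraticChar_sq_left ha, one_mul,
      mul_eq_zero, pow_eq_zero_iff two_ne_zero, ha, false_or]
  have hcone : coneChar (a • x) = coneChar x := by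
    simp only [coneChar, conic_smul, Prod.smul_fst, Prod.smul_snd, hq, smul_eq_zero,
      pow_eq_zero_iff two_ne_zero, ha, false_or]
  rwa [mem_hemisystem, him, hcone, ← mem_hemisystem]

theorem imChar_add_coneChar_of_re_ne_zero {δ : GaussExt K}
    {x : GaussExt K × GaussExt K × GaussExt K} (hx : (δ * conic x).re ≠ 0) :
    imChar δ x + coneChar x = 0 := by
  have h : conic x ≠ 0 := fun h => hx (by simp [h])
  rw [imChar, if_neg hx, coneChar, if_neg h, add_zero]

theorem re_eq_zero_of_mem_hemisystem {δ : GaussExt K}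
    {x : GaussExt K × GaussExt K × GaussExt K} (hx : x ∈ hemisystem δ) :
    (δ * conic x).re = 0 := by
  by_contra h
  rw [mem_hemisystem, imChar_add_coneChar_of_re_ne_zero h] at hx
  exact zero_ne_one hx

variable (hK : Fintype.card K % 4 = 3) {δ : GaussExt K} (hδ : δ.norm = -1)
include hK hδ

theorem imChar_add_coneChar_eq_or {x : GaussExt K × GaussExt K × GaussExt K} (hx : x ≠ 0)
    (h : (δ * conic x).re = 0) :
    imChar δ x + coneChar x = 1 ∨ imChar δ x + coneChar x = -1 := by
  have := fact_sq_ne hK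
  by_cases hc : conic x = 0
  · have him : imChar δ x = 0 := by simp [imChar, hc, MulChar.map_zero]
    rw [him, zero_add, coneChar, if_pos hc]
    split_ifs with hu
    · refine quadChar_eq_or fun hv => hx ?_
      obtain ⟨u, v, z⟩ := x
      simp only at hu hv
      have hz : z = 0 := by simpa [conic, hu] using hc
      rw [hu, hv, hz]
      rfl
    · exact quadChar_eq_or hu
  · have hcone : coneChar x = 0 := if_neg hc
    rw [hcone, add_zero, imChar, if_pos h]
    refine complexQuadraticChar_eq_or fun him => ?_
    exact mul_ne_zero (ne_zero_of_norm_eq_neg_one hδ) hc (QuadraticAlgebra.ext h him)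

theorem sum_hemisystem_reChar {ψ : AddChar K ℂ} (hψ : ψ ≠ 1)
    (y : GaussExt K × GaussExt K × GaussExt K) :
    2 * ∑ x ∈ hemisystem δ, reChar ψ (δ * conicPolar x y)
      = (if y = 0 then (Fintype.card K : ℂ) ^ 5 else 0)
        - (if (δ * conic y).re = 0 then (Fintype.card K : ℂ) ^ 3 else 0)
        + ((Fintype.card K : ℂ) ^ 2 - 1)
        - (Fintype.card K : ℂ) ^ 3 * (imChar δ y + coneChar y) := by
  have hind (x : GaussExt K × GaussExt K × GaussExt K) :
      2 * (if imChar δ x + coneChar x = 1 then reChar ψ (δ * conicPolar x y) else 0)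
        = (if (δ * conic x).re = 0 then 1 else 0) * reChar ψ (δ * conicPolar x y)
          - (if x = 0 then 1 else 0)
          + (imChar δ x * reChar ψ (δ * conicPolar x y)
            + coneChar x * reChar ψ (δ * conicPolar x y)) := by
    rw [← add_mul]
    rcases eq_or_ne x 0 with rfl | hx
    · simp [imChar, coneChar, conic, conicPolar, quadChar_zero, MulChar.map_zero]
    by_cases h : (δ * conic x).re = 0
    · rcases imChar_add_coneChar_eq_or hK hδ hx h with h1 | h1
      · simp only [h1, h, hx, if_true, if_false]; ring
      · have : (-1 : ℂ) ≠ 1 := by norm_num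
        simp only [h1, h, hx, this, if_true, if_false]; ring
    · rw [imChar_add_coneChar_of_re_ne_zero h, if_neg h, if_neg hx]
      simp
  rw [hemisystem, Finset.sum_filter, Finset.mul_sum]
  simp_rw [hind]
  rw [Finset.sum_add_distrib, Finset.sum_sub_distrib, Finset.sum_add_distrib,
    sum_quadric_reChar hK hψ hδ, sum_imChar_mul_reChar hK hψ hδ, sum_coneChar_mul_reChar hK hψ hδ,
    Finset.sum_ite_eq', if_pos (Finset.mem_univ _)]
  ring

theorem sum_hemisystem_reChar_of_ne_zero {ψ : AddChar K ℂ} (hψ : ψ ≠ 1)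
    {y : GaussExt K × GaussExt K × GaussExt K} (hy : y ≠ 0) :
    ∑ x ∈ hemisystem δ, reChar ψ (δ * conicPolar x y)
      = if y ∈ hemisystem δ then
          -(Fintype.card K : ℂ) ^ 3 + ((Fintype.card K : ℂ) ^ 2 - 1) / 2
        else ((Fintype.card K : ℂ) ^ 2 - 1) / 2 := by
  have h := sum_hemisystem_reChar hK hδ hψ y
  rw [if_neg hy] at h
  simp only [mem_hemisystem]
  by_cases hs : (δ * conic y).re = 0
  · rw [if_pos hs] at h
    rcases imChar_add_coneChar_eq_or hK hδ hy hs with h1 | h1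
    · rw [h1] at h
      rw [if_pos h1]
      linear_combination h / 2
    · rw [h1] at h
      rw [if_neg (by rw [h1]; norm_num)]
      linear_combination h / 2
  · rw [if_neg hs, imChar_add_coneChar_of_re_ne_zero hs] at h
    rw [if_neg (by simp [imChar_add_coneChar_of_re_ne_zero hs])]
    linear_combination h / 2

theorem card_hemisystem {ψ : AddChar K ℂ} (hψ : ψ ≠ 1) :
    (hemisystem δ).card = (Fintype.card K ^ 3 + 1) * (Fintype.card K ^ 2 - 1) / 2 := by
  have h := sum_hemisystem_reChar hK hδ hψ 0
  have h0 : imChar δ 0 + coneChar (0 : GaussExt K × GaussExt K × GaussExt K) = 0 := by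
    simp [imChar, coneChar, conic, quadChar_zero, MulChar.map_zero]
  have hc : conic (0 : GaussExt K × GaussExt K × GaussExt K) = 0 := by simp [conic]
  simp only [conicPolar_zero_right, mul_zero, AddChar.map_zero_eq_one, Finset.sum_const,
    nsmul_eq_mul, mul_one, hc, QuadraticAlgebra.re_zero, if_true, h0] at h
  have hq : 1 ≤ Fintype.card K ^ 2 := Nat.one_le_pow _ _ Fintype.card_pos
  have h2 : 2 * (hemisystem δ).card = (Fintype.card K ^ 3 + 1) * (Fintype.card K ^ 2 - 1) := by
    have : (2 * (hemisystem δ).card : ℂ)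
        = ((Fintype.card K ^ 3 + 1) * (Fintype.card K ^ 2 - 1) : ℕ) := by
      push_cast [Nat.cast_sub hq]
      linear_combination h
    exact_mod_cast this
  omega

end GaussExt

section CanonicalCharacter

/-- The canonical additive character of a finite field of characteristic `p`. -/
noncomputable def canonicalAddChar (p : ℕ) [NeZero p] (K : Type*) [Field K] [Algebra (ZMod p) K] :
    AddChar K ℂ :=
  (ZMod.stdAddChar (N := p)).compAddMonoidHom (Algebra.trace (ZMod p) K).toAddMonoidHom

theorem canonicalAddChar_ne_one (p : ℕ) [Fact p.Prime] (K : Type*) [Field K] [Finite K]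
    [Algebra (ZMod p) K] : canonicalAddChar p K ≠ 1 := fun h => by
  obtain ⟨x, hx⟩ := Algebra.trace_surjective (ZMod p) K 1
  have h1 : ZMod.stdAddChar (Algebra.trace (ZMod p) K x) = 1 := DFunLike.congr_fun h x
  rw [hx, ← AddChar.map_zero_eq_one (ZMod.stdAddChar (N := p)),
    ZMod.injective_stdAddChar.eq_iff] at h1
  exact one_ne_zero h1

theorem canonicalAddChar_trace (p : ℕ) [Fact p.Prime] (K L : Type*) [Field K] [Field L]
    [Finite L] [Algebra K L] [Algebra (ZMod p) K] [Algebra (ZMod p) L] (x : L) :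
    canonicalAddChar p K (Algebra.trace K L x)
      = Complex.exp (2 * Real.pi * Complex.I * ((Algebra.trace (ZMod p) L x).val : ℂ) / p) := by
  have : Finite K := .of_injective _ (algebraMap K L).injective
  have : IsScalarTower (ZMod p) K L := .of_algebraMap_eq' (Subsingleton.elim _ _)
  rw [← ZMod.toCircle_apply, ← ZMod.stdAddChar_apply, ← Algebra.trace_trace (R := ZMod p) (S := K)]
  rfl

end CanonicalCharacter

/-- **Theorem 4.2 (character-sum form).** For every prime power `q = p^n ≡ 3 (mod 4)` there is
a subset `D` of the nonzero singular vectors of the elliptic form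
`Q(x) = Tr_{q^3/q}(x^{q^3+1})` on `F_{q^6}`, closed under `F_q^×`-scaling, of size
`(q^3+1)(q^2-1)/2`, whose canonical additive character sums take exactly the two prescribed
values; hence `Cay(F_{q^6}, D)` is strongly regular. -/
theorem hemisystem_exists_character_form
    (p n q : ℕ) (hp : p.Prime) (hn : 0 < n) (hqpn : q = p ^ n) (hq4 : q % 4 = 3)
    (K L : Type) [Field K] [Fintype K] [Field L] [Fintype L] [Algebra K L]
    [Algebra (ZMod p) L]
    (hK : Fintype.card K = q) (hL : Fintype.card L = q ^ 6) :
    ∃ D : Finset L,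
      (0 : L) ∉ D ∧
      (∀ x ∈ D, ∀ l : K, l ≠ 0 → algebraMap K L l * x ∈ D) ∧
      (∀ x ∈ D, x ^ (q ^ 3 + 1) + x ^ ((q ^ 3 + 1) * q) + x ^ ((q ^ 3 + 1) * q ^ 2) = 0) ∧
      D.card = (q ^ 3 + 1) * (q ^ 2 - 1) / 2 ∧
      (∀ a : L, a ≠ 0 →
        (∑ x ∈ D, Complex.exp (2 * Real.pi * Complex.I *
            ((Algebra.trace (ZMod p) L (a * x)).val : ℂ) / p)) =
          if a ^ (q ^ 3) ∈ D then -(q : ℂ) ^ 3 + ((q : ℂ) ^ 2 - 1) / 2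
          else ((q : ℂ) ^ 2 - 1) / 2) := by
  subst hK
  have : Fact p.Prime := ⟨hp⟩
  have hdim : Module.finrank K L = 6 := by
    rw [Module.card_eq_pow_finrank (K := K)] at hL
    exact Nat.pow_right_injective Fintype.one_lt_card hL
  have hchar : CharP K p := by
    have := charP_of_injective_algebraMap (algebraMap (ZMod p) L).injective p
    exact (algebraMap K L).charP (algebraMap K L).injective p
  let _ : Algebra (ZMod p) K := ZMod.algebra K p
  have hψ := canonicalAddChar_ne_one p K
  obtain ⟨δ, hδ⟩ := GaussExt.exists_norm_eq hq4 (-1)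
  obtain ⟨Φ, hΦ⟩ := GaussExt.exists_linearEquiv_trace_mul_pow hq4 hdim hδ
  have hpow (x : L) : (x ^ Fintype.card K ^ 3) ^ Fintype.card K ^ 3 = x := by
    rw [← pow_mul, ← pow_add, ← hL, FiniteField.pow_card]
  have hmem (x : L) : x ∈ (GaussExt.hemisystem δ).map Φ.symm.toEquiv.toEmbedding
      ↔ Φ x ∈ GaussExt.hemisystem δ := Finset.mem_map_equiv
  refine ⟨(GaussExt.hemisystem δ).map Φ.symm.toEquiv.toEmbedding, ?_, fun x hx l hl => ?_,
    fun x hx => ?_, ?_, fun a ha => ?_⟩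
  · rw [hmem, map_zero]
    exact GaussExt.zero_notMem_hemisystem δ
  · rw [hmem] at hx ⊢
    rw [← Algebra.smul_def, map_smul]
    exact GaussExt.smul_mem_hemisystem hl hx
  · rw [hmem] at hx
    have htr : Algebra.trace K L (x * x ^ Fintype.card K ^ 3) = 0 := by
      rw [hΦ, GaussExt.conicPolar_self, mul_left_comm, two_mul, QuadraticAlgebra.re_add,
        GaussExt.re_eq_zero_of_mem_hemisystem hx, add_zero]
    have hsum := FiniteField.algebraMap_trace_eq_sum_pow K L (x * x ^ Fintype.card K ^ 3)
    have h2 : (2 : L) ≠ 0 := by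
      have := two_ne_zero_of_card hq4
      rwa [← map_ne_zero (algebraMap K L), map_ofNat] at this
    rw [htr, map_zero, hdim, Nat.card_eq_fintype_card, ← pow_succ'] at hsum
    have hfix (k : ℕ) : (x ^ (Fintype.card K ^ 3 + 1)) ^ Fintype.card K ^ (3 + k)
        = (x ^ (Fintype.card K ^ 3 + 1)) ^ Fintype.card K ^ k := by
      rw [pow_add (Fintype.card K), pow_mul, pow_succ x, mul_pow, hpow, mul_comm]
    have h3 := hfix 0
    have h4 := hfix 1
    have h5 := hfix 2
    simp only [Finset.sum_range_succ, Finset.sum_range_zero, zero_add, pow_zero, pow_one] at hsum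
    rw [pow_mul, pow_mul]
    apply mul_left_cancel₀ h2
    simp only [pow_zero, pow_one] at h3 h4
    linear_combination -hsum - h3 - h4 - h5
  · rw [Finset.card_map, GaussExt.card_hemisystem hq4 hδ hψ]
  · have hy : Φ (a ^ Fintype.card K ^ 3) ≠ 0 := by
      rw [map_ne_zero_iff _ Φ.injective]
      exact pow_ne_zero _ ha
    simp only [hmem]
    rw [← GaussExt.sum_hemisystem_reChar_of_ne_zero hq4 hδ hψ hy, Finset.sum_map]
    refine Finset.sum_congr rfl fun x _ => ?_
    have h := hΦ (Φ.symm x) (a ^ Fintype.card K ^ 3)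
    rw [hpow, LinearEquiv.apply_symm_apply, mul_comm] at h
    rw [GaussExt.reChar_apply, ← h, canonicalAddChar_trace]
    rfl
end

section
/- Let q be a prime power with q ≡ 3 (mod 4), and let m > 1 be an odd integer dividing q^2+q+1. Let χ'_m be a multiplicative character of F_{q^3} of order m, let χ_m be its lift to F_{q^6} (i.e. χ_m(x) = χ'_m(x^{q^3+1})), and let χ_4 be a multiplicative character of F_{q^6} of order 4. Then G_{F_{q^6}}(χ_4·χ_m) = G_{F_{q^6}}(χ_4^3·χ_m), and moreover G_{F_{q^6}}(χ_4·χ_m) = ρ_q · G_{F_{q^3}}(χ'_m{}^4) · G_{F_{q^3}}(χ'_m{}^{-2}), where ρ_q = -1 if q ≡ 3 (mod 8) and ρ_q = 1 if q ≡ 7 (mod 8). -/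
open scoped Classical

/-- The quadratic character of a finite field, with complex values. -/
noncomputable def quadraticCharComplex (F : Type*) [Field F] [Fintype F] : MulChar F ℂ :=
  (quadraticChar F).ringHomComp (Int.castRingHom ℂ)

section FiniteField

variable {F : Type*} [Field F] [Fintype F]

lemma quadraticCharComplex_apply (a : F) :
    quadraticCharComplex F a = (quadraticChar F a : ℂ) := rfl

lemma ringChar_ne_two_of_card_mod_four (h : Fintype.card F % 4 = 3) : ringChar F ≠ 2 := by
  intro h2
  have := FiniteField.even_card_of_char_two h2
  omega

lemma quadraticCharComplex_ne_one (hF : ringChar F ≠ 2) : quadraticCharComplex F ≠ 1 :=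
  (MulChar.ringHomComp_ne_one_iff (RingHom.injective_int _)).mpr (quadraticChar_ne_one hF)

lemma quadraticCharComplex_neg_one (h : Fintype.card F % 4 = 3) :
    quadraticCharComplex F (-1) = -1 := by
  rw [quadraticCharComplex_apply, quadraticChar_neg_one_iff_not_isSquare.mpr]
  · simp
  · rw [FiniteField.isSquare_neg_one_iff]
    simpa using h

lemma sum_comp_sq_s3 (hF : ringChar F ≠ 2) (f : F → ℂ) :
    ∑ z, f (z ^ 2) = ∑ x, (1 + quadraticCharComplex F x) * f x := by
  rw [← Finset.sum_fiberwise (s := Finset.univ) (g := fun z : F ↦ z ^ 2)]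
  refine Finset.sum_congr rfl fun x _ ↦ ?_
  have h := quadraticChar_card_sqrts hF x
  rw [Finset.sum_congr rfl (g := fun _ ↦ f x) (by simp +contextual), Finset.sum_const,
    nsmul_eq_mul, quadraticCharComplex_apply]
  congr 1
  rw [add_comm, ← Int.cast_one, ← Int.cast_add, ← h, Int.cast_natCast]
  congr 2
  ext
  simp

lemma MulChar.eq_quadraticCharComplex {χ : MulChar F ℂ} (h2 : χ ^ 2 = 1) (h1 : χ ≠ 1) :
    χ = quadraticCharComplex F := by
  have hsq (a : F) (ha : a ≠ 0) (h : IsSquare a) : χ a = 1 := by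
    obtain ⟨b, rfl⟩ := h
    have hb : b ≠ 0 := by rintro rfl; simp at ha
    rw [map_mul, ← sq, ← MulChar.pow_apply' χ two_ne_zero, h2, MulChar.one_apply hb.isUnit]
  obtain ⟨a, ha⟩ := MulChar.ne_one_iff.mp h1
  have ha' : ¬ IsSquare (a : F) := fun h ↦ ha (hsq a a.ne_zero h)
  have hχa : χ a = -1 := by
    have : χ a ^ 2 = 1 := by
      rw [← MulChar.pow_apply' χ two_ne_zero, h2, MulChar.one_apply a.isUnit]
    exact (sq_eq_one_iff.1 this).resolve_left ha
  ext x
  rw [quadraticCharComplex_apply]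
  by_cases hx : IsSquare (x : F)
  · rw [hsq x x.ne_zero hx, (quadraticChar_one_iff_isSquare x.ne_zero).mpr hx, Int.cast_one]
  · have hx' := quadraticChar_neg_one_iff_not_isSquare.mpr hx
    have hxa : χ (x * a) = 1 := by
      refine hsq _ (mul_ne_zero x.ne_zero a.ne_zero) ?_
      rw [← quadraticChar_one_iff_isSquare (mul_ne_zero x.ne_zero a.ne_zero), map_mul, hx',
        quadraticChar_neg_one_iff_not_isSquare.mpr ha']
      norm_num
    rw [map_mul, hχa] at hxa
    rw [hx']
    push_cast
    linear_combination -hxa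

lemma jacobiSum_self_eq (hF : ringChar F ≠ 2) {θ : MulChar F ℂ} (hθ : θ ≠ 1) :
    θ 4 * jacobiSum θ θ = jacobiSum θ (quadraticCharComplex F) := by
  have h2 : (2 : F) ≠ 0 := Ring.two_ne_zero hF
  have e : ∑ x, θ 4 * (θ x * θ (1 - x)) = ∑ w, θ (1 - w ^ 2) := by
    refine Fintype.sum_equiv ((Equiv.mulLeft₀ 2 h2).trans (Equiv.subLeft 1)) _ _ fun x ↦ ?_
    rw [← map_mul, ← map_mul]
    congr 1
    simp
    ring
  rw [jacobiSum, Finset.mul_sum, e, sum_comp_sq_s3 hF fun u ↦ θ (1 - u), jacobiSum_comm, jacobiSum]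
  simp_rw [add_mul, one_mul, Finset.sum_add_distrib]
  have e' : ∑ x, θ (1 - x) = ∑ x, θ x := (Equiv.subLeft (1 : F)).sum_comp θ
  rw [e', MulChar.sum_eq_zero_of_ne_one hθ, zero_add]

lemma gaussSum_mul_gaussSum_inv {χ : MulChar F ℂ} (hχ : χ ≠ 1) {ψ : AddChar F ℂ}
    (hψ : ψ.IsPrimitive) : gaussSum χ ψ * gaussSum χ⁻¹ ψ = χ (-1) * Fintype.card F := by
  rw [← gaussSum_mul_gaussSum_eq_card hχ hψ, ← mul_gaussSum_inv_eq_gaussSum χ⁻¹ ψ,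
    MulChar.inv_apply', inv_neg, inv_one]
  ring

/-- The duplication formula for Gauss sums, rearranged, for a character `θ` with `θ 4 = 1`. -/
lemma gaussSum_duplication (h4 : Fintype.card F % 4 = 3) {θ : MulChar F ℂ} (hθ : θ ^ 2 ≠ 1)
    (hθ4 : θ 4 = 1) (hθ1 : θ (-1) = 1) {ψ : AddChar F ℂ} (hψ : ψ.IsPrimitive) :
    -(gaussSum (quadraticCharComplex F) ψ * gaussSum (θ * quadraticCharComplex F) ψ) =
      gaussSum (θ ^ 2) ψ * gaussSum θ⁻¹ ψ := by
  have hF := ringChar_ne_two_of_card_mod_four h4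
  have hη2 : quadraticCharComplex F ^ 2 = 1 :=
    ((quadraticChar_isQuadratic F).comp (Int.castRingHom ℂ)).sq_eq_one
  have hη := quadraticCharComplex_ne_one hF
  have hθ' : θ ≠ 1 := by rintro rfl; simp at hθ
  have hθη : θ * quadraticCharComplex F ≠ 1 := fun h ↦ hθ <| by
    have := congrArg (· ^ 2) h
    simpa [mul_pow, hη2] using this
  have hc : (Fintype.card F : ℂ) ≠ 0 := by simp
  have j1 := jacobiSum_mul_nontrivial (χ := θ) (φ := θ) (by rwa [← sq]) ψ
  have j2 := jacobiSum_mul_nontrivial hθη ψ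
  have j3 := jacobiSum_self_eq hF hθ'
  have g1 := gaussSum_mul_gaussSum_inv hθ' hψ
  have g2 := gaussSum_mul_gaussSum_inv hη hψ
  rw [inv_eq_of_mul_eq_one_left (by rw [← sq, hη2]), quadraticCharComplex_neg_one h4] at g2
  rw [hθ4, one_mul] at j3
  rw [hθ1, one_mul] at g1
  rw [← sq, j3] at j1
  have n1 := gaussSum_ne_zero_of_nontrivial hc hθ' hψ
  have n2 := gaussSum_ne_zero_of_nontrivial hc hη hψ
  have k : gaussSum (θ ^ 2) ψ * gaussSum (quadraticCharComplex F) ψ =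
      gaussSum (θ * quadraticCharComplex F) ψ * gaussSum θ ψ := by
    refine mul_right_cancel₀ n1 ?_
    linear_combination -gaussSum (θ ^ 2) ψ * j2 + gaussSum (θ * quadraticCharComplex F) ψ * j1
  refine mul_right_cancel₀ n2 ?_
  linear_combination -gaussSum θ⁻¹ ψ * k -
    gaussSum (θ * quadraticCharComplex F) ψ * (g1 + g2)

lemma sum_sq_add_sq_eq (h4 : Fintype.card F % 4 = 3) {κ : MulChar F ℂ} (hκ : κ (-1) = -1)
    (ψ : AddChar F ℂ) :
    ∑ a, ∑ b, κ (a ^ 2 + b ^ 2) * ψ (2 * (a ^ 2 - b ^ 2)) =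
      -2 * κ⁻¹ 2 * (gaussSum (quadraticCharComplex F) ψ * gaussSum κ ψ) := by
  have hF := ringChar_ne_two_of_card_mod_four h4
  have h2 : (2 : F) ≠ 0 := Ring.two_ne_zero hF
  have hneg (χ : MulChar F ℂ) (x : F) : χ (-x) = χ (-1) * χ x := by rw [← map_mul, neg_one_mul]
  set η := quadraticCharComplex F with hη
  have hη1 : η (-1) = -1 := quadraticCharComplex_neg_one h4
  let w (u v : F) : ℂ := κ (u + v) * ψ (2 * (u - v))
  have hw (u v : F) : w (-v) (-u) = -w u v := by
    simp only [w]
    rw [show -v + -u = -(u + v) by ring, hneg κ, hκ, show -v - -u = u - v by ring]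
    ring
  have hswap (g g' : F → F → ℂ) (hg : ∀ u v, g (-v) (-u) = g' u v) :
      ∑ u, ∑ v, g u v * w u v = -∑ u, ∑ v, g' u v * w u v := by
    rw [Finset.sum_comm, ← Equiv.sum_comp (Equiv.neg F), ← Finset.sum_neg_distrib]
    refine Finset.sum_congr rfl fun u _ ↦ ?_
    rw [← Equiv.sum_comp (Equiv.neg F), ← Finset.sum_neg_distrib]
    refine Finset.sum_congr rfl fun v _ ↦ ?_
    simp only [Equiv.neg_apply, hw, hg, mul_neg]
  have e1 : ∑ a, ∑ b, κ (a ^ 2 + b ^ 2) * ψ (2 * (a ^ 2 - b ^ 2)) =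
      ∑ u, ∑ v, ((1 + η u) * (1 + η v)) * w u v := by
    rw [sum_comp_sq_s3 hF fun u ↦ ∑ b, w u (b ^ 2)]
    refine Finset.sum_congr rfl fun u _ ↦ ?_
    rw [sum_comp_sq_s3 hF fun v ↦ w u v, Finset.mul_sum]
    exact Finset.sum_congr rfl fun v _ ↦ by ring
  have e2 := hswap (fun u v ↦ 1 + η u * η v) (fun u v ↦ 1 + η u * η v) fun u v ↦ by
    rw [hneg η, hneg η u, hη1]
    ring
  have e3 := hswap (fun u v ↦ η v) (fun u v ↦ -η u) fun u v ↦ by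
    rw [hneg η, hη1, neg_one_mul]
  have e4 : ∑ u, ∑ v, η u * w u v =
      gaussSum η (ψ.mulShift 4) * gaussSum κ (ψ.mulShift (-2)) := by
    rw [gaussSum, gaussSum, Finset.sum_mul_sum]
    refine Finset.sum_congr rfl fun u _ ↦ ?_
    rw [← (Equiv.subRight u).sum_comp]
    refine Finset.sum_congr rfl fun s _ ↦ ?_
    simp only [w, Equiv.subRight_apply, AddChar.mulShift_apply, add_sub_cancel]
    rw [show 2 * (u - (s - u)) = 4 * u + -2 * s by ring, AddChar.map_add_eq_mul]
    ring
  have s1 := gaussSum_mulShift_eq η ψ (Units.mk0 2 h2 * Units.mk0 2 h2)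
  have s2 := gaussSum_mulShift_eq κ ψ (-Units.mk0 2 h2)
  simp only [Units.val_mul, Units.val_neg, Units.val_mk0] at s1 s2
  have hη4 : η⁻¹ (2 * 2) = 1 := by
    rw [MulChar.inv_apply', mul_inv, ← sq, hη, quadraticCharComplex_apply,
      quadraticChar_sq_one' (inv_ne_zero h2), Int.cast_one]
  rw [hη4, one_mul, show (2 * 2 : F) = 4 by norm_num] at s1
  rw [hneg κ⁻¹, MulChar.inv_apply' κ (-1), inv_neg, inv_one, hκ] at s2
  rw [s1, s2] at e4
  simp only [neg_mul, Finset.sum_neg_distrib, neg_neg] at e3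
  rw [e1]
  have e5 : ∑ u, ∑ v, ((1 + η u) * (1 + η v)) * w u v =
      ∑ u, ∑ v, (1 + η u * η v) * w u v + ∑ u, ∑ v, η u * w u v + ∑ u, ∑ v, η v * w u v := by
    simp_rw [← Finset.sum_add_distrib]
    exact Finset.sum_congr rfl fun u _ ↦ Finset.sum_congr rfl fun v _ ↦ by ring
  have e6 : ∑ u, ∑ v, (1 + η u * η v) * w u v = 0 := by
    linear_combination e2 / 2
  rw [e5, e6, e3, e4]
  ring

end FiniteField

section QuadraticExtension

variable {M L : Type*} [Field M] [Fintype M] [Field L] [Fintype L] [Algebra M L]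

lemma finrank_eq_two_of_card_sq (hL : Fintype.card L = Fintype.card M ^ 2) :
    Module.finrank M L = 2 := by
  rw [Module.card_eq_pow_finrank (K := M)] at hL
  exact Nat.pow_right_injective Fintype.one_lt_card hL

lemma algebraMap_norm_of_card_sq (hL : Fintype.card L = Fintype.card M ^ 2) (z : L) :
    algebraMap M L (Algebra.norm M z) = z * z ^ Fintype.card M := by
  rw [FiniteField.algebraMap_norm_eq_prod_pow, finrank_eq_two_of_card_sq hL,
    Finset.prod_range_succ, Finset.prod_range_one, Nat.card_eq_fintype_card, pow_zero, pow_one,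
    pow_one]

lemma algebraMap_trace_of_card_sq (hL : Fintype.card L = Fintype.card M ^ 2) (z : L) :
    algebraMap M L (Algebra.trace M L z) = z + z ^ Fintype.card M := by
  rw [FiniteField.algebraMap_trace_eq_sum_pow, finrank_eq_two_of_card_sq hL,
    Finset.sum_range_succ, Finset.sum_range_one, Nat.card_eq_fintype_card, pow_zero, pow_one,
    pow_one]

lemma quadraticCharComplex_norm (hF : ringChar M ≠ 2)
    (hL : Fintype.card L = Fintype.card M ^ 2) (z : L) :
    quadraticCharComplex L z = quadraticCharComplex M (Algebra.norm M z) := by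
  have hFL : ringChar L ≠ 2 := by rwa [← Algebra.ringChar_eq M L]
  rw [quadraticCharComplex_apply, quadraticCharComplex_apply]
  congr 1
  refine (quadraticChar_isQuadratic L).eq_of_eq_coe (quadraticChar_isQuadratic M) hFL ?_
  rw [quadraticChar_eq_pow_of_char_ne_two' hFL, ← map_intCast (algebraMap M L),
    quadraticChar_eq_pow_of_char_ne_two' hF, map_pow, algebraMap_norm_of_card_sq hL, ← pow_succ',
    ← pow_mul, hL]
  congr 1
  obtain ⟨k, hk⟩ := Nat.odd_iff.mpr (FiniteField.odd_card_of_char_ne_two hF)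
  rw [hk]
  have e1 : (2 * k + 1) ^ 2 = 2 * (2 * k * (k + 1)) + 1 := by ring
  have e2 : (2 * k + 1) / 2 = k := by omega
  have e3 : (2 * (2 * k * (k + 1)) + 1) / 2 = 2 * k * (k + 1) := by omega
  rw [e1, e2, e3]
  ring

/-- Summation over a quadratic extension `L = M(i)` in terms of norms and traces of squares. -/
lemma sum_norm_trace_sq (h4 : Fintype.card M % 4 = 3)
    (hL : Fintype.card L = Fintype.card M ^ 2) (f : M → M → ℂ) :
    ∑ z : L, f (Algebra.norm M z) (Algebra.trace M L (z ^ 2)) =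
      ∑ a, ∑ b, f (a ^ 2 + b ^ 2) (2 * (a ^ 2 - b ^ 2)) := by
  obtain ⟨i, hi⟩ : IsSquare (-1 : L) := by
    rw [FiniteField.isSquare_neg_one_iff, hL, Nat.pow_mod, h4]
    decide
  have hiQ : i ^ Fintype.card M = -i := by
    obtain ⟨k, hk⟩ : ∃ k, Fintype.card M = 4 * k + 3 := ⟨Fintype.card M / 4, by omega⟩
    have h2 : i ^ 2 = -1 := by rw [sq, hi]
    have h4 : i ^ 4 = 1 := by rw [show i ^ 4 = (i ^ 2) ^ 2 by ring, h2]; ring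
    rw [hk, pow_add, pow_mul, h4, one_pow, one_mul, pow_succ, h2, neg_one_mul]
  have hfrob (a b : M) : (algebraMap M L a + algebraMap M L b * i) ^ Fintype.card M =
      algebraMap M L a - algebraMap M L b * i := by
    have h := map_add (FiniteField.frobeniusAlgHom M L) (algebraMap M L a) (algebraMap M L b * i)
    simp only [map_mul, AlgHom.commutes, FiniteField.coe_frobeniusAlgHom, hiQ] at h
    rw [h]
    ring
  have hnorm (a b : M) :
      Algebra.norm M (algebraMap M L a + algebraMap M L b * i) = a ^ 2 + b ^ 2 := by
    apply FaithfulSMul.algebraMap_injective M L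
    rw [algebraMap_norm_of_card_sq hL, hfrob]
    simp only [map_add, map_pow]
    linear_combination algebraMap M L b ^ 2 * hi
  have htrace (a b : M) : Algebra.trace M L ((algebraMap M L a + algebraMap M L b * i) ^ 2) =
      2 * (a ^ 2 - b ^ 2) := by
    apply FaithfulSMul.algebraMap_injective M L
    rw [algebraMap_trace_of_card_sq hL, ← pow_mul, mul_comm 2, pow_mul, hfrob]
    simp only [map_sub, map_pow, map_mul, map_ofNat]
    linear_combination -2 * algebraMap M L b ^ 2 * hi
  have hbij : Function.Bijective
      fun x : M × M ↦ algebraMap M L x.1 + algebraMap M L x.2 * i := by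
    rw [Fintype.bijective_iff_injective_and_card, Fintype.card_prod, hL, sq]
    refine ⟨?_, rfl⟩
    rintro ⟨a, b⟩ ⟨c, d⟩ h
    have h2 : (2 : L) ≠ 0 := by
      apply Ring.two_ne_zero
      rw [← Algebra.ringChar_eq M L]
      exact ringChar_ne_two_of_card_mod_four h4
    have hi0 : i ≠ 0 := by rintro rfl; simp at hi
    simp only at h
    have h' := congrArg (· ^ Fintype.card M) h
    simp only [hfrob] at h'
    have hac : algebraMap M L a = algebraMap M L c :=
      mul_left_cancel₀ h2 (by linear_combination h + h')
    have hbd : algebraMap M L b = algebraMap M L d :=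
      mul_right_cancel₀ (mul_ne_zero h2 hi0) (by linear_combination h - h')
    rw [FaithfulSMul.algebraMap_injective M L hac, FaithfulSMul.algebraMap_injective M L hbd]
  rw [← Fintype.sum_bijective _ hbij _ _ fun _ ↦ rfl, Fintype.sum_prod_type]
  simp only [hnorm, htrace]

/-- Gauss sums over `L` are invariant under the Frobenius automorphism of `L / M`, which cubes a
character of order four. -/
lemma gaussSum_quartic_conj (h4 : Fintype.card M % 4 = 3) {χ4 χ : MulChar L ℂ}
    (hχ4 : χ4 ^ 4 = 1) {χ' : MulChar M ℂ} (hlift : ∀ x, χ x = χ' (Algebra.norm M x))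
    {ψL : AddChar L ℂ} {ψM : AddChar M ℂ} (hψ : ∀ x, ψL x = ψM (Algebra.trace M L x)) :
    gaussSum (χ4 * χ) ψL = gaussSum (χ4 ^ 3 * χ) ψL := by
  have := Algebra.IsAlgebraic.of_finite M L
  let σ := FiniteField.frobeniusAlgEquivOfAlgebraic M L
  have hσ : χ4 ^ Fintype.card M = χ4 ^ 3 := by
    rw [← Nat.div_add_mod (Fintype.card M) 4, h4, pow_add, pow_mul, hχ4, one_pow, one_mul]
  rw [gaussSum, ← Equiv.sum_comp σ.toEquiv]
  refine Finset.sum_congr rfl fun x _ ↦ ?_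
  have hx : χ4 (σ x) = (χ4 ^ 3) x := by
    rw [← hσ, MulChar.pow_apply' _ Fintype.card_ne_zero, ← map_pow]
    rfl
  change (χ4 * χ) (σ x) * ψL (σ x) = _
  rw [MulChar.mul_apply, MulChar.mul_apply, hx, hlift, hlift, hψ, hψ,
    Algebra.norm_eq_of_algEquiv, Algebra.trace_eq_of_algEquiv]

lemma gaussSum_quartic_mul_lift (h4 : Fintype.card M % 4 = 3)
    (hL : Fintype.card L = Fintype.card M ^ 2) {χ4 χ : MulChar L ℂ} (hχ4 : orderOf χ4 = 4)
    {χ' : MulChar M ℂ} (hlift : ∀ x, χ x = χ' (Algebra.norm M x))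
    {ψL : AddChar L ℂ} {ψM : AddChar M ℂ} (hψ : ∀ x, ψL x = ψM (Algebra.trace M L x)) :
    gaussSum (χ4 * χ) ψL = -(χ' ^ 2 * quadraticCharComplex M)⁻¹ 2 *
      (gaussSum (quadraticCharComplex M) ψM *
        gaussSum (χ' ^ 2 * quadraticCharComplex M) ψM) := by
  have hF := ringChar_ne_two_of_card_mod_four h4
  have hFL : ringChar L ≠ 2 := by rwa [← Algebra.ringChar_eq M L]
  have hχ44 : χ4 ^ 4 = 1 := hχ4 ▸ pow_orderOf_eq_one χ4
  have hη : χ4 ^ 2 = quadraticCharComplex L := by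
    refine MulChar.eq_quadraticCharComplex (by rw [← pow_mul, hχ44]) fun h ↦ ?_
    have := orderOf_le_of_pow_eq_one two_pos h
    omega
  have hκ : (χ' ^ 2 * quadraticCharComplex M) (-1) = -1 := by
    rw [MulChar.mul_apply, quadraticCharComplex_neg_one h4, MulChar.pow_apply' _ two_ne_zero,
      ← map_pow, neg_one_sq, map_one, one_mul]
  have key : gaussSum (χ4 * χ) ψL + gaussSum (χ4 ^ 3 * χ) ψL =
      ∑ z : L, (χ' ^ 2 * quadraticCharComplex M) (Algebra.norm M z) *
        ψM (Algebra.trace M L (z ^ 2)) := by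
    have e : ∑ z, (χ4 * χ) (z ^ 2) * ψL (z ^ 2) = _ :=
      sum_comp_sq_s3 hFL fun z ↦ (χ4 * χ) z * ψL z
    rw [gaussSum, gaussSum, ← Finset.sum_add_distrib]
    trans ∑ z, (χ4 * χ) (z ^ 2) * ψL (z ^ 2)
    · rw [e]
      refine Finset.sum_congr rfl fun x _ ↦ ?_
      rw [← hη, pow_succ χ4 2]
      simp only [MulChar.mul_apply]
      ring
    · refine Finset.sum_congr rfl fun z _ ↦ ?_
      rw [hψ, MulChar.mul_apply, MulChar.mul_apply, ← quadraticCharComplex_norm hF hL, ← hη,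
        hlift, map_pow, map_pow, map_pow, MulChar.pow_apply' _ two_ne_zero,
        MulChar.pow_apply' _ two_ne_zero]
      ring
  rw [← gaussSum_quartic_conj h4 hχ44 hlift hψ,
    sum_norm_trace_sq h4 hL fun x y ↦ (χ' ^ 2 * quadraticCharComplex M) x * ψM y,
    sum_sq_add_sq_eq h4 hκ] at key
  linear_combination key / 2

end QuadraticExtension

lemma MulChar.two_apply_eq_one {F : Type*} [Field F] [Fintype F] {q : ℕ} (hq : 1 < q)
    (hF : Fintype.card F = q ^ 3) {χ : MulChar F ℂ} (hχ : χ ^ (q ^ 2 + q + 1) = 1)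
    (h2 : (2 : F) ≠ 0) (h : (2 : F) ^ (q - 1) = 1) : χ 2 = 1 := by
  obtain ⟨g, hg⟩ := IsCyclic.exists_generator (α := Fˣ)
  obtain ⟨k, hk⟩ := Submonoid.mem_powers_iff _ _ |>.mp
    (mem_powers_iff_mem_zpowers.mpr (hg (Units.mk0 2 h2)))
  have hord : orderOf g = (q ^ 2 + q + 1) * (q - 1) := by
    rw [orderOf_eq_card_of_forall_mem_zpowers hg, Nat.card_eq_fintype_card, Fintype.card_units, hF]
    obtain ⟨r, rfl⟩ := Nat.exists_eq_add_of_lt hq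
    rw [Nat.sub_eq_iff_eq_add (Nat.one_le_pow _ _ (by omega))]
    simp only [Nat.add_sub_cancel]
    ring
  have hk' : g ^ (k * (q - 1)) = 1 := by
    rw [pow_mul, hk]
    ext
    simpa using h
  rw [← orderOf_dvd_iff_pow_eq_one, hord] at hk'
  obtain ⟨j, rfl⟩ := Nat.dvd_of_mul_dvd_mul_right (by omega) hk'
  have : (2 : F) = ((g ^ j : Fˣ) : F) ^ (q ^ 2 + q + 1) := by
    rw [← Units.val_pow_eq_pow_val, ← pow_mul, mul_comm j, hk, Units.val_mk0]
  rw [this, map_pow, ← MulChar.pow_apply_coe, hχ, MulChar.one_apply_coe]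

lemma AddChar.isPrimitive_of_exp_trace {p : ℕ} [Fact p.Prime] {F : Type*} [Field F] [Fintype F]
    [Algebra (ZMod p) F] {ψ : AddChar F ℂ} (hψ : ∀ x : F, ψ x =
      Complex.exp (2 * Real.pi * Complex.I * ((Algebra.trace (ZMod p) F x).val : ℂ) / p)) :
    ψ.IsPrimitive := by
  obtain ⟨x, hx⟩ := Algebra.trace_surjective (ZMod p) F 1
  refine AddChar.IsPrimitive.of_ne_one (AddChar.ne_one_iff.mpr ⟨x, ?_⟩)
  have hp := (Fact.out : p.Prime)
  rw [hψ, hx, ZMod.val_one_eq_one_mod, Nat.mod_eq_of_lt hp.one_lt, Nat.cast_one, mul_one]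
  exact (Complex.isPrimitiveRoot_exp p hp.ne_zero).ne_one hp.one_lt

/-- **Theorem 2.7.** For `q ≡ 3 (mod 4)` and odd `m > 1` dividing `q^2+q+1`:
`G_{q^6}(χ₄χ_m) = G_{q^6}(χ₄³χ_m)` and
`G_{q^6}(χ₄χ_m) = ρ_q · G_{q^3}(χ'_m⁴) · G_{q^3}(χ'_m⁻²)`, where `ρ_q = -1` when
`q ≡ 3 (mod 8)` and `ρ_q = 1` when `q ≡ 7 (mod 8)`. -/
theorem gauss_sum_main
    (p n q : ℕ) (hp : p.Prime) (hn : 0 < n) (hqpn : q = p ^ n) (hq4 : q % 4 = 3)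
    (m : ℕ) (hm1 : 1 < m) (hmodd : Odd m) (hmdvd : m ∣ q ^ 2 + q + 1)
    (M L : Type) [Field M] [Fintype M] [Field L] [Fintype L] [Algebra M L]
    [Algebra (ZMod p) M] [Algebra (ZMod p) L]
    (hM : Fintype.card M = q ^ 3) (hL : Fintype.card L = q ^ 6)
    (χm' : MulChar M ℂ) (hχm' : orderOf χm' = m)
    (χm : MulChar L ℂ) (hlift : ∀ x : L, χm x = χm' (Algebra.norm M x))
    (χ4 : MulChar L ℂ) (hχ4 : orderOf χ4 = 4)
    (ψM : AddChar M ℂ) (hψM : ∀ x : M, ψM x = Complex.exp (2 * Real.pi * Complex.I *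
      ((Algebra.trace (ZMod p) M x).val : ℂ) / p))
    (ψL : AddChar L ℂ) (hψL : ∀ x : L, ψL x = Complex.exp (2 * Real.pi * Complex.I *
      ((Algebra.trace (ZMod p) L x).val : ℂ) / p)) :
    gaussSum (χ4 * χm) ψL = gaussSum (χ4 ^ 3 * χm) ψL ∧
    gaussSum (χ4 * χm) ψL =
      (if q % 8 = 3 then (-1 : ℂ) else 1) *
        (gaussSum (χm' ^ 4) ψM * gaussSum ((χm'⁻¹) ^ 2) ψM) := by
  have : Fact p.Prime := ⟨hp⟩
  have hq2 : q ^ 2 % 8 = 1 := by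
    rcases (by omega : q % 8 = 3 ∨ q % 8 = 7) with h | h <;> simp [Nat.pow_mod, h]
  have hQ8 : Fintype.card M % 8 = q % 8 := by
    rw [hM, pow_succ, Nat.mul_mod, hq2, one_mul, Nat.mod_mod]
  have h4 : Fintype.card M % 4 = 3 := by omega
  have hF := ringChar_ne_two_of_card_mod_four h4
  have hLM : Fintype.card L = Fintype.card M ^ 2 := by rw [hL, hM, ← pow_mul]
  have hψ (x : L) : ψL x = ψM (Algebra.trace M L x) := by
    have : IsScalarTower (ZMod p) M L := .of_algebraMap_eq' (RingHom.ext_zmod _ _)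
    rw [hψL, hψM, Algebra.trace_trace]
  have hχ44 : χ4 ^ 4 = 1 := hχ4 ▸ pow_orderOf_eq_one χ4
  refine ⟨gaussSum_quartic_conj h4 hχ44 hlift hψ, ?_⟩
  have h2 : (2 : M) ≠ 0 := Ring.two_ne_zero hF
  have hχ2 : χm' 2 = 1 := by
    have h2q : (2 : M) ^ q = 2 := by
      have : CharP M p := charP_of_injective_algebraMap (algebraMap (ZMod p) M).injective p
      rw [hqpn, ← iterateFrobenius_def, map_ofNat]
    refine MulChar.two_apply_eq_one (by omega) hM
      (orderOf_dvd_iff_pow_eq_one.mp (hχm' ▸ hmdvd)) h2 (mul_right_cancel₀ h2 ?_)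
    rw [← pow_succ, Nat.sub_add_cancel (by omega), h2q, one_mul]
  have hθ2 : (χm' ^ 2) 2 = 1 := by rw [MulChar.pow_apply' _ two_ne_zero, hχ2, one_pow]
  have hθ4 : (χm' ^ 2) 4 = 1 := by
    rw [show (4 : M) = 2 * 2 by norm_num, map_mul, hθ2, one_mul]
  have hθ1 : (χm' ^ 2) (-1) = 1 := by
    rw [MulChar.pow_apply' _ two_ne_zero, ← map_pow, neg_one_sq, map_one]
  have hθ : (χm' ^ 2) ^ 2 ≠ 1 := by
    rw [← pow_mul, ne_eq, ← orderOf_dvd_iff_pow_eq_one, hχm']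
    intro h
    have : m.Coprime (2 * 2) := (Nat.coprime_two_right.mpr hmodd).mul_right
      (Nat.coprime_two_right.mpr hmodd)
    have := this.eq_one_of_dvd h
    omega
  have hη2 : (χm' ^ 2 * quadraticCharComplex M)⁻¹ 2 = if q % 8 = 3 then (-1 : ℂ) else 1 := by
    rw [mul_inv, MulChar.mul_apply, MulChar.inv_apply_eq_inv', hθ2, inv_one, one_mul,
      MulChar.inv_apply_eq_inv', quadraticCharComplex_apply, quadraticChar_two hF,
      ZMod.χ₈_nat_eq_if_mod_eight]
    rcases (by omega : q % 8 = 3 ∨ q % 8 = 7) with h | h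
    · have : Fintype.card M % 2 ≠ 0 := by omega
      simp [hQ8, h, this]
    · have : Fintype.card M % 2 ≠ 0 := by omega
      simp [hQ8, h, this]
  have hdup := gaussSum_duplication h4 hθ hθ4 hθ1 (AddChar.isPrimitive_of_exp_trace hψM)
  rw [← pow_mul, ← inv_pow] at hdup
  rw [gaussSum_quartic_mul_lift h4 hLM hχ4 hlift hψ, hη2, ← hdup]
  ring
end

section
/- Let q be a prime power with q ≡ 3 (mod 4), and let m > 1 be an odd integer dividing q^2+q+1. Let χ'_m be a multiplicative character of F_{q^3} of order m, let χ_m be its lift to F_{q^6} (i.e. χ_m(x) = χ'_m(x^{q^3+1})), let χ_4 be a multiplicative character of F_{q^6} of order 4, and let χ'_2 be the quadratic character of F_{q^3}. Then G_{F_{q^6}}(χ_4·χ_m) = ρ_q · q^3 · G_{F_{q^3}}(χ'_2·χ'_m{}^2) / G_{F_{q^3}}(χ'_2), where ρ_q = -1 if q ≡ 3 (mod 8) and ρ_q = 1 if q ≡ 7 (mod 8). -/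
open scoped Classical

section QuadraticCharacters

variable {F : Type*} [Field F] [Fintype F]

/-- A finite field has at most one multiplicative character of order two. -/
lemma MulChar.eq_of_orderOf_eq_two {χ χ' : MulChar F ℂ} (hχ : orderOf χ = 2)
    (hχ' : orderOf χ' = 2) : χ = χ' := by
  obtain ⟨g, hg⟩ := IsCyclic.exists_generator (α := Fˣ)
  have apply_generator (φ : MulChar F ℂ) (hφ : orderOf φ = 2) : φ g = -1 := by
    have hsq : φ g ^ 2 = 1 := by
      rw [← MulChar.pow_apply' φ two_ne_zero, ← hφ, pow_orderOf_eq_one, MulChar.one_apply_coe]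
    refine (mul_self_eq_one_iff.mp <| (sq _).symm.trans hsq).resolve_left fun h ↦ ?_
    have : φ = 1 := (MulChar.eq_iff hg φ 1).mpr (by rw [h, MulChar.one_apply_coe])
    rw [this, orderOf_one] at hφ
    omega
  rw [MulChar.eq_iff hg, apply_generator χ hχ, apply_generator χ' hχ']

/-- The character of order two is the quadratic character. -/
lemma MulChar.apply_eq_quadraticChar (hF : ringChar F ≠ 2) {χ : MulChar F ℂ}
    (hχ : orderOf χ = 2) (x : F) : χ x = (quadraticChar F x : ℂ) := by
  have h : orderOf ((quadraticChar F).ringHomComp (Int.castRingHom ℂ)) = 2 :=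
    orderOf_eq_prime ((quadraticChar_isQuadratic F).comp _).sq_eq_one
      ((MulChar.ringHomComp_ne_one_iff (RingHom.injective_int _)).mpr (quadraticChar_ne_one hF))
  rw [MulChar.eq_of_orderOf_eq_two hχ h]
  simp

/-- Summing over squares weights each value by its number of square roots. -/
lemma sum_apply_sq (hF : ringChar F ≠ 2) {χ : MulChar F ℂ} (hχ : orderOf χ = 2) (f : F → ℂ) :
    ∑ x, f (x ^ 2) = ∑ x, (1 + χ x) * f x := by
  rw [← Finset.sum_fiberwise (s := Finset.univ) (g := fun x : F ↦ x ^ 2)]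
  refine Finset.sum_congr rfl fun a _ ↦ ?_
  have hcard := quadraticChar_card_sqrts hF a
  rw [Finset.sum_congr rfl (g := fun _ ↦ f a) fun x hx ↦ by simp [(Finset.mem_filter.mp hx).2],
    Finset.sum_const, nsmul_eq_mul, MulChar.apply_eq_quadraticChar hF hχ, add_comm (1 : ℂ)]
  congr 1
  have : ((Finset.univ.filter fun x : F ↦ x ^ 2 = a).card : ℤ) = quadraticChar F a + 1 := by
    rw [← hcard]
    congr 2
    ext
    simp
  exact_mod_cast this

/-- A two-variable character sum over a quadratic form as a product of Gauss sums. -/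
lemma sum_add_sq_mul_sub_sq (hF : ringChar F ≠ 2) {η μ : MulChar F ℂ} (hη : orderOf η = 2)
    (hη_neg : η (-1) = -1) (hμ_neg : μ (-1) = -1) (hμ_two : μ 2 ^ 2 = 1) (ψ : AddChar F ℂ) :
    ∑ a, ∑ b, μ (a ^ 2 + b ^ 2) * ψ (2 * (a ^ 2 - b ^ 2)) =
      -2 * μ 2 * gaussSum η ψ * gaussSum μ ψ := by
  have two_ne : (2 : F) ≠ 0 := Ring.two_ne_zero hF
  have neg_apply (χ : MulChar F ℂ) (h : χ (-1) = -1) (x : F) : χ (-x) = -χ x := by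
    rw [← neg_one_mul x, map_mul, h, neg_one_mul]
  have symm (f : F → F → ℂ) : ∑ a, ∑ b, f a b = ∑ a, ∑ b, f (-b) (-a) := by
    rw [Finset.sum_comm, ← Equiv.sum_comp (Equiv.neg F)]
    exact Finset.sum_congr rfl fun a _ ↦ (Equiv.sum_comp (Equiv.neg F) fun b ↦ f b (-a)).symm
  have hexpand : ∑ a, ∑ b, μ (a ^ 2 + b ^ 2) * ψ (2 * (a ^ 2 - b ^ 2)) =
      ∑ a, ∑ b, (1 + η a) * (1 + η b) * (μ (a + b) * ψ (2 * (a - b))) := by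
    rw [sum_apply_sq hF hη fun a ↦ ∑ b, μ (a + b ^ 2) * ψ (2 * (a - b ^ 2))]
    refine Finset.sum_congr rfl fun a _ ↦ ?_
    rw [sum_apply_sq hF hη fun b ↦ μ (a + b) * ψ (2 * (a - b)), Finset.mul_sum]
    exact Finset.sum_congr rfl fun b _ ↦ by ring
  have hodd : ∑ a, ∑ b, (1 + η a * η b) * (μ (a + b) * ψ (2 * (a - b))) = 0 := by
    rw [← self_eq_neg]
    conv_lhs => rw [symm]
    simp only [← Finset.sum_neg_distrib]
    refine Finset.sum_congr rfl fun a _ ↦ Finset.sum_congr rfl fun b _ ↦ ?_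
    rw [neg_apply η hη_neg, neg_apply η hη_neg, ← neg_add, neg_apply μ hμ_neg, add_comm b a,
      neg_sub_neg]
    ring
  have hsymm : ∑ a, ∑ b, η b * (μ (a + b) * ψ (2 * (a - b))) =
      ∑ a, ∑ b, η a * (μ (a + b) * ψ (2 * (a - b))) := by
    rw [symm]
    refine Finset.sum_congr rfl fun a _ ↦ Finset.sum_congr rfl fun b _ ↦ ?_
    rw [neg_apply η hη_neg, ← neg_add, neg_apply μ hμ_neg, add_comm b a, neg_sub_neg]
    ring
  have hη_shift : ∑ a, η a * ψ (4 * a) = gaussSum η ψ := by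
    have h := gaussSum_mulShift η ψ (Units.mk0 2 two_ne * Units.mk0 2 two_ne)
    have hη_four : η (2 * 2) = 1 := by
      rw [map_mul, ← sq, ← MulChar.pow_apply' η two_ne_zero, ← hη, pow_orderOf_eq_one,
        MulChar.one_apply two_ne.isUnit]
    rw [Units.val_mul, Units.val_mk0, hη_four, one_mul] at h
    rw [← h]
    norm_num [gaussSum, AddChar.mulShift_apply]
  have hμ_shift : ∑ c, μ c * ψ (-2 * c) = -μ 2 * gaussSum μ ψ := by
    have h := gaussSum_mulShift μ ψ (Units.mk0 (-2) (neg_ne_zero.mpr two_ne))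
    rw [Units.val_mk0, neg_apply μ hμ_neg] at h
    rw [← h, ← mul_assoc, neg_mul_neg, ← sq, hμ_two, one_mul]
    simp [gaussSum, AddChar.mulShift_apply]
  have hmixed : ∑ a, ∑ b, η a * (μ (a + b) * ψ (2 * (a - b))) =
      -μ 2 * gaussSum η ψ * gaussSum μ ψ := by
    have hinner (a : F) : ∑ b, η a * (μ (a + b) * ψ (2 * (a - b))) =
        η a * ψ (4 * a) * ∑ c, μ c * ψ (-2 * c) := by
      rw [← Equiv.sum_comp (Equiv.addLeft a) fun c ↦ μ c * ψ (-2 * c), Finset.mul_sum]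
      refine Finset.sum_congr rfl fun b _ ↦ ?_
      rw [Equiv.coe_addLeft, show 2 * (a - b) = 4 * a + -2 * (a + b) by ring,
        AddChar.map_add_eq_mul]
      ring
    simp only [hinner]
    rw [← Finset.sum_mul, hη_shift, hμ_shift]
    ring
  calc _ = ∑ a, ∑ b, (1 + η a * η b) * (μ (a + b) * ψ (2 * (a - b))) +
        (∑ a, ∑ b, η a * (μ (a + b) * ψ (2 * (a - b))) +
          ∑ a, ∑ b, η b * (μ (a + b) * ψ (2 * (a - b)))) := by
        rw [hexpand]
        simp only [← Finset.sum_add_distrib]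
        exact Finset.sum_congr rfl fun a _ ↦ Finset.sum_congr rfl fun b _ ↦ by ring
    _ = _ := by
        rw [hodd, hsymm, hmixed]
        ring

end QuadraticCharacters

section QuadraticExtension

lemma FiniteField.add_mul_pow_card {M L : Type*} [Field M] [Fintype M] [Field L] [Algebra M L]
    (hM : Fintype.card M % 4 = 3) {i : L} (hi : i ^ 2 = -1) (a b : M) :
    (algebraMap M L a + algebraMap M L b * i) ^ Fintype.card M =
      algebraMap M L a - algebraMap M L b * i := by
  have hpow : i ^ Fintype.card M = -i := by
    have hi4 : i ^ 4 = 1 := by rw [pow_mul i 2 2, hi]; norm_num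
    rw [← Nat.div_add_mod (Fintype.card M) 4, hM, pow_add, pow_mul, hi4, one_pow, one_mul,
      pow_succ, hi, neg_one_mul]
  have h := map_add (FiniteField.frobeniusAlgHom M L) (algebraMap M L a) (algebraMap M L b * i)
  simp only [FiniteField.coe_frobeniusAlgHom, mul_pow, hpow, ← map_pow, FiniteField.pow_card] at h
  rw [h]
  ring

variable {M L : Type*} [Field M] [Fintype M] [Field L] [Fintype L] [Algebra M L]

lemma FiniteField.finrank_eq_two (hML : Fintype.card L = Fintype.card M ^ 2) :
    Module.finrank M L = 2 := by
  have h := Module.card_eq_pow_finrank (K := M) (V := L)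
  rw [hML] at h
  exact (Nat.pow_right_injective Fintype.one_lt_card h).symm

lemma FiniteField.algebraMap_norm_eq_mul_pow_card (hML : Fintype.card L = Fintype.card M ^ 2)
    (x : L) : algebraMap M L (Algebra.norm M x) = x * x ^ Fintype.card M := by
  rw [FiniteField.algebraMap_norm_eq_prod_pow, FiniteField.finrank_eq_two hML,
    Finset.prod_range_succ, Finset.prod_range_one, Nat.card_eq_fintype_card, pow_zero, pow_one,
    pow_one]

lemma FiniteField.algebraMap_trace_eq_add_pow_card
    (hML : Fintype.card L = Fintype.card M ^ 2) (x : L) :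
    algebraMap M L (Algebra.trace M L x) = x + x ^ Fintype.card M := by
  rw [FiniteField.algebraMap_trace_eq_sum_pow, FiniteField.finrank_eq_two hML,
    Finset.sum_range_succ, Finset.sum_range_one, Nat.card_eq_fintype_card, pow_zero, pow_one,
    pow_one]

lemma FiniteField.norm_add_mul (hML : Fintype.card L = Fintype.card M ^ 2)
    (hM : Fintype.card M % 4 = 3) {i : L} (hi : i ^ 2 = -1) (a b : M) :
    Algebra.norm M (algebraMap M L a + algebraMap M L b * i) = a ^ 2 + b ^ 2 := by
  apply (algebraMap M L).injective
  rw [FiniteField.algebraMap_norm_eq_mul_pow_card hML, FiniteField.add_mul_pow_card hM hi]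
  simp only [map_add, map_pow]
  linear_combination -(algebraMap M L b) ^ 2 * hi

lemma FiniteField.trace_add_mul_sq (hML : Fintype.card L = Fintype.card M ^ 2)
    (hM : Fintype.card M % 4 = 3) {i : L} (hi : i ^ 2 = -1) (a b : M) :
    Algebra.trace M L ((algebraMap M L a + algebraMap M L b * i) ^ 2) =
      2 * (a ^ 2 - b ^ 2) := by
  apply (algebraMap M L).injective
  rw [FiniteField.algebraMap_trace_eq_add_pow_card hML, ← pow_mul, mul_comm 2, pow_mul,
    FiniteField.add_mul_pow_card hM hi]
  simp only [map_mul, map_sub, map_pow, map_ofNat]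
  linear_combination 2 * (algebraMap M L b) ^ 2 * hi

lemma FiniteField.sum_add_mul (hML : Fintype.card L = Fintype.card M ^ 2)
    (hM : Fintype.card M % 4 = 3) {i : L} (hi : i ^ 2 = -1) (f : L → ℂ) :
    ∑ x, f x = ∑ a : M, ∑ b : M, f (algebraMap M L a + algebraMap M L b * i) := by
  have hinj : Function.Injective
      fun x : M × M ↦ algebraMap M L x.1 + algebraMap M L x.2 * i := by
    rintro ⟨a, b⟩ ⟨c, d⟩ h
    have hnorm := FiniteField.norm_add_mul hML hM hi (a - c) (b - d)
    have hzero : algebraMap M L (a - c) + algebraMap M L (b - d) * i = 0 := by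
      simp only [map_sub]
      linear_combination h
    rw [hzero, Algebra.norm_zero] at hnorm
    have hbd : b - d = 0 := by
      by_contra hne
      refine FiniteField.isSquare_neg_one_iff.mp ⟨(a - c) / (b - d), ?_⟩ hM
      field_simp
      linear_combination hnorm
    have hac : a - c = 0 := by simpa [hbd] using hnorm.symm
    rw [sub_eq_zero.mp hbd, sub_eq_zero.mp hac]
  have hbij := (Fintype.bijective_iff_injective_and_card _).mpr
    ⟨hinj, by rw [Fintype.card_prod, hML, sq]⟩
  rw [← Fintype.sum_prod_type', ← hbij.sum_comp f]

/-- Evaluation of the Gauss sum of a quartic character times a lifted character over the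
quadratic extension of a finite field with `3 mod 4` elements. -/
lemma gaussSum_quartic_mul_lift_s4 (hML : Fintype.card L = Fintype.card M ^ 2)
    (hM : Fintype.card M % 4 = 3) {χ : MulChar L ℂ} (hχ : orderOf χ = 4) {η α : MulChar M ℂ}
    (hη : orderOf η = 2) (hα_two : α 2 = 1) (hα_neg : α (-1) = 1) {α' : MulChar L ℂ}
    (hlift : ∀ x, α' x = α (Algebra.norm M x)) {ψ : AddChar M ℂ} {ψ' : AddChar L ℂ}
    (hψ : ∀ x, ψ' x = ψ (Algebra.trace M L x)) :
    gaussSum (χ * α') ψ' = -η 2 * gaussSum η ψ * gaussSum (η * α ^ 2) ψ := by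
  have hcharM : ringChar M ≠ 2 := fun h ↦ by
    have := FiniteField.even_card_of_char_two h
    omega
  have hcardL : Fintype.card L % 4 = 1 := by rw [hML, Nat.pow_mod, hM]
  have hcharL : ringChar L ≠ 2 := fun h ↦ by
    have := FiniteField.even_card_of_char_two h
    omega
  obtain ⟨i, hi⟩ := FiniteField.isSquare_neg_one_iff (F := L).mpr (by omega)
  rw [← sq, eq_comm] at hi
  have hη_neg : η (-1) = -1 := by
    rw [MulChar.apply_eq_quadraticChar hcharM hη, quadraticChar_neg_one hcharM,
      ZMod.χ₄_nat_three_mod_four hM]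
    norm_num
  have hη_two : η 2 ^ 2 = 1 := by
    rw [← MulChar.pow_apply' η two_ne_zero, ← hη, pow_orderOf_eq_one,
      MulChar.one_apply (Ring.two_ne_zero hcharM).isUnit]
  have hχ_sq : orderOf (χ ^ 2) = 2 := by
    rw [orderOf_pow' χ two_ne_zero, hχ]
    norm_num
  let η' : MulChar L ℂ :=
    { toMonoidHom := η.toMonoidHom.comp (Algebra.norm M)
      map_nonunit' := fun x hx ↦ by
        have : x = 0 := by simpa using hx
        subst this
        simpa [Algebra.norm_zero] using η.map_zero }
  have hη'_apply (x : L) : η' x = η (Algebra.norm M x) := rfl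
  have hη' : orderOf η' = 2 := by
    refine orderOf_eq_prime (MulChar.ext fun x ↦ ?_) fun h ↦ ?_
    · rw [MulChar.pow_apply' _ two_ne_zero, hη'_apply, ← MulChar.pow_apply' η two_ne_zero, ← hη,
        pow_orderOf_eq_one, MulChar.one_apply_coe, MulChar.one_apply]
      exact (Algebra.norm_ne_zero_iff.mpr x.ne_zero).isUnit
    · obtain ⟨x, hx⟩ := FiniteField.norm_surjective M L (-1)
      have hx0 : x ≠ 0 := by
        rintro rfl
        simp [Algebra.norm_zero] at hx
      have h1 := hη'_apply x
      rw [hx, hη_neg, h, MulChar.one_apply hx0.isUnit] at h1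
      norm_num at h1
  have hχη (x : L) : (χ ^ 2) x = η (Algebra.norm M x) := by
    rw [MulChar.eq_of_orderOf_eq_two hχ_sq hη', hη'_apply]
  have hχ_frob (x : L) : χ (x ^ Fintype.card M) = (χ ^ 2) x * χ x := by
    rcases eq_or_ne x 0 with rfl | hx
    · rw [zero_pow Fintype.card_ne_zero, MulChar.map_zero, mul_zero]
    · have h4 : χ x ^ 4 = 1 := by
        rw [← MulChar.pow_apply' χ four_ne_zero, ← hχ, pow_orderOf_eq_one,
          MulChar.one_apply hx.isUnit]
      rw [map_pow, ← Nat.div_add_mod (Fintype.card M) 4, hM, pow_add, pow_mul, h4, one_pow,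
        one_mul, MulChar.pow_apply' χ two_ne_zero, ← pow_succ]
  have hfrob_bij : Function.Bijective fun x : L ↦ x ^ Fintype.card M := by
    rw [← FiniteField.coe_frobeniusAlgHom M L]
    exact Finite.injective_iff_bijective.mp (FiniteField.frobeniusAlgHom M L).toRingHom.injective
  have hα'_frob (x : L) : α' (x ^ Fintype.card M) = α' x := by
    rw [hlift, hlift, map_pow, FiniteField.pow_card]
  have hψ'_frob (x : L) : ψ' (x ^ Fintype.card M) = ψ' x := by
    rw [hψ, hψ]
    congr 1
    apply (algebraMap M L).injective
    rw [FiniteField.algebraMap_trace_eq_add_pow_card hML,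
      FiniteField.algebraMap_trace_eq_add_pow_card hML, ← pow_mul, ← sq, ← hML,
      FiniteField.pow_card, add_comm]
  have htwist : ∑ x, (χ ^ 2) x * ((χ * α') x * ψ' x) = gaussSum (χ * α') ψ' := by
    rw [gaussSum, ← hfrob_bij.sum_comp fun x ↦ (χ * α') x * ψ' x]
    refine Finset.sum_congr rfl fun x _ ↦ ?_
    rw [MulChar.mul_apply, MulChar.mul_apply, hχ_frob, hα'_frob, hψ'_frob]
    ring
  have hsquares : ∑ x, (χ * α') (x ^ 2) * ψ' (x ^ 2) = 2 * gaussSum (χ * α') ψ' := by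
    rw [sum_apply_sq hcharL hχ_sq fun x ↦ (χ * α') x * ψ' x]
    simp only [add_mul, one_mul, Finset.sum_add_distrib, htwist]
    rw [gaussSum, two_mul]
  have hvalue (x : L) : (χ * α') (x ^ 2) = (η * α ^ 2) (Algebra.norm M x) := by
    rw [MulChar.mul_apply, MulChar.mul_apply, ← hχη, map_pow, map_pow, hlift,
      MulChar.pow_apply' χ two_ne_zero, MulChar.pow_apply' α two_ne_zero]
  have hμ_two : (η * α ^ 2) 2 = η 2 := by
    rw [MulChar.mul_apply, MulChar.pow_apply' α two_ne_zero, hα_two, one_pow, mul_one]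
  have hμ_neg : (η * α ^ 2) (-1) = -1 := by
    rw [MulChar.mul_apply, MulChar.pow_apply' α two_ne_zero, hα_neg, one_pow, mul_one, hη_neg]
  rw [FiniteField.sum_add_mul hML hM hi] at hsquares
  simp only [hvalue, hψ, FiniteField.norm_add_mul hML hM hi,
    FiniteField.trace_add_mul_sq hML hM hi] at hsquares
  rw [sum_add_sq_mul_sub_sq hcharM hη hη_neg hμ_neg (by rw [hμ_two, hη_two]) ψ, hμ_two]
    at hsquares
  linear_combination -hsquares / 2

end QuadraticExtension

/-- A multiplicative character whose order divides the index of a group of roots of unity is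
trivial on that group. -/
lemma MulChar.apply_eq_one_of_pow_eq_one {F : Type*} [Field F] [Fintype F] {χ : MulChar F ℂ}
    {k d : ℕ} (hd : 0 < d) (hcard : Fintype.card F - 1 = k * d) (hχ : orderOf χ ∣ k) {x : F}
    (hx : x ^ d = 1) : χ x = 1 := by
  obtain ⟨g, hg⟩ := IsCyclic.exists_generator (α := Fˣ)
  have hx0 : x ≠ 0 := by
    rintro rfl
    simp [hd.ne'] at hx
  obtain ⟨e, he⟩ := mem_powers_iff_mem_zpowers.mpr (hg (Units.mk0 x hx0))
  have he' : (g : F) ^ e = x := by simpa using congrArg Units.val he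
  have hge : g ^ (e * d) = 1 := by
    ext
    rw [pow_mul, Units.val_pow_eq_pow_val, Units.val_pow_eq_pow_val, he', hx, Units.val_one]
  have hdvd : k * d ∣ e * d := by
    rw [← hcard, ← Fintype.card_units, ← orderOf_eq_card_of_forall_mem_zpowers hg |>.trans
      Nat.card_eq_fintype_card]
    exact orderOf_dvd_of_pow_eq_one hge
  obtain ⟨r, rfl⟩ := hχ.trans (Nat.dvd_of_mul_dvd_mul_right hd hdvd)
  rw [← he', map_pow, pow_mul, ← MulChar.pow_apply_coe, pow_orderOf_eq_one,
    MulChar.one_apply_coe, one_pow]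

/-- The canonical additive character of a finite field is primitive. -/
lemma AddChar.isPrimitive_of_apply_eq_exp_trace {p : ℕ} (hp : p.Prime) {F : Type*} [Field F]
    [Finite F] [Algebra (ZMod p) F] {ψ : AddChar F ℂ}
    (hψ : ∀ x, ψ x = Complex.exp (2 * Real.pi * Complex.I *
      ((Algebra.trace (ZMod p) F x).val : ℂ) / p)) : ψ.IsPrimitive := by
  have : Fact p.Prime := ⟨hp⟩
  refine AddChar.IsPrimitive.of_ne_one fun h ↦ ?_
  obtain ⟨x, hx⟩ := Algebra.trace_surjective (ZMod p) F 1
  have h1 := hψ x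
  rw [h, hx, ZMod.val_one, AddChar.one_apply, Nat.cast_one, mul_one] at h1
  exact (Complex.isPrimitiveRoot_exp p hp.ne_zero).ne_one hp.one_lt h1.symm

/-- **Corollary 2.8.** For `q ≡ 3 (mod 4)` and odd `m > 1` dividing `q^2+q+1`:
`G_{q^6}(χ₄χ_m) = ρ_q · q³ · G_{q^3}(χ'₂ χ'_m²) / G_{q^3}(χ'₂)`, where `χ'₂` is the quadratic
character of `F_{q^3}`, and `ρ_q = -1` when `q ≡ 3 (mod 8)` and `ρ_q = 1` when
`q ≡ 7 (mod 8)`. -/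
theorem gauss_sum_corollary
    (p n q : ℕ) (hp : p.Prime) (hn : 0 < n) (hqpn : q = p ^ n) (hq4 : q % 4 = 3)
    (m : ℕ) (hm1 : 1 < m) (hmodd : Odd m) (hmdvd : m ∣ q ^ 2 + q + 1)
    (M L : Type) [Field M] [Fintype M] [Field L] [Fintype L] [Algebra M L]
    [Algebra (ZMod p) M] [Algebra (ZMod p) L]
    (hM : Fintype.card M = q ^ 3) (hL : Fintype.card L = q ^ 6)
    (χm' : MulChar M ℂ) (hχm' : orderOf χm' = m)
    (χm : MulChar L ℂ) (hlift : ∀ x : L, χm x = χm' (Algebra.norm M x))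
    (χ4 : MulChar L ℂ) (hχ4 : orderOf χ4 = 4)
    (χ2' : MulChar M ℂ) (hχ2' : orderOf χ2' = 2)
    (ψM : AddChar M ℂ) (hψM : ∀ x : M, ψM x = Complex.exp (2 * Real.pi * Complex.I *
      ((Algebra.trace (ZMod p) M x).val : ℂ) / p))
    (ψL : AddChar L ℂ) (hψL : ∀ x : L, ψL x = Complex.exp (2 * Real.pi * Complex.I *
      ((Algebra.trace (ZMod p) L x).val : ℂ) / p)) :
    gaussSum (χ4 * χm) ψL =
      (if q % 8 = 3 then (-1 : ℂ) else 1) * (q : ℂ) ^ 3 *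
        gaussSum (χ2' * χm' ^ 2) ψM / gaussSum χ2' ψM := by
  have : Fact p.Prime := ⟨hp⟩
  have hcardM : Fintype.card M % 4 = 3 := by rw [hM, Nat.pow_mod, hq4]
  have hcardML : Fintype.card L = Fintype.card M ^ 2 := by rw [hL, hM, ← pow_mul]
  have hcharM : ringChar M ≠ 2 := fun h ↦ by
    have := FiniteField.even_card_of_char_two h
    omega
  have two_ne : (2 : M) ≠ 0 := Ring.two_ne_zero hcharM
  have htower : IsScalarTower (ZMod p) M L :=
    IsScalarTower.of_algebraMap_eq' (RingHom.ext_zmod _ _)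
  have hψ (x : L) : ψL x = ψM (Algebra.trace M L x) := by
    rw [hψL, hψM, Algebra.trace_trace]
  have hα_neg : χm' (-1) = 1 := by
    have hodd : χm' (-1) ^ m = 1 := by
      rw [← MulChar.pow_apply' χm' (by omega), ← hχm', pow_orderOf_eq_one,
        MulChar.one_apply isUnit_one.neg]
    rw [← map_pow, hmodd.neg_one_pow] at hodd
    exact hodd
  have hα_two : χm' 2 = 1 := by
    have hq_pos : 0 < q - 1 := by omega
    refine MulChar.apply_eq_one_of_pow_eq_one hq_pos (k := q ^ 2 + q + 1) ?_ (hχm' ▸ hmdvd) ?_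
    · rw [hM]
      obtain ⟨r, rfl⟩ : ∃ r, q = r + 1 := ⟨q - 1, by omega⟩
      rw [Nat.add_sub_cancel, Nat.sub_eq_iff_eq_add (Nat.one_le_pow _ (r + 1) r.succ_pos)]
      ring
    · have hfix : (2 : M) ^ q = 2 := by
        rw [hqpn, ← map_ofNat (algebraMap (ZMod p) M) 2, ← map_pow, ZMod.pow_card_pow]
      apply mul_right_cancel₀ two_ne
      rw [← pow_succ, Nat.sub_add_cancel (by omega), hfix, one_mul]
  have hη_neg : χ2' (-1) = -1 := by
    rw [MulChar.apply_eq_quadraticChar hcharM hχ2', quadraticChar_neg_one hcharM,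
      ZMod.χ₄_nat_three_mod_four hcardM]
    norm_num
  have hη_two : χ2' 2 = if q % 8 = 3 then (-1 : ℂ) else 1 := by
    have hq8 : q % 8 = 3 ∨ q % 8 = 7 := by omega
    rw [MulChar.apply_eq_quadraticChar hcharM hχ2', quadraticChar_two hcharM,
      ZMod.χ₈_nat_eq_if_mod_eight, hM]
    rcases hq8 with h | h <;> simp [Nat.pow_mod, h, show q ^ 3 % 2 = 1 by
      rw [Nat.pow_mod, show q % 2 = 1 by omega]]
  have hsq : gaussSum χ2' ψM ^ 2 = -(q : ℂ) ^ 3 := by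
    have hη_ne : χ2' ≠ 1 := fun h ↦ by
      rw [h, orderOf_one] at hχ2'
      omega
    rw [gaussSum_sq hη_ne (MulChar.isQuadratic_iff_sq_eq_one.mpr (hχ2' ▸ pow_orderOf_eq_one χ2'))
      (AddChar.isPrimitive_of_apply_eq_exp_trace hp hψM), hη_neg, hM]
    push_cast
    ring
  have hq0 : (q : ℂ) ≠ 0 := Nat.cast_ne_zero.mpr (by omega)
  have hne : gaussSum χ2' ψM ≠ 0 := fun h ↦ by
    rw [h, zero_pow two_ne_zero, zero_eq_neg] at hsq
    exact pow_ne_zero 3 hq0 hsq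
  rw [gaussSum_quartic_mul_lift_s4 hcardML hcardM hχ4 hχ2' hα_two hα_neg hlift hψ, ← hη_two,
    eq_div_iff hne]
  linear_combination -(χ2' 2 * gaussSum (χ2' * χm' ^ 2) ψM) * hsq
end

section
/- Let q be a prime power with q ≡ 3 (mod 4), and let m > 1 be an odd integer dividing q^2+q+1. Let χ_m be the lift to F_{q^6} of a multiplicative character of F_{q^3} of order m, and let χ_4 be a multiplicative character of F_{q^6} of order 4. Then G_{F_{q^6}}(χ_4·χ_m)^2 = G_{F_{q^6}}(χ_m^4) · G_{F_{q^6}}(χ_m^{-2}). -/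
open scoped Classical

section MulCharLemmas

variable {F R : Type*} [Field F] [Fintype F] [Field R]

/-- A finite field carries at most one multiplicative character of order two. -/
theorem MulChar.eq_of_sq_eq_one_of_ne_one {χ φ : MulChar F R} (hχ : χ ^ 2 = 1) (hχ1 : χ ≠ 1)
    (hφ : φ ^ 2 = 1) (hφ1 : φ ≠ 1) : χ = φ := by
  obtain ⟨g, hg⟩ := IsCyclic.exists_generator (α := Fˣ)
  have key : ∀ θ : MulChar F R, θ ^ 2 = 1 → θ ≠ 1 → θ g = -1 := by
    intro θ h h1
    have h2 : θ g ^ 2 = 1 := by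
      rw [← MulChar.pow_apply_coe, h, MulChar.one_apply_coe]
    refine (sq_eq_one_iff.1 h2).resolve_left fun h3 => h1 ?_
    rw [MulChar.eq_iff hg, h3, MulChar.one_apply_coe]
  rw [MulChar.eq_iff hg, key χ hχ hχ1, key φ hφ hφ1]

/-- A multiplicative character of order dividing `b` is trivial on the elements of order dividing
`a` when `a * b` is the order of the unit group. -/
theorem MulChar.apply_eq_one_of_pow_eq_one_s5 {χ : MulChar F R} {a b : ℕ}
    (hab : Fintype.card F - 1 = a * b) (hχ : χ ^ b = 1) {x : F} (hx : x ^ a = 1) : χ x = 1 := by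
  have hpos : 0 < a * b := by
    have := Fintype.one_lt_card (α := F)
    omega
  have ha : 0 < a := Nat.pos_of_mul_pos_right hpos
  obtain ⟨g, hg⟩ := IsCyclic.exists_generator (α := Fˣ)
  have hord : orderOf g = a * b := by
    rw [orderOf_eq_card_of_forall_mem_zpowers hg, Nat.card_eq_fintype_card, Fintype.card_units, hab]
  obtain ⟨u, rfl⟩ := (IsUnit.of_pow_eq_one hx ha.ne')
  obtain ⟨k, rfl⟩ := (mem_powers_iff_mem_zpowers).2 (hg u)
  have h1 : g ^ (k * a) = 1 := by
    rw [pow_mul]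
    exact Units.ext (by simpa using hx)
  have h2 : a * b ∣ a * k := by
    rw [← hord, mul_comm a k]
    exact orderOf_dvd_of_pow_eq_one h1
  obtain ⟨c, rfl⟩ := Nat.dvd_of_mul_dvd_mul_left ha h2
  simp only [Units.val_pow_eq_pow_val, map_pow]
  rw [pow_mul, ← MulChar.pow_apply_coe, hχ, MulChar.one_apply_coe, one_pow]

/-- The Gauss sum is invariant under raising the character to a power of the characteristic, when
the additive character is invariant under Frobenius. -/
theorem gaussSum_pow_char_pow (p : ℕ) [Fact p.Prime] [CharP F p] (χ : MulChar F R)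
    {ψ : AddChar F R} (hψ : ∀ x, ψ (x ^ p) = ψ x) (k : ℕ) :
    gaussSum (χ ^ p ^ k) ψ = gaussSum χ ψ := by
  induction k with
  | zero => simp
  | succ k ih =>
    rw [pow_succ, pow_mul, ← ih]
    generalize χ ^ p ^ k = φ
    refine Fintype.sum_bijective (frobenius F p) (bijective_frobenius F p) _ _ fun x => ?_
    rw [frobenius_def, hψ, map_pow, MulChar.pow_apply' _ (Fact.out : p.Prime).ne_zero]

/-- Lifting a multiplicative character through the norm preserves its order. -/
theorem MulChar.orderOf_lift {K : Type*} [Field K] [Fintype K] [Algebra K F]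
    {χ : MulChar F R} {χ' : MulChar K R} (h : ∀ x, χ x = χ' (Algebra.norm K x)) :
    orderOf χ = orderOf χ' := by
  refine orderOf_eq_orderOf_iff.2 fun n => ⟨fun hn => ?_, fun hn => ?_⟩
  · ext u
    obtain ⟨v, rfl⟩ := FiniteField.unitsMap_norm_surjective K F u
    have : (χ ^ n) v = 1 := by rw [hn, MulChar.one_apply_coe]
    rw [MulChar.pow_apply_coe, h] at this
    rw [MulChar.pow_apply_coe, MulChar.one_apply_coe]
    exact this
  · ext v
    have : (χ' ^ n) (Units.map (Algebra.norm K (S := F)) v) = 1 := by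
      rw [hn, MulChar.one_apply_coe]
    rw [MulChar.pow_apply_coe] at this
    rw [MulChar.pow_apply_coe, MulChar.one_apply_coe, h]
    exact this

variable [CharZero R]

/-- The fibres of squaring are counted by the multiplicative character of order two. -/
theorem MulChar.sum_comp_sq {η : MulChar F R} (hF : ringChar F ≠ 2) (hη : η ^ 2 = 1) (hη1 : η ≠ 1)
    (f : F → R) : ∑ y, f (y ^ 2) = ∑ u, (η u + 1) * f u := by
  classical
  have hquad : η = (quadraticChar F).ringHomComp (Int.castRingHom R) := by
    refine MulChar.eq_of_sq_eq_one_of_ne_one hη hη1 ?_ ?_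
    · exact ((quadraticChar_isQuadratic F).comp _).sq_eq_one
    · exact (MulChar.ringHomComp_ne_one_iff (RingHom.injective_int _)).2 (quadraticChar_ne_one hF)
  have hcard (u : F) : (((Finset.univ.filter fun y : F => y ^ 2 = u).card : ℕ) : R) = η u + 1 := by
    have h := quadraticChar_card_sqrts hF u
    rw [hquad, MulChar.ringHomComp_apply, eq_intCast, ← Int.cast_one, ← Int.cast_add, ← h,
      Int.cast_natCast]
    congr 2
    ext y
    simp
  rw [← Finset.sum_fiberwise (s := Finset.univ) (g := fun y : F => y ^ 2)]
  refine Finset.sum_congr rfl fun u _ => ?_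
  rw [← hcard, ← nsmul_eq_mul, ← Finset.sum_const]
  refine Finset.sum_congr rfl fun y hy => ?_
  rw [(Finset.mem_filter.1 hy).2]

theorem jacobiSum_self {χ η : MulChar F R} (hF : ringChar F ≠ 2) (hχ : χ ≠ 1) (hη : η ^ 2 = 1)
    (hη1 : η ≠ 1) : χ 4 * jacobiSum χ χ = jacobiSum χ η := by
  have h2 : (2 : F) ≠ 0 := Ring.two_ne_zero hF
  have h : χ 4 * jacobiSum χ χ = ∑ y : F, χ (1 - y ^ 2) := by
    rw [jacobiSum, Finset.mul_sum]
    refine Fintype.sum_bijective (fun x : F => 2 * x - 1) ?_ _ _ fun x => ?_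
    · refine Finite.injective_iff_bijective.1 fun x y hxy => ?_
      exact mul_left_cancel₀ h2 (sub_left_injective hxy)
    · rw [← map_mul, ← map_mul]
      congr 1
      ring
  rw [h, MulChar.sum_comp_sq hF hη hη1 fun u => χ (1 - u)]
  simp only [add_mul, one_mul, Finset.sum_add_distrib]
  have h0 : ∑ u : F, χ (1 - u) = 0 := by
    exact ((Equiv.subLeft (1 : F)).sum_comp χ).trans (MulChar.sum_eq_zero_of_ne_one hχ)
  rw [h0, add_zero, jacobiSum_comm, jacobiSum]

/-- The Hasse-Davenport product formula for the quadratic character. -/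
theorem gaussSum_mul_gaussSum_mul_quadratic {χ η : MulChar F R} {ψ : AddChar F R}
    (hF : ringChar F ≠ 2) (hχ : χ ^ 2 ≠ 1) (hη : η ^ 2 = 1) (hη1 : η ≠ 1) (hψ : ψ.IsPrimitive) :
    χ 4 * (gaussSum χ ψ * gaussSum (χ * η) ψ) = gaussSum (χ ^ 2) ψ * gaussSum η ψ := by
  have hχ1 : χ ≠ 1 := by
    rintro rfl
    exact hχ (one_pow 2)
  have hχη : χ * η ≠ 1 := fun h => hχ <| by
    have h' : (χ * η) ^ 2 = 1 := by rw [h, one_pow]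
    rwa [mul_pow, hη, mul_one] at h'
  have h0 : gaussSum χ ψ ≠ 0 :=
    gaussSum_ne_zero_of_nontrivial (Nat.cast_ne_zero.2 Fintype.card_ne_zero) hχ1 hψ
  have e1 := jacobiSum_mul_nontrivial (pow_two χ ▸ hχ) ψ
  have e2 := jacobiSum_mul_nontrivial hχη ψ
  rw [← jacobiSum_self hF hχ1 hη hη1] at e2
  rw [← pow_two χ] at e1
  refine mul_left_cancel₀ h0 ?_
  linear_combination (-χ 4 * gaussSum (χ * η) ψ) * e1 + gaussSum (χ ^ 2) ψ * e2

end MulCharLemmas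

section TraceCharacter

variable {p : ℕ} [Fact p.Prime] {L : Type*} [Field L] [Fintype L] [Algebra (ZMod p) L]
  {ψ : AddChar L ℂ}

theorem AddChar.isPrimitive_of_eq_exp_trace (hψ : ∀ x : L, ψ x =
    Complex.exp (2 * Real.pi * Complex.I * ((Algebra.trace (ZMod p) L x).val : ℂ) / p)) :
    ψ.IsPrimitive := by
  have hp : p.Prime := Fact.out
  refine AddChar.IsPrimitive.of_ne_one fun h => ?_
  obtain ⟨b, hb⟩ := Algebra.trace_surjective (ZMod p) L 1
  have h1 := hψ b
  have : Fact (1 < p) := ⟨hp.one_lt⟩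
  rw [h, AddChar.one_apply, hb, ZMod.val_one, Nat.cast_one, mul_one] at h1
  exact (Complex.isPrimitiveRoot_exp p hp.ne_zero).ne_one hp.one_lt h1.symm

theorem Algebra.trace_zmod_pow_char (x : L) :
    Algebra.trace (ZMod p) L (x ^ p) = Algebra.trace (ZMod p) L x := by
  have h := Algebra.trace_eq_of_algEquiv (FiniteField.frobeniusAlgEquivOfAlgebraic (ZMod p) L) x
  simpa [ZMod.card] using h

end TraceCharacter

/-- **Equation (2.8) in the proof of Theorem 2.7.** For `q ≡ 3 (mod 4)` and odd `m > 1`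
dividing `q^2+q+1`: `G_{q^6}(χ₄χ_m)² = G_{q^6}(χ_m⁴) · G_{q^6}(χ_m⁻²)`. -/
theorem gauss_sum_square
    (p n q : ℕ) (hp : p.Prime) (hn : 0 < n) (hqpn : q = p ^ n) (hq4 : q % 4 = 3)
    (m : ℕ) (hm1 : 1 < m) (hmodd : Odd m) (hmdvd : m ∣ q ^ 2 + q + 1)
    (M L : Type) [Field M] [Fintype M] [Field L] [Fintype L] [Algebra M L]
    [Algebra (ZMod p) M] [Algebra (ZMod p) L]
    (hM : Fintype.card M = q ^ 3) (hL : Fintype.card L = q ^ 6)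
    (χm' : MulChar M ℂ) (hχm' : orderOf χm' = m)
    (χm : MulChar L ℂ) (hlift : ∀ x : L, χm x = χm' (Algebra.norm M x))
    (χ4 : MulChar L ℂ) (hχ4 : orderOf χ4 = 4)
    (ψL : AddChar L ℂ) (hψL : ∀ x : L, ψL x = Complex.exp (2 * Real.pi * Complex.I *
      ((Algebra.trace (ZMod p) L x).val : ℂ) / p)) :
    gaussSum (χ4 * χm) ψL ^ 2 = gaussSum (χm ^ 4) ψL * gaussSum ((χm⁻¹) ^ 2) ψL := by
  have : Fact p.Prime := ⟨hp⟩
  have : CharP L p := charP_of_injective_algebraMap (algebraMap (ZMod p) L).injective p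
  have hq0 : 3 ≤ q := by omega
  have hp2 : p ≠ 2 := by
    rintro rfl
    have : 2 ∣ q := hqpn ▸ dvd_pow_self 2 hn.ne'
    omega
  have hF : ringChar L ≠ 2 := by rwa [ringChar.eq L p]
  have hψ : ψL.IsPrimitive := AddChar.isPrimitive_of_eq_exp_trace hψL
  have hfrob (x : L) : ψL (x ^ p) = ψL x := by
    rw [hψL, hψL, Algebra.trace_zmod_pow_char]
  have hm : orderOf χm = m := (MulChar.orderOf_lift hlift).trans hχm'
  have hm_pow (k : ℕ) : χm ^ k = 1 ↔ m ∣ k := by rw [← hm, orderOf_dvd_iff_pow_eq_one]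
  have h4_pow (k : ℕ) : χ4 ^ k = 1 ↔ 4 ∣ k := by rw [← hχ4, orderOf_dvd_iff_pow_eq_one]
  obtain ⟨c, hc⟩ : ∃ c, q = 4 * c + 3 := ⟨q / 4, by omega⟩
  -- characters of order dividing `4` or `m` are trivial on the units of the field with `q` elements
  have hcard : Fintype.card L - 1 =
      (q - 1) * ((q + 1) * (q ^ 2 + q + 1) * (q * (q - 1) + 1)) := by
    rw [hL]
    obtain ⟨k, rfl⟩ : ∃ k, q = k + 1 := ⟨q - 1, by omega⟩
    rw [Nat.add_sub_cancel, Nat.sub_eq_iff_eq_add (Nat.one_le_pow _ _ (by omega))]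
    ring
  have h4q : 4 ∣ q + 1 := by omega
  have hm_triv {x : L} (hx : x ^ (q - 1) = 1) : χm x = 1 :=
    MulChar.apply_eq_one_of_pow_eq_one_s5 hcard
      ((hm_pow _).2 ((hmdvd.mul_left _).mul_right _)) hx
  have h4_triv {x : L} (hx : x ^ (q - 1) = 1) : χ4 x = 1 :=
    MulChar.apply_eq_one_of_pow_eq_one_s5 hcard
      ((h4_pow _).2 ((h4q.mul_right _).mul_right _)) hx
  have hfour : (4 : L) ^ (q - 1) = 1 := by
    have h0 : (4 : L) ≠ 0 := by
      have := Ring.two_ne_zero hF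
      rw [show (4 : L) = 2 * 2 by norm_num]
      exact mul_ne_zero this this
    refine mul_right_cancel₀ h0 ?_
    rw [← pow_succ, Nat.sub_add_cancel (by omega), one_mul, hqpn]
    have := map_natCast (iterateFrobenius L p n) 4
    simpa [iterateFrobenius_def] using this
  have hneg : (-1 : L) ^ (q - 1) = 1 := Even.neg_one_pow ⟨2 * c + 1, by omega⟩
  have hη : (χ4 ^ 2) ^ 2 = 1 := by
    rw [← pow_mul, h4_pow]
  have hη1 : χ4 ^ 2 ≠ 1 := by
    rw [Ne, h4_pow]
    decide
  have hm_odd : ¬ 2 ∣ m := hmodd.not_two_dvd_nat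
  have hcop : Nat.Coprime m 2 := hmodd.coprime_two_right
  have hμ1 : χm ^ 2 ≠ 1 := by
    rw [Ne, hm_pow]
    intro h
    have := Nat.le_of_dvd two_pos h
    exact hm_odd ((by omega : m = 2) ▸ dvd_rfl)
  have hμ2 : (χm ^ 2) ^ 2 ≠ 1 := by
    rw [Ne, ← pow_mul, hm_pow]
    exact fun h => hμ1 ((hm_pow 2).2 (hcop.dvd_of_dvd_mul_left h))
  have hχ2 : (χ4 * χm) ^ 2 ≠ 1 := fun h => hη1 <| by
    have h' : ((χ4 * χm) ^ 2) ^ m = 1 := by rw [h, one_pow]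
    rw [mul_pow, mul_pow, ← pow_mul χm, (hm_pow (2 * m)).2 (dvd_mul_left _ _), mul_one] at h'
    obtain ⟨k, rfl⟩ := hmodd
    rwa [pow_succ, pow_mul, hη, one_pow, one_mul] at h'
  have hconj : (χ4 * χm) ^ q ^ 3 = χ4 * χm * χ4 ^ 2 := by
    have h4 : χ4 ^ q ^ 3 = χ4 ^ 3 := by
      rw [pow_eq_pow_iff_modEq, hχ4]
      exact (show q ≡ 3 [MOD 4] from hq4).pow 3
    have h1 : χm ^ q ^ 3 = χm := by
      conv_rhs => rw [← pow_one χm]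
      rw [pow_eq_pow_iff_modEq, hm]
      refine ((Nat.modEq_iff_dvd' (Nat.one_le_pow _ _ (by omega))).2 ?_).symm
      have : q ^ 3 - 1 = (q ^ 2 + q + 1) * (q - 1) := by
        obtain ⟨k, rfl⟩ : ∃ k, q = k + 1 := ⟨q - 1, by omega⟩
        rw [Nat.add_sub_cancel, Nat.sub_eq_iff_eq_add (Nat.one_le_pow _ _ (by omega))]
        ring
      exact this ▸ hmdvd.mul_right _
    rw [mul_pow, h4, h1, mul_right_comm, pow_succ' χ4 2]
  have hG : gaussSum (χ4 * χm * χ4 ^ 2) ψL = gaussSum (χ4 * χm) ψL := by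
    rw [← hconj, hqpn, ← pow_mul]
    exact gaussSum_pow_char_pow p _ hfrob _
  have e1 := gaussSum_mul_gaussSum_mul_quadratic hF hχ2 hη hη1 hψ
  rw [hG, MulChar.mul_apply, hm_triv hfour, h4_triv hfour, mul_pow, mul_comm (χ4 ^ 2)] at e1
  have e2 := gaussSum_mul_gaussSum_mul_quadratic hF hμ2 hη hη1 hψ
  rw [MulChar.pow_apply' _ two_ne_zero, hm_triv hfour, ← pow_mul] at e2
  have e3 := gaussSum_sq hη1 (MulChar.isQuadratic_iff_sq_eq_one.2 hη) hψ
  rw [MulChar.pow_apply' _ two_ne_zero, h4_triv hneg] at e3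
  have e4 := gaussSum_mul_gaussSum_eq_card hμ1 hψ
  have e5 := mul_gaussSum_inv_eq_gaussSum (χm ^ 2)⁻¹ ψL
  rw [MulChar.inv_apply', inv_neg, inv_one, MulChar.pow_apply' _ two_ne_zero, hm_triv hneg, one_pow,
    one_mul] at e5
  rw [e5] at e4
  have h0 : gaussSum (χm ^ 2) ψL ≠ 0 :=
    gaussSum_ne_zero_of_nontrivial (Nat.cast_ne_zero.2 Fintype.card_ne_zero) hμ1 hψ
  rw [inv_pow]
  refine mul_left_cancel₀ h0 ?_
  linear_combination gaussSum (χm ^ 2) ψL * e1 + gaussSum (χ4 ^ 2) ψL * e2 +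
    gaussSum (χm ^ 4) ψL * e3 - gaussSum (χm ^ 4) ψL * e4
end

section
/- Let q be a prime power, let m ≥ 1 be an integer, and let M be a set of points of the elliptic quadric Q^-(5,q) with |M| = m(q^3+1). Define D = {λx : λ ∈ F_q^×, the span of x belongs to M} ⊆ F_{q^6}. Then M is an m-ovoid of Q^-(5,q) if and only if for every nonzero a ∈ F_{q^6}, the character sum Σ_{x∈D} ψ(ax) equals -q^3 + m(q-1) if a^{q^3} ∈ D, and equals m(q-1) otherwise, where ψ is the canonical additive character of F_{q^6}. -/
open scoped Classical

section QuadraticSpace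

variable {K V : Type*} [Field K] [Fintype K] [AddCommGroup V] [Module K V] [Fintype V]

lemma card_filter_mem_submodule (W : Submodule K V) :
    (Finset.univ.filter (· ∈ W)).card = Fintype.card K ^ Module.finrank K W := by
  rw [← Fintype.card_subtype, ← Module.card_eq_pow_finrank (K := K) (V := W)]

lemma card_mul_card_fiber_functional (f : V →ₗ[K] K) (hf : f ≠ 0) (k : K) :
    Fintype.card K * (Finset.univ.filter (fun v => f v = k)).card = Fintype.card V := by
  have hs := LinearMap.surjective_iff_ne_zero.2 hf
  have h := Finset.card_eq_sum_card_fiberwise (f := f) (s := (Finset.univ : Finset V))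
    (t := Finset.univ) (fun _ _ => Finset.mem_coe.2 (Finset.mem_univ _))
  rw [Finset.sum_congr rfl fun j _ =>
    AddMonoidHom.card_fiber_eq_of_mem_range f (hs j) (hs k)] at h
  simpa using h.symm

lemma card_mul_card_fiber_functional_submodule (W : Submodule K V) (f : V →ₗ[K] K)
    (hf : ∃ w ∈ W, f w ≠ 0) (k : K) :
    Fintype.card K * (Finset.univ.filter (fun v => v ∈ W ∧ f v = k)).card =
      Fintype.card K ^ Module.finrank K W := by
  obtain ⟨w, hw, hfw⟩ := hf
  have h := card_mul_card_fiber_functional (f.domRestrict W)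
    (fun h0 => hfw (by simpa using LinearMap.congr_fun h0 ⟨w, hw⟩)) k
  rw [Module.card_eq_pow_finrank (K := K) (V := W)] at h
  rw [← h]
  congr 1
  symm
  refine Finset.card_bij (fun a _ => (a : V)) ?_ ?_ ?_
  · intro a ha
    exact Finset.mem_filter.2 ⟨Finset.mem_univ _, a.2, (Finset.mem_filter.1 ha).2⟩
  · intro a _ b _ hab; exact Subtype.ext hab
  · intro b hb
    simp only [Finset.mem_filter, Finset.mem_univ, true_and] at hb
    exact ⟨⟨b, hb.1⟩, Finset.mem_filter.2 ⟨Finset.mem_univ _, hb.2⟩, rfl⟩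

/-- Outside the orthogonal complement of a totally singular subspace, exactly one vector
in `q` is singular. -/
lemma card_singular_not_mem_orthogonal (Q : QuadraticForm K V) (W : Submodule K V)
    (hW : ∀ w ∈ W, Q w = 0) :
    Fintype.card K * (Finset.univ.filter
        (fun x => Q x = 0 ∧ x ∉ LinearMap.BilinForm.orthogonal Q.polarBilin W)).card =
      (Finset.univ.filter
        (fun x => x ∉ LinearMap.BilinForm.orthogonal Q.polarBilin W)).card := by
  set U := LinearMap.BilinForm.orthogonal Q.polarBilin W with hU
  have hWU : W ≤ U := by
    intro x hx w hw
    simp [QuadraticMap.polar, hW w hw, hW x hx, hW _ (W.add_mem hw hx)]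
  have key : ∀ x ∈ Finset.univ.filter (fun x => x ∉ U),
      Fintype.card K * (Finset.bipartiteAbove (fun x w => Q (x + w) = 0)
        (Finset.univ.filter (· ∈ W)) x).card = Fintype.card K ^ Module.finrank K W := by
    intro x hx
    have hx' : ∃ w ∈ W, Q.polarBilin x w ≠ 0 := by
      simp only [Finset.mem_filter, Finset.mem_univ, true_and, hU,
        LinearMap.BilinForm.mem_orthogonal_iff] at hx
      push Not at hx
      obtain ⟨w, hw, h⟩ := hx
      exact ⟨w, hw, by simpa [QuadraticMap.polar_comm] using h⟩
    rw [← card_mul_card_fiber_functional_submodule W (Q.polarBilin x) hx' (-Q x)]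
    congr 2
    ext w
    simp only [Finset.bipartiteAbove, Finset.mem_filter, Finset.mem_univ, true_and]
    refine and_congr_right fun hw => ?_
    rw [QuadraticMap.map_add Q, hW w hw, QuadraticMap.polarBilin_apply_apply, eq_neg_iff_add_eq_zero]
    constructor <;> intro h <;> linear_combination h
  have key2 : ∀ w ∈ Finset.univ.filter (· ∈ W),
      (Finset.bipartiteBelow (fun x w => Q (x + w) = 0)
        (Finset.univ.filter (fun x => x ∉ U)) w).card =
      (Finset.univ.filter (fun x => Q x = 0 ∧ x ∉ U)).card := by
    intro w hw
    replace hw : w ∈ W := by simpa using hw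
    refine Finset.card_bij (fun x _ => x + w) ?_ ?_ ?_
    · intro x hx
      simp only [Finset.bipartiteBelow, Finset.mem_filter, Finset.mem_univ, true_and] at hx ⊢
      exact ⟨hx.2, by rw [Submodule.add_mem_iff_left _ (hWU hw)]; exact hx.1⟩
    · intro a _ b _ hab; exact add_right_cancel hab
    · intro b hb
      simp only [Finset.bipartiteBelow, Finset.mem_filter, Finset.mem_univ, true_and] at hb ⊢
      exact ⟨b - w, ⟨by rw [Submodule.sub_mem_iff_left _ (hWU hw)]; exact hb.2,
        by simpa using hb.1⟩, by simp⟩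
  have h := Finset.sum_card_bipartiteAbove_eq_sum_card_bipartiteBelow
    (s := Finset.univ.filter (fun x => x ∉ U)) (t := Finset.univ.filter (· ∈ W))
    (fun x w => Q (x + w) = 0)
  rw [Finset.sum_congr rfl key2, Finset.sum_const, smul_eq_mul, card_filter_mem_submodule] at h
  have h2 := congrArg (Fintype.card K * ·) h
  simp only [Finset.mul_sum] at h2
  rw [Finset.sum_congr rfl key, Finset.sum_const, smul_eq_mul] at h2
  have hpos : 0 < Fintype.card K ^ Module.finrank K W := pow_pos Fintype.card_pos _
  apply Nat.eq_of_mul_eq_mul_right hpos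
  rw [h2]; ring

/-- A nondegenerate quadratic form in six variables with the number of singular vectors of an
elliptic quadric. -/
structure IsElliptic (Q : QuadraticForm K V) : Prop where
  nondegenerate : LinearMap.BilinForm.Nondegenerate Q.polarBilin
  finrank_eq : Module.finrank K V = 6
  card_singular : (Finset.univ.filter (fun x => Q x = 0)).card + Fintype.card K ^ 3 =
    Fintype.card K ^ 5 + Fintype.card K ^ 2

namespace IsElliptic

variable {Q : QuadraticForm K V} (hQ : IsElliptic Q)
include hQ

lemma card_singular_orthogonal (W : Submodule K V) (hW : ∀ w ∈ W, Q w = 0) {k : ℕ}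
    (hk : k + Module.finrank K W = 6) :
    Fintype.card K * (Finset.univ.filter
        (fun x => Q x = 0 ∧ x ∈ LinearMap.BilinForm.orthogonal Q.polarBilin W)).card +
      Fintype.card K ^ 4 = Fintype.card K ^ 3 + Fintype.card K ^ k := by
  have h1 := card_singular_not_mem_orthogonal Q W hW
  have h2 := hQ.card_singular
  have h3 := card_filter_mem_submodule (LinearMap.BilinForm.orthogonal Q.polarBilin W)
  rw [LinearMap.BilinForm.finrank_orthogonal hQ.nondegenerate, hQ.finrank_eq,
    show 6 - Module.finrank K W = k by omega] at h3
  have h4 := Finset.card_filter_add_card_filter_not (s := (Finset.univ : Finset V))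
    (fun x => x ∈ LinearMap.BilinForm.orthogonal Q.polarBilin W)
  rw [Finset.card_univ, Module.card_eq_pow_finrank (K := K) (V := V), hQ.finrank_eq] at h4
  have h5 := Finset.card_filter_add_card_filter_not
    (s := Finset.univ.filter (fun x => Q x = 0))
    (fun x => x ∈ LinearMap.BilinForm.orthogonal Q.polarBilin W)
  rw [Finset.filter_filter, Finset.filter_filter] at h5
  zify at *
  linear_combination h3 - h4 - h1 + (Fintype.card K : ℤ) * h2 + (Fintype.card K : ℤ) * h5

lemma mem_of_mem_orthogonal (W : Submodule K V) (hW : ∀ w ∈ W, Q w = 0)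
    (hk : Module.finrank K W = 2) {x : V} (hx : Q x = 0)
    (hxW : x ∈ LinearMap.BilinForm.orthogonal Q.polarBilin W) : x ∈ W := by
  have h := hQ.card_singular_orthogonal W hW (k := 4) (by omega)
  have hsub : Finset.univ.filter (· ∈ W) ⊆ Finset.univ.filter
      (fun x => Q x = 0 ∧ x ∈ LinearMap.BilinForm.orthogonal Q.polarBilin W) := by
    intro y hy
    simp only [Finset.mem_filter, Finset.mem_univ, true_and] at hy ⊢
    refine ⟨hW y hy, fun w hw => ?_⟩
    simp [QuadraticMap.polar, hW w hw, hW y hy, hW _ (W.add_mem hw hy)]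
  have heq := Finset.eq_of_subset_of_card_le hsub (by
    rw [card_filter_mem_submodule, hk]
    apply le_of_mul_le_mul_left _ (Fintype.card_pos (α := K))
    linarith [h, pow_succ' (Fintype.card K) 2])
  have : x ∈ Finset.univ.filter (· ∈ W) := by
    rw [heq]; exact Finset.mem_filter.2 ⟨Finset.mem_univ _, hx, hxW⟩
  simpa using this

lemma card_singular_polar_eq_zero {b : V} (hb : b ≠ 0) (hQb : Q b = 0) :
    (Finset.univ.filter (fun x => Q x = 0 ∧ Q.polarBilin x b = 0)).card + Fintype.card K ^ 3 =
      Fintype.card K ^ 4 + Fintype.card K ^ 2 := by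
  have h := hQ.card_singular_orthogonal (K ∙ b) (k := 5) (by
    intro w hw
    obtain ⟨c, rfl⟩ := Submodule.mem_span_singleton.1 hw
    rw [QuadraticMap.map_smul, hQb, smul_zero]) (by rw [finrank_span_singleton hb])
  have hset : (Finset.univ.filter (fun x => Q x = 0 ∧
      x ∈ LinearMap.BilinForm.orthogonal Q.polarBilin (K ∙ b))) =
      Finset.univ.filter (fun x => Q x = 0 ∧ Q.polarBilin x b = 0) := by
    ext x
    simp only [Finset.mem_filter, Finset.mem_univ, true_and]
    refine and_congr_right fun _ => ⟨fun hx => ?_, fun hx w hw => ?_⟩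
    · simpa [QuadraticMap.polar_comm] using hx b (Submodule.mem_span_singleton_self b)
    · obtain ⟨c, rfl⟩ := Submodule.mem_span_singleton.1 hw
      have : QuadraticMap.polar Q b x = 0 := by simpa [QuadraticMap.polar_comm] using hx
      simp [this]
  rw [hset] at h
  apply Nat.eq_of_mul_eq_mul_left (Fintype.card_pos (α := K))
  linarith [h]


omit hQ [Fintype K] [Fintype V] in
lemma singular_of_mem_span_pair {b y : V} (hb : Q b = 0) (hy : Q y = 0)
    (hby : Q.polarBilin y b = 0) {w : V} (hw : w ∈ Submodule.span K {b, y}) : Q w = 0 := by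
  obtain ⟨s, t, rfl⟩ := Submodule.mem_span_pair.1 hw
  have : QuadraticMap.polar Q b y = 0 := by simpa [QuadraticMap.polar_comm] using hby
  rw [QuadraticMap.map_add Q, QuadraticMap.map_smul, QuadraticMap.map_smul,
    QuadraticMap.polar_smul_left, QuadraticMap.polar_smul_right, hb, hy, this]
  simp

omit hQ [Fintype K] [Fintype V] in
lemma finrank_span_pair {b y : V} (hb : b ≠ 0) (hy : y ∉ Submodule.span K {b}) :
    Module.finrank K (Submodule.span K {b, y}) = 2 := by
  have hli : LinearIndependent K ![b, y] := by
    rw [LinearIndependent.pair_iff' hb]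
    intro a h
    exact hy (Submodule.mem_span_singleton.2 ⟨a, h⟩)
  rw [← Matrix.range_cons_cons_empty b y ![]]
  exact finrank_span_eq_card hli

omit hQ in
lemma card_filter_mem_line {D : Finset V} (hDsmul : ∀ (c : K) (x : V), c ≠ 0 → x ∈ D → c • x ∈ D)
    (hD0 : ∀ x ∈ D, x ≠ 0) {b : V} (hb : b ≠ 0) :
    ((D.filter (· ∈ Submodule.span K {b})).card : ℤ) =
      if b ∈ D then (Fintype.card K : ℤ) - 1 else 0 := by
  split_ifs with h
  · have : D.filter (· ∈ Submodule.span K {b}) =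
        (Finset.univ.filter (· ∈ Submodule.span K {b})).erase 0 := by
      ext x
      simp only [Finset.mem_filter, Finset.mem_erase, Finset.mem_univ, true_and]
      refine ⟨fun hx => ⟨hD0 x hx.1, hx.2⟩, fun hx => ⟨?_, hx.2⟩⟩
      obtain ⟨c, rfl⟩ := Submodule.mem_span_singleton.1 hx.2
      exact hDsmul c b (fun h0 => hx.1 (by simp [h0])) h
    rw [this, Finset.cast_card_erase_of_mem (by simp), card_filter_mem_submodule,
      finrank_span_singleton hb]
    simp
  · simp only [Nat.cast_eq_zero, Finset.card_eq_zero, Finset.filter_eq_empty_iff]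
    intro x hx hxb
    obtain ⟨c, rfl⟩ := Submodule.mem_span_singleton.1 hxb
    have hc : c ≠ 0 := fun h0 => hD0 _ hx (by simp [h0])
    exact h (by simpa [hc] using hDsmul c⁻¹ _ (inv_ne_zero hc) hx)

variable {D : Finset V} (hDsmul : ∀ (c : K) (x : V), c ≠ 0 → x ∈ D → c • x ∈ D)
  (hDQ : ∀ x ∈ D, x ≠ 0 ∧ Q x = 0) {c : ℕ}
include hDsmul hDQ

/-- If every totally singular line carries `c` vectors of `D`, then the number of vectors of `D`
orthogonal to a singular vector is determined. -/
lemma card_polar_eq_zero_of_forall_line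
    (hline : ∀ W : Submodule K V, Module.finrank K W = 2 → (∀ w ∈ W, Q w = 0) →
      (D.filter (· ∈ W)).card = c) {b : V} (hb : b ≠ 0) (hQb : Q b = 0) :
    ((D.filter (fun x => Q.polarBilin x b = 0)).card : ℤ) +
      (Fintype.card K : ℤ) ^ 2 * (if b ∈ D then (Fintype.card K : ℤ) - 1 else 0) =
      c * ((Fintype.card K : ℤ) ^ 2 + 1) := by
  rw [← card_filter_mem_line hDsmul (fun x hx => (hDQ x hx).1) hb]
  set L := Submodule.span K {b} with hL
  have hbL : b ∈ L := Submodule.mem_span_singleton_self b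
  have hpolL : ∀ x ∈ L, Q.polarBilin x b = 0 := by
    intro x hx
    obtain ⟨s, rfl⟩ := Submodule.mem_span_singleton.1 hx
    simp [QuadraticMap.polar_self, hQb]
  have hQL : ∀ x ∈ L, Q x = 0 := by
    intro x hx
    obtain ⟨s, rfl⟩ := Submodule.mem_span_singleton.1 hx
    rw [QuadraticMap.map_smul, hQb, smul_zero]
  set T := Finset.univ.filter (fun y => (Q y = 0 ∧ Q.polarBilin y b = 0) ∧ y ∉ L) with hT
  have hTcard : (T.card : ℤ) = (Fintype.card K : ℤ) ^ 4 - (Fintype.card K : ℤ) ^ 3 +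
      (Fintype.card K : ℤ) ^ 2 - Fintype.card K := by
    have h1 := hQ.card_singular_polar_eq_zero hb hQb
    have h2 := Finset.card_filter_add_card_filter_not
      (s := Finset.univ.filter (fun x => Q x = 0 ∧ Q.polarBilin x b = 0)) (fun x => x ∈ L)
    rw [Finset.filter_filter, Finset.filter_filter] at h2
    have h3 := card_filter_mem_submodule L
    rw [finrank_span_singleton hb, pow_one] at h3
    have h4 : Finset.univ.filter (fun x => (Q x = 0 ∧ Q.polarBilin x b = 0) ∧ x ∈ L) =
        Finset.univ.filter (· ∈ L) := by
      ext x
      simp only [Finset.mem_filter, Finset.mem_univ, true_and, and_iff_right_iff_imp]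
      exact fun hx => ⟨hQL x hx, hpolL x hx⟩
    rw [h4, h3] at h2
    zify at h1 h2
    linear_combination h2 + h1
  have habove : ∀ y ∈ T, (Finset.bipartiteAbove (fun y x => x ∈ Submodule.span K {b, y}) D y).card
      = c := by
    intro y hy
    simp only [hT, Finset.mem_filter, Finset.mem_univ, true_and] at hy
    exact hline _ (finrank_span_pair hb hy.2)
      (fun w hw => singular_of_mem_span_pair hQb hy.1.1 hy.1.2 hw)
  have hbelow : ∀ x ∈ D,
      ((Finset.bipartiteBelow (fun y x => x ∈ Submodule.span K {b, y}) T x).card : ℤ) =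
      (if x ∈ L then (T.card : ℤ) - ((Fintype.card K : ℤ) ^ 2 - Fintype.card K) else 0) +
      (if Q.polarBilin x b = 0 then (Fintype.card K : ℤ) ^ 2 - Fintype.card K else 0) := by
    intro x hx
    by_cases hxL : x ∈ L
    · rw [if_pos hxL, if_pos (hpolL x hxL), sub_add_cancel]
      congr 2
      rw [Finset.bipartiteBelow, Finset.filter_eq_self]
      intro y _
      exact Submodule.span_mono (by simp) hxL
    rw [if_neg hxL, zero_add]
    have hexch : ∀ y, x ∈ Submodule.span K {b, y} → y ∈ Submodule.span K {b, x} := by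
      intro y hy
      rw [Set.pair_comm] at hy ⊢
      exact mem_span_insert_exchange hy hxL
    split_ifs with hp
    · have hset : Finset.bipartiteBelow (fun y x => x ∈ Submodule.span K {b, y}) T x =
          Finset.univ.filter (· ∈ Submodule.span K {b, x}) \ Finset.univ.filter (· ∈ L) := by
        ext y
        simp only [hT, Finset.bipartiteBelow, Finset.mem_filter, Finset.mem_univ, true_and,
          Finset.mem_sdiff]
        refine ⟨fun hy => ⟨hexch y hy.2, hy.1.2⟩, fun hy => ⟨⟨⟨?_, ?_⟩, hy.2⟩, ?_⟩⟩
        · exact singular_of_mem_span_pair hQb (hDQ x hx).2 hp hy.1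
        · obtain ⟨s, t, rfl⟩ := Submodule.mem_span_pair.1 hy.1
          rw [map_add, LinearMap.add_apply, hpolL _ (L.smul_mem s hbL), map_smul,
            LinearMap.smul_apply, hp]
          simp
        · have h := hy.1
          rw [Set.pair_comm] at h ⊢
          exact mem_span_insert_exchange h hy.2
      have hsub : Finset.univ.filter (· ∈ L) ⊆
          Finset.univ.filter (· ∈ Submodule.span K {b, x}) := by
        intro y hy
        simp only [Finset.mem_filter, Finset.mem_univ, true_and] at hy ⊢
        exact Submodule.span_mono (by simp) hy
      rw [hset, Finset.cast_card_sdiff hsub, card_filter_mem_submodule, card_filter_mem_submodule,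
        finrank_span_pair hb hxL, finrank_span_singleton hb]
      simp
    · simp only [Nat.cast_eq_zero, Finset.card_eq_zero, Finset.bipartiteBelow,
        Finset.filter_eq_empty_iff]
      intro y hy hxy
      simp only [hT, Finset.mem_filter, Finset.mem_univ, true_and] at hy
      obtain ⟨s, t, rfl⟩ := Submodule.mem_span_pair.1 hxy
      apply hp
      rw [map_add, LinearMap.add_apply, hpolL _ (L.smul_mem s hbL), map_smul,
        LinearMap.smul_apply, hy.1.2]
      simp
  have h := Finset.sum_card_bipartiteAbove_eq_sum_card_bipartiteBelow
    (s := T) (t := D) (fun y x => x ∈ Submodule.span K {b, y})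
  rw [Finset.sum_congr rfl habove, Finset.sum_const, smul_eq_mul] at h
  zify at h
  rw [Finset.sum_congr rfl hbelow, Finset.sum_add_distrib, ← Finset.sum_filter,
    ← Finset.sum_filter, Finset.sum_const, Finset.sum_const, nsmul_eq_mul, nsmul_eq_mul,
    hTcard] at h
  have hq : (1 : ℤ) < Fintype.card K := by exact_mod_cast Fintype.one_lt_card
  have hne : ((Fintype.card K : ℤ) ^ 2 - Fintype.card K) ≠ 0 := by nlinarith
  apply mul_left_cancel₀ hne
  linear_combination -h

omit hDsmul in
/-- If `D` meets the perps of singular vectors in the right numbers, then every totally singular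
line carries `c` vectors of `D`. -/
lemma card_line_of_forall_polar_eq_zero (hDcard : D.card = c * (Fintype.card K ^ 3 + 1))
    (hperp : ∀ b : V, b ≠ 0 → Q b = 0 →
      ((D.filter (fun x => Q.polarBilin x b = 0)).card : ℤ) +
      (Fintype.card K : ℤ) ^ 2 * (if b ∈ D then (Fintype.card K : ℤ) - 1 else 0) =
      c * ((Fintype.card K : ℤ) ^ 2 + 1))
    (W : Submodule K V) (hW2 : Module.finrank K W = 2) (hW : ∀ w ∈ W, Q w = 0) :
    (D.filter (· ∈ W)).card = c := by
  set W' := (Finset.univ.filter (· ∈ W)).erase 0 with hW'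
  have hcard : (W'.card : ℤ) = (Fintype.card K : ℤ) ^ 2 - 1 := by
    rw [hW', Finset.cast_card_erase_of_mem (by simp), card_filter_mem_submodule, hW2]
    simp
  have hpolW : ∀ x ∈ W, ∀ b ∈ W, Q.polarBilin x b = 0 := by
    intro x hx b hb
    simp [QuadraticMap.polar, hW x hx, hW b hb, hW _ (W.add_mem hx hb)]
  have hbelow : ∀ x ∈ D,
      ((Finset.bipartiteBelow (fun b x => Q.polarBilin x b = 0) W' x).card : ℤ) =
      (if x ∈ W then (Fintype.card K : ℤ) ^ 2 - Fintype.card K else 0) +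
        ((Fintype.card K : ℤ) - 1) := by
    intro x hx
    split_ifs with hxW
    · rw [Finset.bipartiteBelow, Finset.filter_true_of_mem, hcard]
      · ring
      · intro b hb
        simp only [hW', Finset.mem_erase, Finset.mem_filter, Finset.mem_univ, true_and] at hb
        exact hpolW x hxW b hb.2
    · have hne : ∃ w ∈ W, Q.polarBilin x w ≠ 0 := by
        by_contra! h0
        refine hxW (hQ.mem_of_mem_orthogonal W hW hW2 (hDQ x hx).2 fun w hw => ?_)
        simpa [QuadraticMap.polar_comm] using h0 w hw
      have h := card_mul_card_fiber_functional_submodule W (Q.polarBilin x) hne 0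
      rw [hW2, pow_two] at h
      have h' := Nat.eq_of_mul_eq_mul_left Fintype.card_pos h
      have hset : Finset.bipartiteBelow (fun b x => Q.polarBilin x b = 0) W' x =
          (Finset.univ.filter (fun v => v ∈ W ∧ Q.polarBilin x v = 0)).erase 0 := by
        ext y
        simp [hW', Finset.bipartiteBelow, and_assoc]
      rw [hset, Finset.cast_card_erase_of_mem (by simp), h']
      simp
  have habove : ∀ b ∈ W',
      ((Finset.bipartiteAbove (fun b x => Q.polarBilin x b = 0) D b).card : ℤ) =
      c * ((Fintype.card K : ℤ) ^ 2 + 1) -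
      (Fintype.card K : ℤ) ^ 2 * (if b ∈ D then (Fintype.card K : ℤ) - 1 else 0) := by
    intro b hb
    simp only [hW', Finset.mem_erase, Finset.mem_filter, Finset.mem_univ, true_and] at hb
    exact eq_sub_of_add_eq (hperp b hb.1 (hW b hb.2))
  have hWD : W'.filter (· ∈ D) = D.filter (· ∈ W) := by
    ext y
    simp only [hW', Finset.mem_erase, Finset.mem_filter, Finset.mem_univ, true_and]
    exact ⟨fun h => ⟨h.2, h.1.2⟩, fun h => ⟨⟨(hDQ y h.1).1, h.2⟩, h.1⟩⟩
  have h := Finset.sum_card_bipartiteAbove_eq_sum_card_bipartiteBelow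
    (s := W') (t := D) (fun b x => Q.polarBilin x b = 0)
  zify at h
  rw [Finset.sum_congr rfl habove, Finset.sum_congr rfl hbelow, Finset.sum_add_distrib,
    Finset.sum_sub_distrib, ← Finset.sum_filter] at h
  simp only [mul_ite, mul_zero, ← Finset.sum_filter, hWD] at h
  simp only [Finset.sum_const, nsmul_eq_mul, hcard, hDcard] at h
  push_cast at h
  have hq : (1 : ℤ) < Fintype.card K := by exact_mod_cast Fintype.one_lt_card
  have hne : ((Fintype.card K : ℤ) ^ 3 - Fintype.card K) ≠ 0 := by nlinarith
  zify
  apply mul_left_cancel₀ hne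
  linear_combination -h

end IsElliptic
end QuadraticSpace

section FiniteFieldModel

open Polynomial in
lemma card_filter_pow_add_eval_le {F : Type*} [Field F] [Fintype F] {n : ℕ} {g : F[X]}
    (hg : g.degree < n) :
    (Finset.univ.filter (fun x : F => x ^ n + g.eval x = 0)).card ≤ n := by
  have hm : (X ^ n + g).Monic := monic_X_pow_add hg
  have hdeg : (X ^ n + g).natDegree = n := by
    rw [add_comm]
    exact natDegree_eq_of_degree_eq_some (by rw [degree_add_eq_right_of_degree_lt] <;> simp [hg])
  have hsub : Finset.univ.filter (fun x : F => x ^ n + g.eval x = 0) ⊆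
      (X ^ n + g).roots.toFinset := by
    intro x hx
    rw [Multiset.mem_toFinset, mem_roots hm.ne_zero]
    simpa using hx
  calc _ ≤ (X ^ n + g).roots.toFinset.card := Finset.card_le_card hsub
    _ ≤ Multiset.card (X ^ n + g).roots := Multiset.toFinset_card_le _
    _ ≤ n := (card_roots' _).trans hdeg.le

variable {K L : Type*} [Field K] [Fintype K] [Field L] [Fintype L] [Algebra K L]

open Polynomial in
lemma exists_algebraMap_eq_of_pow_card_eq {x : L} (hx : x ^ Fintype.card K = x) :
    ∃ k : K, algebraMap K L k = x := by
  have hle := card_filter_pow_add_eval_le (F := L) (n := Fintype.card K) (g := -X)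
    (by rw [degree_neg, degree_X]; exact_mod_cast Fintype.one_lt_card)
  have hsub : Finset.univ.map ⟨algebraMap K L, (algebraMap K L).injective⟩ ⊆
      Finset.univ.filter (fun x : L => x ^ Fintype.card K + (-X : L[X]).eval x = 0) := by
    intro y hy
    obtain ⟨k, -, rfl⟩ := Finset.mem_map.1 hy
    simp [← map_pow, FiniteField.pow_card]
  have heq := Finset.eq_of_subset_of_card_le hsub (by simpa using hle)
  have : x ∈ Finset.univ.filter (fun x : L => x ^ Fintype.card K + (-X : L[X]).eval x = 0) := by
    simp [hx]
  rw [← heq] at this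
  obtain ⟨k, -, h⟩ := Finset.mem_map.1 this
  exact ⟨k, h⟩

variable (K) in
omit [Fintype L] in
lemma add_pow_card_pow (i : ℕ) (x y : L) :
    (x + y) ^ Fintype.card K ^ i = x ^ Fintype.card K ^ i + y ^ Fintype.card K ^ i := by
  induction i with
  | zero => simp
  | succ i ih =>
    rw [pow_succ, pow_mul, ih, pow_mul, pow_mul]
    exact map_add (FiniteField.frobeniusAlgHom K L) _ _

/-- The expression `Tr_{q^3/q}(x^{q^3+1})`. -/
def ellipticExpr (q : ℕ) (x : L) : L :=
  x ^ (q ^ 3 + 1) + x ^ ((q ^ 3 + 1) * q) + x ^ ((q ^ 3 + 1) * q ^ 2)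

omit [Fintype L] in
lemma ellipticExpr_eq (q : ℕ) (x : L) : ellipticExpr q x =
    x ^ q ^ 3 * x ^ q ^ 0 + x ^ q ^ 4 * x ^ q ^ 1 + x ^ q ^ 5 * x ^ q ^ 2 := by
  simp only [ellipticExpr, ← pow_add]
  ring_nf

omit [Field K] [Algebra K L] in
lemma pow_card_pow_add_six (hL : Fintype.card L = Fintype.card K ^ 6) (i : ℕ) (x : L) :
    x ^ Fintype.card K ^ (6 + i) = x ^ Fintype.card K ^ i := by
  rw [pow_add, ← hL, pow_mul, FiniteField.pow_card]

lemma finrank_eq_six (hL : Fintype.card L = Fintype.card K ^ 6) : Module.finrank K L = 6 := by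
  rw [Module.card_eq_pow_finrank (K := K) (V := L)] at hL
  exact Nat.pow_right_injective Fintype.one_lt_card hL

lemma ellipticExpr_pow (hL : Fintype.card L = Fintype.card K ^ 6) (x : L) :
    ellipticExpr (Fintype.card K) x ^ Fintype.card K = ellipticExpr (Fintype.card K) x := by
  have h := fun a b : L => add_pow_card_pow K 1 a b
  simp only [pow_one] at h
  rw [ellipticExpr_eq, h, h, mul_pow, mul_pow, mul_pow]
  simp only [← pow_mul, ← pow_succ]
  rw [pow_card_pow_add_six hL 0]
  ring

lemma algebraMap_trace_mul_pow (hL : Fintype.card L = Fintype.card K ^ 6) (x y : L) :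
    ellipticExpr (Fintype.card K) (x + y) =
      ellipticExpr (Fintype.card K) x + ellipticExpr (Fintype.card K) y +
      algebraMap K L (Algebra.trace K L (x * y ^ Fintype.card K ^ 3)) := by
  rw [FiniteField.algebraMap_trace_eq_sum_pow, finrank_eq_six hL, Nat.card_eq_fintype_card]
  simp only [ellipticExpr_eq, add_pow_card_pow, Finset.sum_range_succ, Finset.sum_range_zero,
    mul_pow, ← pow_mul, ← pow_add]
  simp only [pow_card_pow_add_six hL 0, pow_card_pow_add_six hL 1, pow_card_pow_add_six hL 2,
    show 3 + 3 = 6 + 0 from rfl, show 3 + 4 = 6 + 1 from rfl, show 3 + 5 = 6 + 2 from rfl]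
  ring

lemma exists_ellipticForm (hL : Fintype.card L = Fintype.card K ^ 6) :
    ∃ Q : QuadraticForm K L,
      (∀ x, algebraMap K L (Q x) = ellipticExpr (Fintype.card K) x) ∧
      ∀ x y, Q.polarBilin x y = Algebra.trace K L (x * y ^ Fintype.card K ^ 3) := by
  choose f hf using fun x : L => exists_algebraMap_eq_of_pow_card_eq (ellipticExpr_pow hL x)
  have hinj := (algebraMap K L).injective
  have hadd : ∀ x y, f (x + y) = f x + f y + Algebra.trace K L (x * y ^ Fintype.card K ^ 3) := by
    intro x y
    apply hinj
    rw [map_add, map_add, hf, hf, hf, algebraMap_trace_mul_pow hL]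
  let φ := FiniteField.frobeniusAlgHom K L
  refine ⟨⟨f, fun a x => hinj ?_, (Algebra.traceForm K L).compl₂
    (φ.comp (φ.comp φ)).toLinearMap, fun x y => ?_⟩, hf, fun x y => ?_⟩
  · have ha : ∀ i, algebraMap K L a ^ Fintype.card K ^ i = algebraMap K L a := fun i => by
      rw [← map_pow, FiniteField.pow_card_pow]
    rw [hf, smul_eq_mul, map_mul, map_mul, hf, Algebra.smul_def]
    simp only [ellipticExpr_eq, mul_pow, ha]
    ring
  · rw [hadd]
    simp [φ, Algebra.traceForm_apply, ← pow_mul, pow_succ, mul_assoc]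
  · change f (x + y) - f x - f y = _
    rw [hadd]; ring

lemma nondegenerate_of_polarBilin_eq_trace {Q : QuadraticForm K L}
    (h : ∀ x y, Q.polarBilin x y = Algebra.trace K L (x * y ^ Fintype.card K ^ 3)) :
    LinearMap.BilinForm.Nondegenerate Q.polarBilin := by
  let φ := FiniteField.frobeniusAlgHom K L
  have hsurj : Function.Surjective (fun y : L => y ^ Fintype.card K ^ 3) := by
    have : Function.Injective (φ.comp (φ.comp φ)) := RingHom.injective (φ.comp (φ.comp φ)).toRingHom
    intro z
    obtain ⟨y, hy⟩ := (Finite.injective_iff_surjective.1 this) z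
    exact ⟨y, by rw [← hy]; simp [φ, ← pow_mul, pow_succ, mul_assoc]⟩
  have hleft : ∀ x, (∀ y, Q.polarBilin x y = 0) → x = 0 := by
    intro x hx
    apply (traceForm_nondegenerate K L).1 x
    intro z
    obtain ⟨y, rfl⟩ := hsurj z
    rw [Algebra.traceForm_apply, ← h, hx]
  refine ⟨hleft, fun x hx => hleft x fun y => ?_⟩
  rw [QuadraticMap.polarBilin_apply_apply, QuadraticMap.polar_comm]
  exact hx y

open Polynomial in
lemma isElliptic_ellipticForm (hL : Fintype.card L = Fintype.card K ^ 6) {Q : QuadraticForm K L}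
    (hQ : ∀ x, algebraMap K L (Q x) = ellipticExpr (Fintype.card K) x)
    (h : ∀ x y, Q.polarBilin x y = Algebra.trace K L (x * y ^ Fintype.card K ^ 3)) :
    IsElliptic Q := by
  refine ⟨nondegenerate_of_polarBilin_eq_trace h, finrank_eq_six hL, ?_⟩
  have hinj := (algebraMap K L).injective
  have hq : 1 < Fintype.card K := Fintype.one_lt_card
  set q := Fintype.card K with hqdef
  obtain ⟨r, hr⟩ : ∃ r, q = r + 2 := ⟨q - 2, by omega⟩
  have hne : ∀ c : K, (Finset.univ.filter (fun x => Q x = c)).card ≤ (q ^ 3 + 1) * q ^ 2 := by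
    intro c
    have hle := card_filter_pow_add_eval_le (F := L) (n := (q ^ 3 + 1) * q ^ 2)
      (g := X ^ (q ^ 3 + 1) + X ^ ((q ^ 3 + 1) * q) - C (algebraMap K L c)) (by
        have h1 : (q ^ 3 + 1) < (q ^ 3 + 1) * q ^ 2 := by
          rw [hr]; ring_nf; omega
        have h2 : (q ^ 3 + 1) * q < (q ^ 3 + 1) * q ^ 2 := by
          apply Nat.mul_lt_mul_of_pos_left _ (by positivity)
          nlinarith
        apply (degree_sub_le _ _).trans_lt
        refine max_lt ((degree_add_le _ _).trans_lt (max_lt ?_ ?_)) ?_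
        · rw [degree_X_pow]; exact_mod_cast h1
        · rw [degree_X_pow]; exact_mod_cast h2
        · refine degree_C_le.trans_lt ?_
          exact_mod_cast (by positivity : 0 < (q ^ 3 + 1) * q ^ 2))
    refine le_trans (Finset.card_le_card fun x hx => ?_) hle
    simp only [Finset.mem_filter, Finset.mem_univ, true_and] at hx ⊢
    have := hQ x
    rw [hx, ellipticExpr] at this
    simp only [eval_sub, eval_add, eval_pow, eval_X, eval_C, this]
    ring
  have hzero : (Finset.univ.filter (fun x => Q x = 0)).card ≤ (q ^ 3 + 1) * (q ^ 2 - 1) + 1 := by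
    have hle := card_filter_pow_add_eval_le (F := L) (n := (q ^ 3 + 1) * (q ^ 2 - 1))
      (g := X ^ ((q ^ 3 + 1) * (q - 1)) + 1) (by
        have h2 : (q ^ 3 + 1) * (q - 1) < (q ^ 3 + 1) * (q ^ 2 - 1) := by
          apply Nat.mul_lt_mul_of_pos_left _ (by positivity)
          have : q < q ^ 2 := by nlinarith
          omega
        refine (degree_add_le _ _).trans_lt (max_lt ?_ ?_)
        · rw [degree_X_pow]; exact_mod_cast h2
        · refine degree_one_le.trans_lt ?_
          exact_mod_cast (Nat.zero_le _).trans_lt h2)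
    refine le_trans (Finset.card_le_card (t := insert 0 _) fun x hx => ?_)
      ((Finset.card_insert_le _ _).trans (Nat.add_le_add_right hle 1))
    simp only [Finset.mem_filter, Finset.mem_univ, true_and, Finset.mem_insert] at hx ⊢
    refine or_iff_not_imp_left.2 fun hx0 => ?_
    have := hQ x
    rw [hx, ellipticExpr, map_zero] at this
    simp only [eval_add, eval_pow, eval_X, eval_one]
    apply mul_left_cancel₀ (pow_ne_zero (q ^ 3 + 1) hx0)
    have e1 : (q ^ 3 + 1) * q = (q ^ 3 + 1) + (q ^ 3 + 1) * (q - 1) := by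
      rw [hr, show r + 2 - 1 = r + 1 by omega]; ring
    have e2 : (q ^ 3 + 1) * q ^ 2 = (q ^ 3 + 1) + (q ^ 3 + 1) * (q ^ 2 - 1) := by
      conv_lhs => rw [show q ^ 2 = 1 + (q ^ 2 - 1) by have : 0 < q ^ 2 := by positivity
                                                      omega]
      ring
    rw [e1, e2, pow_add, pow_add] at this
    linear_combination -this
  have hsum := Finset.card_eq_sum_card_fiberwise (f := Q) (s := (Finset.univ : Finset L))
    (t := Finset.univ) (fun _ _ => Finset.mem_coe.2 (Finset.mem_univ _))
  rw [← Finset.add_sum_erase _ _ (Finset.mem_univ (0 : K)), Finset.card_univ, hL] at hsum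
  have hb := Finset.sum_le_card_nsmul (Finset.univ.erase (0 : K))
    (fun c => (Finset.univ.filter (fun x => Q x = c)).card) _ (fun c _ => hne c)
  rw [Finset.card_erase_of_mem (Finset.mem_univ _), Finset.card_univ, ← hqdef, smul_eq_mul] at hb
  have h1 : 1 ≤ q := by omega
  have h2 : 1 ≤ q ^ 2 := Nat.one_le_pow _ _ (by omega)
  zify [h1, h2] at *
  apply le_antisymm
  · linarith
  · linarith

end FiniteFieldModel

section CharacterSums

open Finset

lemma exists_canonicalAddChar {p : ℕ} (hp : p.Prime) {K L : Type*} [Field K] [Fintype K] [Field L]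
    [Fintype L] [Algebra K L] [Algebra (ZMod p) L] :
    ∃ ψ : AddChar L ℂ, ψ.IsPrimitive ∧
      (∀ x, ψ x = Complex.exp (2 * Real.pi * Complex.I *
        ((Algebra.trace (ZMod p) L x).val : ℂ) / p)) ∧
      ∀ z, ∑ k : K, ψ (k • z) = if Algebra.trace K L z = 0 then (Fintype.card K : ℂ) else 0 := by
  have : Fact p.Prime := ⟨hp⟩
  have : CharP L p := charP_of_injective_algebraMap (algebraMap (ZMod p) L).injective p
  have : CharP K p := (algebraMap K L).charP (algebraMap K L).injective p
  let _ : Algebra (ZMod p) K := ZMod.algebra K p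
  have : IsScalarTower (ZMod p) K L := IsScalarTower.of_algebraMap_eq' (Subsingleton.elim _ _)
  let ψ : AddChar L ℂ :=
    (ZMod.stdAddChar (N := p)).compAddMonoidHom (Algebra.trace (ZMod p) L).toAddMonoidHom
  have hψ : ∀ x, ψ x = ZMod.stdAddChar (Algebra.trace (ZMod p) L x) := fun _ => rfl
  have hψ1 : ∀ x, ψ x = 1 ↔ Algebra.trace (ZMod p) L x = 0 := fun x => by
    rw [hψ, ← (ZMod.stdAddChar (N := p)).map_zero_eq_one, ZMod.injective_stdAddChar.eq_iff]
  refine ⟨ψ, AddChar.IsPrimitive.of_ne_one fun h => ?_, fun x => ?_, fun z => ?_⟩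
  · obtain ⟨x, hx⟩ := Algebra.trace_surjective (ZMod p) L 1
    have := (hψ1 x).1 (by rw [h]; rfl)
    rw [hx] at this
    exact one_ne_zero this
  · rw [hψ, ZMod.stdAddChar_apply, ZMod.toCircle_apply]
  · have h := (ψ.compAddMonoidHom (LinearMap.toSpanSingleton K L z).toAddMonoidHom).sum_eq_ite
    have hiff : ψ.compAddMonoidHom (LinearMap.toSpanSingleton K L z).toAddMonoidHom = 0 ↔
        Algebra.trace K L z = 0 := by
      have htr : ∀ k : K, Algebra.trace (ZMod p) L (k • z) =
          Algebra.trace (ZMod p) K (Algebra.trace K L z * k) := fun k => by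
        rw [← Algebra.trace_trace (S := K), map_smul, smul_eq_mul, mul_comm]
      constructor
      · intro h0
        apply (traceForm_nondegenerate (ZMod p) K).1
        intro k
        rw [Algebra.traceForm_apply, ← htr, ← hψ1]
        exact DFunLike.congr_fun h0 k
      · intro h0
        ext k
        refine (hψ1 _).2 ?_
        exact (htr k).trans (by rw [h0, zero_mul, map_zero])
    rw [if_congr hiff rfl rfl] at h
    exact h

lemma sum_charSum_sub_sq {L : Type*} [Field L] [Fintype L] {ψ : AddChar L ℂ} (hψ : ψ.IsPrimitive)
    {D : Finset L} (h0 : (0 : L) ∉ D) (hneg : ∀ x ∈ D, -x ∈ D) (c : ℂ) :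
    ∑ a : L, (∑ x ∈ D, ψ (a * x) - c) ^ 2 = Fintype.card L * (D.card + c ^ 2) := by
  have h1 : ∑ a : L, ∑ x ∈ D, ψ (a * x) = 0 := by
    rw [sum_comm]
    refine sum_eq_zero fun x hx => ?_
    rw [AddChar.sum_mulShift x hψ, if_neg (ne_of_mem_of_not_mem hx h0)]
    simp
  have h2 : ∑ a : L, (∑ x ∈ D, ψ (a * x)) ^ 2 = Fintype.card L * D.card := by
    simp_rw [pow_two, sum_mul_sum, ← AddChar.map_add_eq_mul, ← mul_add]
    rw [sum_comm]
    have : ∀ x ∈ D, ∑ a : L, ∑ y ∈ D, ψ (a * (x + y)) = (Fintype.card L : ℂ) := by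
      intro x hx
      rw [sum_comm]
      simp_rw [AddChar.sum_mulShift _ hψ]
      rw [sum_eq_single (-x)]
      · simp
      · intro y _ hy
        rw [if_neg]
        · simp
        · intro h; exact hy (eq_neg_of_add_eq_zero_right h)
      · intro h; exact absurd (hneg x hx) h
    rw [sum_congr rfl this, sum_const, nsmul_eq_mul, mul_comm]
  simp_rw [sub_sq, sum_add_distrib, sum_sub_distrib, mul_assoc, ← mul_sum, ← sum_mul]
  rw [h1, h2]
  simp
  ring

variable {K L : Type*} [Field K] [Fintype K] [Field L] [Fintype L] [Algebra K L]

omit [Fintype L] in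
lemma charSum_eq_card_trace_eq_zero {ψ : AddChar L ℂ}
    (hsum : ∀ z, ∑ k : K, ψ (k • z) =
      if Algebra.trace K L z = 0 then (Fintype.card K : ℂ) else 0)
    {D : Finset L} (hDsmul : ∀ (c : K) (x : L), c ≠ 0 → x ∈ D → c • x ∈ D) (a : L) :
    ((Fintype.card K : ℂ) - 1) * ∑ x ∈ D, ψ (a * x) =
      Fintype.card K * (D.filter (fun x => Algebra.trace K L (x * a) = 0)).card - D.card := by
  have h1 : ∑ k : K, ∑ x ∈ D, ψ (k • (x * a)) =
      Fintype.card K * (D.filter (fun x => Algebra.trace K L (x * a) = 0)).card := by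
    rw [sum_comm, sum_congr rfl fun x _ => hsum (x * a), ← sum_filter, sum_const, nsmul_eq_mul,
      mul_comm]
  rw [← h1, ← add_sum_erase _ _ (mem_univ (0 : K))]
  have h2 : ∀ k ∈ univ.erase (0 : K), ∑ x ∈ D, ψ (k • (x * a)) = ∑ x ∈ D, ψ (a * x) := by
    intro k hk
    have hk0 : k ≠ 0 := ne_of_mem_erase hk
    refine sum_bij' (fun x _ => k • x) (fun x _ => k⁻¹ • x) (fun x hx => hDsmul k x hk0 hx)
      (fun x hx => hDsmul _ x (inv_ne_zero hk0) hx) ?_ ?_ ?_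
    · intro x _; exact inv_smul_smul₀ hk0 x
    · intro x _; exact smul_inv_smul₀ hk0 x
    · intro x _; rw [mul_smul_comm, mul_comm a]
  rw [sum_congr rfl h2]
  simp only [zero_smul, AddChar.map_zero_eq_one, sum_const, nsmul_eq_mul, mul_one,
    card_erase_of_mem (mem_univ _), card_univ]
  rw [Nat.cast_sub Fintype.card_pos]
  push_cast
  ring

/-- The vector version of the main theorem, for a set `D` of singular vectors closed under
multiplication by nonzero scalars. -/
lemma forall_line_iff_charSum (hL : Fintype.card L = Fintype.card K ^ 6) {Q : QuadraticForm K L}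
    (hQ : IsElliptic Q)
    (hpol : ∀ x y, Q.polarBilin x y = Algebra.trace K L (x * y ^ Fintype.card K ^ 3))
    {ψ : AddChar L ℂ} (hψ : ψ.IsPrimitive)
    (hsum : ∀ z, ∑ k : K, ψ (k • z) =
      if Algebra.trace K L z = 0 then (Fintype.card K : ℂ) else 0)
    {D : Finset L} (hDsmul : ∀ (c : K) (x : L), c ≠ 0 → x ∈ D → c • x ∈ D)
    (hDQ : ∀ x ∈ D, x ≠ 0 ∧ Q x = 0) {c : ℕ} (hDcard : D.card = c * (Fintype.card K ^ 3 + 1)) :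
    (∀ W : Submodule K L, Module.finrank K W = 2 → (∀ w ∈ W, Q w = 0) →
      (D.filter (· ∈ W)).card = c) ↔
    ∀ a : L, a ≠ 0 → ∑ x ∈ D, ψ (a * x) =
      if a ^ Fintype.card K ^ 3 ∈ D then -(Fintype.card K : ℂ) ^ 3 + c else (c : ℂ) := by
  set q := Fintype.card K with hq
  have hq1 : (q : ℂ) - 1 ≠ 0 := by
    rw [sub_ne_zero]
    exact_mod_cast Fintype.one_lt_card.ne'
  have hinv : ∀ a : L, (a ^ q ^ 3) ^ q ^ 3 = a := fun a => by
    rw [← pow_mul, ← pow_add, ← hL, FiniteField.pow_card]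
  have hsingular : ∀ a : L,
      (((D.filter (fun x => Q.polarBilin x (a ^ q ^ 3) = 0)).card : ℤ) +
        (q : ℤ) ^ 2 * (if a ^ q ^ 3 ∈ D then (q : ℤ) - 1 else 0) = c * ((q : ℤ) ^ 2 + 1)) ↔
      ∑ x ∈ D, ψ (a * x) = if a ^ q ^ 3 ∈ D then -(q : ℂ) ^ 3 + c else (c : ℂ) := by
    intro a
    have h := charSum_eq_card_trace_eq_zero hsum hDsmul a
    rw [hDcard, ← hq] at h
    simp only [hpol, hinv]
    have hq0 : (q : ℂ) ≠ 0 := by exact_mod_cast Fintype.card_ne_zero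
    rw [← (Int.cast_injective (α := ℂ)).eq_iff, ← mul_right_inj' hq0,
      ← mul_right_inj' (b := ∑ x ∈ D, ψ (a * x)) hq1, h]
    push_cast
    split_ifs <;> constructor <;> intro h' <;> linear_combination h'
  constructor
  · intro hline
    have hS : ∀ a : L, a ≠ 0 → Q (a ^ q ^ 3) = 0 → ∑ x ∈ D, ψ (a * x) =
        if a ^ q ^ 3 ∈ D then -(q : ℂ) ^ 3 + c else (c : ℂ) := fun a ha hQa =>
      (hsingular a).1 (hQ.card_polar_eq_zero_of_forall_line hDsmul hDQ hline
        (pow_ne_zero _ ha) hQa)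
    let r : L → ℝ := fun a =>
      ((q : ℝ) * (D.filter (fun x => Algebra.trace K L (x * a) = 0)).card - D.card) / (q - 1) - c
    have hr : ∀ a, ∑ x ∈ D, ψ (a * x) - c = (r a : ℂ) := fun a => by
      have h := charSum_eq_card_trace_eq_zero hsum hDsmul a
      simp only [r]
      push_cast
      rw [← h, mul_div_cancel_left₀ _ hq1]
    let h : L → ℝ := fun a =>
      (if a = 0 then (q : ℝ) ^ 6 * c ^ 2 else 0) + if a ^ q ^ 3 ∈ D then (q : ℝ) ^ 6 else 0
    have h0D : (0 : L) ∉ D := fun h0 => (hDQ 0 h0).1 rfl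
    have hq3 : q ^ 3 ≠ 0 := pow_ne_zero _ Fintype.card_ne_zero
    have hle : ∀ a ∈ (univ : Finset L), h a ≤ r a ^ 2 := by
      intro a _
      by_cases ha : a = 0
      · have hra : r a = c * q ^ 3 := by
          have := hr a
          simp only [ha, zero_mul, AddChar.map_zero_eq_one, sum_const, nsmul_eq_mul, mul_one,
            hDcard] at this
          rw [ha]
          apply Complex.ofReal_injective
          rw [← this]
          push_cast
          ring
        simp only [h, ha, if_true, zero_pow hq3, h0D, if_false]
        rw [← ha, hra]
        exact le_of_eq (by ring)
      · simp only [h, ha, if_false, zero_add]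
        split_ifs with haD
        · have hra : r a = -q ^ 3 := by
            have := hr a
            rw [hS a ha (hDQ _ haD).2, if_pos haD] at this
            apply Complex.ofReal_injective
            rw [← this]
            push_cast
            ring
          rw [hra]
          exact le_of_eq (by ring)
        · positivity
    have hcardD : (univ.filter (fun a : L => a ^ q ^ 3 ∈ D)).card = D.card := by
      refine card_bij' (fun a _ => a ^ q ^ 3) (fun a _ => a ^ q ^ 3) ?_ ?_ ?_ ?_
      · intro a ha; simpa using ha
      · intro a ha; simpa [hinv] using ha
      · intro a _; exact hinv a
      · intro a _; exact hinv a
    have hsumeq : ∑ a, h a = ∑ a, r a ^ 2 := by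
      have hneg : ∀ x ∈ D, -x ∈ D := fun x hx => by
        simpa using hDsmul (-1) x (by simp) hx
      have h2 := sum_charSum_sub_sq hψ h0D hneg c
      simp_rw [hr] at h2
      have h3 : ∑ a, h a = (q : ℝ) ^ 6 * c ^ 2 + D.card * q ^ 6 := by
        simp only [h, sum_add_distrib]
        rw [← sum_filter _ (fun _ => (q : ℝ) ^ 6), sum_const, hcardD]
        simp
      rw [h3]
      apply Complex.ofReal_injective
      push_cast
      rw [h2, hL]
      push_cast
      ring
    have heq := (sum_eq_sum_iff_of_le hle).1 hsumeq
    intro a ha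
    by_cases hQa : Q (a ^ q ^ 3) = 0
    · exact hS a ha hQa
    · have haD : a ^ q ^ 3 ∉ D := fun hD => hQa (hDQ _ hD).2
      have := heq a (mem_univ a)
      simp only [h, ha, haD, if_false, add_zero] at this
      have hra : r a = 0 := pow_eq_zero_iff two_ne_zero |>.1 this.symm
      rw [if_neg haD, ← sub_eq_zero, hr, hra, Complex.ofReal_zero]
  · intro hchar
    refine hQ.card_line_of_forall_polar_eq_zero hDQ hDcard fun b hb _ => ?_
    have := (hsingular (b ^ q ^ 3)).2 (hchar _ (pow_ne_zero _ hb))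
    rwa [hinv] at this

lemma card_filter_mem_eq_mul_ncard {M : Set (Submodule K L)} {D : Finset L}
    (hM : ∀ P ∈ M, Module.finrank K P = 1)
    (hD : ∀ y, y ∈ D ↔ y ≠ 0 ∧ Submodule.span K {y} ∈ M) (W : Submodule K L) :
    (D.filter (· ∈ W)).card = {P ∈ M | P ≤ W}.ncard * (Fintype.card K - 1) := by
  have hfin : {P ∈ M | P ≤ W}.Finite := Set.toFinite _
  rw [Set.ncard_eq_toFinset_card _ hfin, card_eq_sum_card_fiberwise
    (f := fun y => Submodule.span K {y}) (t := hfin.toFinset)]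
  · rw [← smul_eq_mul, ← sum_const]
    refine sum_congr rfl fun P hP => ?_
    obtain ⟨hPM, hPW⟩ := hfin.mem_toFinset.1 hP
    have hset : (D.filter (· ∈ W)).filter (fun y => Submodule.span K {y} = P) =
        (univ.filter (· ∈ P)).erase 0 := by
      ext y
      simp only [mem_filter, mem_erase, mem_univ, true_and, hD]
      constructor
      · rintro ⟨⟨⟨hy0, -⟩, -⟩, rfl⟩
        exact ⟨hy0, Submodule.mem_span_singleton_self y⟩
      · rintro ⟨hy0, hyP⟩
        have hspan : Submodule.span K {y} = P := by
          refine Submodule.eq_of_le_of_finrank_eq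
            ((Submodule.span_singleton_le_iff_mem _ _).2 hyP) ?_
          rw [finrank_span_singleton hy0, hM P hPM]
        exact ⟨⟨⟨hy0, hspan ▸ hPM⟩, hPW hyP⟩, hspan⟩
    rw [hset, card_erase_of_mem (by simp), card_filter_mem_submodule, hM P hPM, pow_one]
  · intro y hy
    simp only [coe_filter, Set.mem_ofPred_eq, hD] at hy
    simpa using And.intro hy.1.2 hy.2

end CharacterSums

/-- **Result 2.2.** A set `M` of `m(q^3+1)` points of the elliptic quadric `Q⁻(5,q)`
(modelled in `F_{q^6}` with `Q(x) = Tr_{q^3/q}(x^{q^3+1})`) is an `m`-ovoid if and only if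
the set `D = {λx : λ ∈ F_q^×, ⟨x⟩ ∈ M}` has the prescribed canonical additive character
sums. -/
theorem m_ovoid_iff_character_values
    (p n q : ℕ) (hp : p.Prime) (hn : 0 < n) (hqpn : q = p ^ n)
    (m : ℕ) (hm : 1 ≤ m)
    (K L : Type) [Field K] [Fintype K] [Field L] [Fintype L] [Algebra K L]
    [Algebra (ZMod p) L]
    (hK : Fintype.card K = q) (hL : Fintype.card L = q ^ 6)
    (M : Set (Submodule K L))
    (hMpts : ∀ P ∈ M, Module.finrank K P = 1 ∧
      ∀ x ∈ P, x ^ (q ^ 3 + 1) + x ^ ((q ^ 3 + 1) * q) + x ^ ((q ^ 3 + 1) * q ^ 2) = 0)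
    (hMcard : M.ncard = m * (q ^ 3 + 1))
    (D : Finset L)
    (hD : ∀ y : L, y ∈ D ↔
      ∃ l : K, l ≠ 0 ∧ ∃ x : L, Submodule.span K {x} ∈ M ∧ y = algebraMap K L l * x) :
    (∀ W : Submodule K L, Module.finrank K W = 2 →
        (∀ x ∈ W, x ^ (q ^ 3 + 1) + x ^ ((q ^ 3 + 1) * q) + x ^ ((q ^ 3 + 1) * q ^ 2) = 0) →
        {P ∈ M | P ≤ W}.ncard = m) ↔
      (∀ a : L, a ≠ 0 →
        (∑ x ∈ D, Complex.exp (2 * Real.pi * Complex.I *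
            ((Algebra.trace (ZMod p) L (a * x)).val : ℂ) / p)) =
          if a ^ (q ^ 3) ∈ D then -(q : ℂ) ^ 3 + (m : ℂ) * ((q : ℂ) - 1)
          else (m : ℂ) * ((q : ℂ) - 1)) := by
  subst hK
  obtain ⟨Q, hQ, hpol⟩ := exists_ellipticForm hL
  have hE := isElliptic_ellipticForm hL hQ hpol
  obtain ⟨ψ, hψ, hψexp, hsum⟩ := exists_canonicalAddChar (K := K) (L := L) hp
  have hQ0 : ∀ x : L, Q x = 0 ↔ x ^ (Fintype.card K ^ 3 + 1) +
      x ^ ((Fintype.card K ^ 3 + 1) * Fintype.card K) +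
      x ^ ((Fintype.card K ^ 3 + 1) * Fintype.card K ^ 2) = 0 := fun x => by
    rw [← map_eq_zero (algebraMap K L), hQ, ellipticExpr]
  simp_rw [← hQ0] at hMpts ⊢
  have hspan0 : ∀ x : L, Submodule.span K {x} ∈ M → x ≠ 0 := by
    rintro x hx rfl
    have h := (hMpts _ hx).1
    rw [Submodule.span_zero_singleton, finrank_bot] at h
    exact zero_ne_one h
  have hD' : ∀ y, y ∈ D ↔ y ≠ 0 ∧ Submodule.span K {y} ∈ M := by
    intro y
    rw [hD]
    constructor
    · rintro ⟨l, hl, x, hx, rfl⟩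
      rw [← Algebra.smul_def, Submodule.span_singleton_smul_eq hl.isUnit]
      exact ⟨smul_ne_zero hl (hspan0 x hx), hx⟩
    · rintro ⟨-, hy⟩
      exact ⟨1, one_ne_zero, y, hy, by simp⟩
  have hDsmul : ∀ (c : K) (x : L), c ≠ 0 → x ∈ D → c • x ∈ D := by
    intro c x hc hx
    rw [hD'] at hx ⊢
    rw [Submodule.span_singleton_smul_eq hc.isUnit]
    exact ⟨smul_ne_zero hc hx.1, hx.2⟩
  have hDQ : ∀ x ∈ D, x ≠ 0 ∧ Q x = 0 := by
    intro x hx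
    rw [hD'] at hx
    exact ⟨hx.1, (hMpts _ hx.2).2 x (Submodule.mem_span_singleton_self x)⟩
  have hcard := card_filter_mem_eq_mul_ncard (fun P hP => (hMpts P hP).1) hD'
  have hq : 1 < Fintype.card K := Fintype.one_lt_card
  have hDcard : D.card = (m * (Fintype.card K - 1)) * (Fintype.card K ^ 3 + 1) := by
    have h := hcard ⊤
    simp only [Submodule.mem_top, Finset.filter_true, le_top, and_true, Set.ofPred_mem_eq,
      hMcard] at h
    rw [h]
    ring
  have hmain := forall_line_iff_charSum hL hE hpol hψ hsum hDsmul hDQ hDcard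
  have hcast : ((m * (Fintype.card K - 1) : ℕ) : ℂ) = m * ((Fintype.card K : ℂ) - 1) := by
    rw [Nat.cast_mul, Nat.cast_sub hq.le, Nat.cast_one]
  simp_rw [hcard, Nat.mul_left_inj (Nat.sub_ne_zero_of_lt hq), hcast, hψexp] at hmain
  exact hmain
end

section
/- Let q be an odd prime power and let z be a nonzero element of F_{q^3}. Let n(z) be the number of one-dimensional F_q-subspaces of F_{q^3} spanned by elements y with Tr_{q^3/q}(zy) = 0 and Tr_{q^3/q}(y^2) = 0. Then: n(z) = 1 if Tr_{q^3/q}(z^2) = 0; n(z) = 2 if Tr_{q^3/q}(z^2) is a nonzero element of F_q with sgn(Tr_{q^3/q}(z^2)) = ε; and n(z) = 0 if sgn(Tr_{q^3/q}(z^2)) = -ε. Here ε = 1 if q ≡ 1 (mod 4) and ε = -1 if q ≡ 3 (mod 4). (Equivalently: the polarity of PG(2,q) induced by the conic Tr_{q^3/q}(x^2) = 0 maps conic points to tangent lines, exterior points to secant lines, and interior points to exterior lines.) -/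
open scoped Classical

namespace ConicPolarity

open Module

variable {K L : Type*} [Field K] [Field L] [Algebra K L]

/-- The vector product with `z` on a cyclic cubic extension: in the coordinates `(x, σ x, σ² x)`
it is the usual cross product. -/
def cross (σ : L →ₐ[K] L) (x z : L) : L := σ x * σ (σ z) - σ (σ x) * σ z

/-- An endomorphism `σ` of `L` behaving as a generator of a cyclic cubic Galois group. -/
structure IsCubicGenerator (σ : L →ₐ[K] L) : Prop where
  cube : ∀ x, σ (σ (σ x)) = x
  trace : ∀ x, algebraMap K L (Algebra.trace K L x) = x + σ x + σ (σ x)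
  fixed : ∀ x, σ x = x → ∃ k : K, algebraMap K L k = x

variable {σ : L →ₐ[K] L}

namespace IsCubicGenerator

lemma exists_eq_mul (h : IsCubicGenerator σ) {x y : L} (hy : y ≠ 0) (hxy : cross σ x y = 0) :
    ∃ k : K, x = algebraMap K L k * y := by
  obtain ⟨k, hk⟩ := h.fixed (x / y) (by
    have h1 : σ y ≠ 0 := by simpa using hy
    have h2 : σ (σ y) ≠ 0 := by simpa using hy
    apply σ.injective
    apply σ.injective
    change σ (σ (σ (x / y))) = σ (σ (x / y))
    rw [h.cube, map_div₀, map_div₀]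
    have := congrArg σ hxy
    simp only [cross, map_sub, map_mul, h.cube, map_zero] at this
    field_simp
    linear_combination -this)
  exact ⟨k, by rw [hk]; field_simp⟩

lemma cross_cross (h : IsCubicGenerator σ) (x z : L) :
    cross σ (cross σ x z) z = z * algebraMap K L (Algebra.trace K L (z * x)) -
      x * algebraMap K L (Algebra.trace K L (z ^ 2)) := by
  simp only [cross, h.trace, map_sub, map_mul, map_pow, h.cube]
  ring

lemma exists_cross_eq (h : IsCubicGenerator σ) {y z : L} (hy : y ≠ 0)
    (hzy : Algebra.trace K L (z * y) = 0) (hyy : Algebra.trace K L (y ^ 2) = 0) :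
    ∃ c : K, c ^ 2 = -Algebra.trace K L (z ^ 2) ∧ cross σ y z = algebraMap K L c * y := by
  have h1 := congrArg (algebraMap K L) hzy
  have h2 := congrArg (algebraMap K L) hyy
  simp only [h.trace, map_mul, map_pow, map_zero] at h1 h2
  obtain ⟨c, hc⟩ := h.exists_eq_mul (x := cross σ y z) hy (by
    simp only [cross, map_sub, map_mul, h.cube]
    linear_combination z * h2 - y * h1)
  refine ⟨c, ?_, hc⟩
  have h3 := h.cross_cross y z
  have h4 : cross σ (algebraMap K L c * y) z = algebraMap K L c * cross σ y z := by
    simp only [cross, map_mul, AlgHom.commutes]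
    ring
  rw [hc, h4, hc, hzy] at h3
  apply (algebraMap K L).injective
  apply mul_right_cancel₀ hy
  simp only [map_pow, map_neg, map_zero] at h3 ⊢
  linear_combination h3

lemma trace_mul_eq_zero_of_cross_eq (h : IsCubicGenerator σ) {y z : L} {c : K} (hc : c ≠ 0)
    (hy : cross σ y z = algebraMap K L c * y) : Algebra.trace K L (z * y) = 0 := by
  have h1 := congrArg σ hy
  have h2 := congrArg σ h1
  simp only [cross, map_sub, map_mul, h.cube, AlgHom.commutes] at hy h1 h2
  apply (algebraMap K L).injective
  have hc' : algebraMap K L c ≠ 0 := by simpa using hc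
  apply mul_left_cancel₀ hc'
  simp only [h.trace, map_mul, map_zero]
  linear_combination -z * hy - σ z * h1 - σ (σ z) * h2

lemma trace_sq_eq_zero_of_cross_eq (h : IsCubicGenerator σ) (h2K : (2 : K) ≠ 0) {y z : L} {c : K}
    (hc : c ≠ 0) (hcz : c ^ 2 = -Algebra.trace K L (z ^ 2))
    (hy : cross σ y z = algebraMap K L c * y) : Algebra.trace K L (y ^ 2) = 0 := by
  have h0 := congrArg (algebraMap K L) (h.trace_mul_eq_zero_of_cross_eq hc hy)
  have hcz' := congrArg (algebraMap K L) hcz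
  have h1 := congrArg σ hy
  have h2 := congrArg σ h1
  have e0 := congrArg (· ^ 2) hy
  have e1 := congrArg (· ^ 2) h1
  have e2 := congrArg (· ^ 2) h2
  simp only [cross, map_sub, map_mul, h.cube, AlgHom.commutes] at e0 e1 e2
  simp only [map_neg, h.trace, map_mul, map_pow, map_zero] at h0 hcz'
  apply (algebraMap K L).injective
  have hc' : algebraMap K L (2 * c ^ 2) ≠ 0 := by simpa using And.intro (by
    simpa using (map_ne_zero (algebraMap K L)).2 h2K) hc
  apply mul_left_cancel₀ hc'
  simp only [h.trace, map_mul, map_pow, map_zero, map_ofNat]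
  linear_combination (y ^ 2 + σ y ^ 2 + σ (σ y) ^ 2) * hcz' - e0 - e1 - e2 -
    (z * y + σ z * σ y + σ (σ z) * σ (σ y)) * h0

lemma cross_eq_zero_of_cross_eq (h : IsCubicGenerator σ) (h2K : (2 : K) ≠ 0) {x y z : L} {c : K}
    (hc : c ≠ 0) (hx : cross σ x z = algebraMap K L c * x)
    (hy : cross σ y z = algebraMap K L c * y) : cross σ x y = 0 := by
  have hxz := congrArg (algebraMap K L) (h.trace_mul_eq_zero_of_cross_eq hc hx)
  have hyz := congrArg (algebraMap K L) (h.trace_mul_eq_zero_of_cross_eq hc hy)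
  have x1 := congrArg σ hx
  have x2 := congrArg σ x1
  have y1 := congrArg σ hy
  have y2 := congrArg σ y1
  simp only [cross, map_sub, map_mul, h.cube, AlgHom.commutes] at x1 x2 y1 y2
  simp only [h.trace, map_mul, map_zero] at hxz hyz
  have hc' : algebraMap K L (2 * c) ≠ 0 := by simpa using And.intro (by
    simpa using (map_ne_zero (algebraMap K L)).2 h2K) hc
  apply mul_left_cancel₀ hc'
  simp only [cross, map_mul, map_ofNat]
  linear_combination -σ (σ y) * x1 + σ y * x2 - σ x * y2 + σ (σ x) * y1 - x * hyz + y * hxz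

lemma exists_cross_eq_mul (h : IsCubicGenerator σ) (h2K : (2 : K) ≠ 0) (hL : finrank K L = 3)
    {z : L} {c : K} (hc : c ≠ 0) (hcz : c ^ 2 = -Algebra.trace K L (z ^ 2)) :
    ∃ w : L, w ≠ 0 ∧ cross σ w z = algebraMap K L c * w := by
  have : FiniteDimensional K L := FiniteDimensional.of_finrank_pos (by omega)
  by_contra! hne
  let f : L →ₗ[K] K := Algebra.trace K L ∘ₗ LinearMap.mulLeft K z
  have key : ∀ u ∈ LinearMap.ker f, cross σ u z = algebraMap K L (-c) * u := by
    intro u hu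
    have hu' : Algebra.trace K L (z * u) = 0 := hu
    by_contra hv
    apply hne (cross σ u z + algebraMap K L c * u)
    · intro h0
      apply hv
      rw [map_neg]
      linear_combination h0
    · have h1 := h.cross_cross u z
      have h2 : cross σ (cross σ u z + algebraMap K L c * u) z =
          cross σ (cross σ u z) z + algebraMap K L c * cross σ u z := by
        simp only [cross, map_mul, map_add, AlgHom.commutes]
        ring
      have h3 := congrArg (algebraMap K L) hcz
      rw [hu', map_zero] at h1
      rw [h2, h1]
      rw [map_pow, map_neg] at h3
      linear_combination -u * h3
  have hker : 2 ≤ finrank K (LinearMap.ker f) := by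
    have h1 := f.finrank_range_add_finrank_ker
    have h2 := (LinearMap.range f).finrank_le
    rw [finrank_self] at h2
    omega
  obtain ⟨w, hw, hw0⟩ := (LinearMap.ker f).exists_mem_ne_zero_of_ne_bot (by
    intro h0
    rw [h0, finrank_bot] at hker
    omega)
  have hle : LinearMap.ker f ≤ Submodule.span K {w} := by
    intro u hu
    obtain ⟨k, hk⟩ := h.exists_eq_mul hw0
      (h.cross_eq_zero_of_cross_eq h2K (neg_ne_zero.2 hc) (key u hu) (key w hw))
    exact Submodule.mem_span_singleton.2 ⟨k, by rw [hk, Algebra.smul_def]⟩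
  have h1 := Submodule.finrank_mono hle
  rw [finrank_span_singleton hw0] at h1
  omega

end IsCubicGenerator

/-- The points of the conic `Tr (y ^ 2) = 0` on the line `Tr (z * y) = 0`. -/
def linePoints (K : Type*) {L : Type*} [Field K] [Field L] [Algebra K L] (z : L) :
    Set (Submodule K L) :=
  {P | finrank K P = 1 ∧ ∃ y : L, P = Submodule.span K {y} ∧
    Algebra.trace K L (z * y) = 0 ∧ Algebra.trace K L (y ^ 2) = 0}

lemma mem_linePoints {z : L} {P : Submodule K L} :
    P ∈ linePoints K z ↔ ∃ y : L, y ≠ 0 ∧ P = Submodule.span K {y} ∧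
      Algebra.trace K L (z * y) = 0 ∧ Algebra.trace K L (y ^ 2) = 0 := by
  constructor
  · rintro ⟨h1, y, rfl, h⟩
    refine ⟨y, ?_, rfl, h⟩
    rintro rfl
    rw [Submodule.span_zero_singleton, finrank_bot] at h1
    exact zero_ne_one h1
  · rintro ⟨y, hy, rfl, h⟩
    exact ⟨finrank_span_singleton hy, y, rfl, h⟩

lemma span_mul_eq {x y : L} (hx : x ≠ 0) {k : K} (hk : x = algebraMap K L k * y) :
    Submodule.span K {x} = Submodule.span K {y} := by
  rw [hk, ← Algebra.smul_def]
  refine Submodule.span_singleton_smul_eq (IsUnit.mk0 k ?_) y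
  rintro rfl
  simp [hx] at hk

namespace IsCubicGenerator

lemma ncard_linePoints_of_eq_zero (h : IsCubicGenerator σ) {z : L} (hz : z ≠ 0)
    (ha : Algebra.trace K L (z ^ 2) = 0) : (linePoints K z).ncard = 1 := by
  rw [Set.ncard_eq_one]
  refine ⟨Submodule.span K {z}, Set.eq_singleton_iff_unique_mem.2 ⟨?_, ?_⟩⟩
  · exact mem_linePoints.2 ⟨z, hz, rfl, by rw [← sq, ha], ha⟩
  · intro P hP
    obtain ⟨y, hy, rfl, h1, h2⟩ := mem_linePoints.1 hP
    obtain ⟨c, hc, hcy⟩ := h.exists_cross_eq hy h1 h2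
    obtain rfl : c = 0 := by simpa [ha] using hc
    obtain ⟨k, hk⟩ := h.exists_eq_mul hz (by simpa using hcy)
    exact span_mul_eq hy hk

lemma ncard_linePoints_of_not_isSquare (h : IsCubicGenerator σ) {z : L}
    (ha : ¬ IsSquare (-Algebra.trace K L (z ^ 2))) : (linePoints K z).ncard = 0 := by
  suffices linePoints K z = ∅ by rw [this, Set.ncard_empty]
  refine Set.eq_empty_iff_forall_notMem.2 fun P hP ↦ ?_
  obtain ⟨y, hy, rfl, h1, h2⟩ := mem_linePoints.1 hP
  obtain ⟨c, hc, -⟩ := h.exists_cross_eq hy h1 h2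
  exact ha ⟨c, by rw [← hc, sq]⟩

lemma ncard_linePoints_of_isSquare (h : IsCubicGenerator σ) (h2K : (2 : K) ≠ 0)
    (hL : finrank K L = 3) {z : L} (ha : Algebra.trace K L (z ^ 2) ≠ 0)
    (hsq : IsSquare (-Algebra.trace K L (z ^ 2))) : (linePoints K z).ncard = 2 := by
  obtain ⟨c, hc⟩ := hsq
  rw [← sq] at hc
  have hc0 : c ≠ 0 := by
    rintro rfl
    simp [ha] at hc
  have hc0' : -c ≠ 0 := neg_ne_zero.2 hc0
  have hc' : (-c) ^ 2 = -Algebra.trace K L (z ^ 2) := by rw [hc, neg_sq]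
  obtain ⟨v, hv, hvc⟩ := h.exists_cross_eq_mul h2K hL hc0 hc.symm
  obtain ⟨w, hw, hwc⟩ := h.exists_cross_eq_mul h2K hL hc0' hc'
  rw [Set.ncard_eq_two]
  refine ⟨Submodule.span K {v}, Submodule.span K {w}, ?_, ?_⟩
  · intro hvw
    obtain ⟨k, hk⟩ := Submodule.mem_span_singleton.1
      (hvw ▸ Submodule.mem_span_singleton_self v : v ∈ Submodule.span K {w})
    rw [Algebra.smul_def] at hk
    have h1 : cross σ (algebraMap K L k * w) z = algebraMap K L k * cross σ w z := by
      simp only [cross, map_mul, AlgHom.commutes]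
      ring
    rw [hk, hvc, hwc, map_neg] at h1
    have h2 : algebraMap K L (2 * c) * v = 0 := by
      rw [map_mul, map_ofNat]
      linear_combination h1 - algebraMap K L c * hk
    simp [hv, hc0, h2K] at h2
  · ext P
    rw [Set.mem_insert_iff, Set.mem_singleton_iff, mem_linePoints]
    constructor
    · rintro ⟨y, hy, rfl, h1, h2⟩
      obtain ⟨d, hd, hdy⟩ := h.exists_cross_eq hy h1 h2
      rw [hc, sq_eq_sq_iff_eq_or_eq_neg] at hd
      rcases hd with rfl | rfl
      · obtain ⟨k, hk⟩ := h.exists_eq_mul hv (h.cross_eq_zero_of_cross_eq h2K hc0 hdy hvc)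
        exact Or.inl (span_mul_eq hy hk)
      · obtain ⟨k, hk⟩ := h.exists_eq_mul hw (h.cross_eq_zero_of_cross_eq h2K hc0' hdy hwc)
        exact Or.inr (span_mul_eq hy hk)
    · rintro (rfl | rfl)
      · exact ⟨v, hv, rfl, h.trace_mul_eq_zero_of_cross_eq hc0 hvc,
          h.trace_sq_eq_zero_of_cross_eq h2K hc0 hc.symm hvc⟩
      · exact ⟨w, hw, rfl, h.trace_mul_eq_zero_of_cross_eq hc0' hwc,
          h.trace_sq_eq_zero_of_cross_eq h2K hc0' hc' hwc⟩

end IsCubicGenerator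

lemma isCubicGenerator_frobenius (K L : Type*) [Field K] [Fintype K] [Field L] [Finite L]
    [Algebra K L] (hL : finrank K L = 3) :
    IsCubicGenerator (FiniteField.frobeniusAlgHom K L) where
  cube x := by
    have h := pow_orderOf_eq_one (FiniteField.frobeniusAlgHom K L)
    rw [FiniteField.orderOf_frobeniusAlgHom, hL] at h
    exact DFunLike.congr_fun h x
  trace x := by
    rw [FiniteField.algebraMap_trace_eq_sum_pow, hL]
    simp [Finset.sum_range_succ, ← pow_mul, sq]
  fixed x hx := by
    have hbot : x ∈ (⊥ : IntermediateField K L) := by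
      rw [IsGalois.mem_bot_iff_fixed]
      intro f
      obtain ⟨n, rfl⟩ := (FiniteField.bijective_frobeniusAlgEquivOfAlgebraic_pow K L).2 f
      rw [AlgEquiv.coe_pow]
      exact Function.iterate_fixed hx _
    exact IntermediateField.mem_bot.1 hbot

end ConicPolarity

/-- **Lemma 3.1(1) (reformulated).** Let `q` be an odd prime power and `z ≠ 0` in `F_{q^3}`,
and let `n(z)` count the points of the conic `Tr_{q^3/q}(y²) = 0` on the line
`Tr_{q^3/q}(zy) = 0` of `PG(2,q)`. Then `n(z) = 1` if `Tr(z²) = 0`; `n(z) = 2` if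
`sgn(Tr(z²)) = ε`; and `n(z) = 0` if `sgn(Tr(z²)) = -ε`, where `ε = 1` for `q ≡ 1 (mod 4)`
and `ε = -1` for `q ≡ 3 (mod 4)`. -/
theorem conic_polarity
    (q : ℕ) (hq : IsPrimePow q) (hqodd : Odd q)
    (K M3 : Type) [Field K] [Fintype K] [Field M3] [Fintype M3] [Algebra K M3]
    (hK : Fintype.card K = q) (hM3 : Fintype.card M3 = q ^ 3)
    (z : M3) (hz : z ≠ 0) :
    (Algebra.trace K M3 (z ^ 2) = 0 →
      {P : Submodule K M3 | Module.finrank K P = 1 ∧ ∃ y : M3, P = Submodule.span K {y} ∧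
        Algebra.trace K M3 (z * y) = 0 ∧ Algebra.trace K M3 (y ^ 2) = 0}.ncard = 1) ∧
    (Algebra.trace K M3 (z ^ 2) ≠ 0 → IsSquare (Algebra.trace K M3 (z ^ 2)) →
      {P : Submodule K M3 | Module.finrank K P = 1 ∧ ∃ y : M3, P = Submodule.span K {y} ∧
        Algebra.trace K M3 (z * y) = 0 ∧ Algebra.trace K M3 (y ^ 2) = 0}.ncard =
          if q % 4 = 1 then 2 else 0) ∧
    (¬ IsSquare (Algebra.trace K M3 (z ^ 2)) →
      {P : Submodule K M3 | Module.finrank K P = 1 ∧ ∃ y : M3, P = Submodule.span K {y} ∧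
        Algebra.trace K M3 (z * y) = 0 ∧ Algebra.trace K M3 (y ^ 2) = 0}.ncard =
          if q % 4 = 1 then 0 else 2) := by
  open ConicPolarity in
  have hL : Module.finrank K M3 = 3 := by
    have h := Module.card_eq_pow_finrank (K := K) (V := M3)
    rw [hM3, hK] at h
    exact (Nat.pow_right_injective hq.two_le h).symm
  have hchar : ringChar K ≠ 2 := fun h ↦ by
    have := FiniteField.even_card_of_char_two h
    rw [hK] at this
    have := Nat.odd_iff.1 hqodd
    omega
  have h2K : (2 : K) ≠ 0 := Ring.two_ne_zero hchar
  have h := isCubicGenerator_frobenius K M3 hL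
  have hmod : q % 4 = 1 ∨ q % 4 = 3 := by
    have := Nat.odd_iff.1 hqodd
    omega
  have hneg : IsSquare (-1 : K) ↔ q % 4 ≠ 3 := hK ▸ FiniteField.isSquare_neg_one_iff
  change (_ → (linePoints K z).ncard = 1) ∧ (_ → _ → (linePoints K z).ncard = _) ∧
    (_ → (linePoints K z).ncard = _)
  have hmul : ∀ x : K, x ≠ 0 → (IsSquare (-x) ↔ (IsSquare x ↔ q % 4 = 1)) := by
    intro x hx
    have hx' := quadraticChar_dichotomy hx
    have h1' := quadraticChar_dichotomy (neg_ne_zero.2 (one_ne_zero (α := K)))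
    have h1 : IsSquare (-1 : K) ↔ q % 4 = 1 := by rw [hneg]; omega
    rw [← h1, ← quadraticChar_one_iff_isSquare hx,
      ← quadraticChar_one_iff_isSquare (neg_ne_zero.2 hx),
      ← quadraticChar_one_iff_isSquare (neg_ne_zero.2 (one_ne_zero (α := K))),
      ← neg_one_mul x, map_mul]
    rcases hx' with h | h <;> rcases h1' with h' | h' <;> rw [h, h'] <;> norm_num
  refine ⟨h.ncard_linePoints_of_eq_zero hz, fun ha hsq ↦ ?_, fun hsq ↦ ?_⟩
  · split_ifs with h4
    · exact h.ncard_linePoints_of_isSquare h2K hL ha ((hmul _ ha).2 (by tauto))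
    · exact h.ncard_linePoints_of_not_isSquare (by rw [hmul _ ha]; tauto)
  · have ha : Algebra.trace K M3 (z ^ 2) ≠ 0 := fun h0 ↦ hsq (h0 ▸ IsSquare.zero)
    split_ifs with h4
    · exact h.ncard_linePoints_of_not_isSquare (by rw [hmul _ ha]; tauto)
    · exact h.ncard_linePoints_of_isSquare h2K hL ha ((hmul _ ha).2 (by tauto))
end
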